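/- Let L be a link in a 3-manifold M whose complement M∖L admits a complete hyperbolic metric of finite volume, and let α be an arc with endpoints on L whose interior is a complete properly embedded geodesic of M∖L. Then α cannot be homotoped through M∖L into L while fixing its endpoints on L. -/

import Mathlib

open Metric MeasureTheory Set ENNReal

noncomputable section

/-- Euclidean 2-space. -/
abbrev E2 : Type := EuclideanSpace ℝ (Fin 2)
/-- Euclidean 3-space. -/
abbrev E3 : Type := EuclideanSpace ℝ (Fin 3)

/-- The model circle: the unit circle in the Euclidean plane. -/
def ModelCircle : Set E2 := sphere (0 : E2) 1

/-- The 3-sphere, realized as the unit sphere in Euclidean 4-space. -/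
abbrev S3 : Type := ↥(sphere (0 : EuclideanSpace ℝ (Fin 4)) 1)

/-- Inverse hyperbolic cosine. -/
def arcosh (t : ℝ) : ℝ := Real.log (t + Real.sqrt (t ^ 2 - 1))

/-- The hyperbolic distance between two points of the upper half-space model
`{x : E3 | 0 < x 2}` of hyperbolic 3-space `ℍ³`. -/
def hypDist (x y : E3) : ℝ := arcosh (1 + dist x y ^ 2 / (2 * x 2 * y 2))

/-- A metric space is locally hyperbolic if every point has a metric ball on which
the metric agrees, via some chart, with the upper half-space model of `ℍ³`. -/
def IsLocallyHyperbolic (X : Type*) [MetricSpace X] : Prop :=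
  ∀ x : X, ∃ ε > 0, ∃ f : X → E3,
    (∀ y ∈ ball x ε, 0 < f y 2) ∧
    ∀ y ∈ ball x ε, ∀ z ∈ ball x ε, hypDist (f y) (f z) = dist y z

/-- The (hyperbolic) volume of a metric space: its 3-dimensional Hausdorff measure. -/
def hypVolume (X : Type*) [MetricSpace X] : ℝ≥0∞ :=
  letI : MeasurableSpace X := borel X
  haveI : BorelSpace X := ⟨rfl⟩
  μH[3] (univ : Set X)

/-- `m` is a complete hyperbolic metric of finite volume on the topological space `X`,
inducing the topology of `X`. -/
def IsCompleteHyperbolicMetricOfFiniteVolume (X : Type*) [t : TopologicalSpace X]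
    (m : MetricSpace X) : Prop :=
  @UniformSpace.toTopologicalSpace X
      (@PseudoMetricSpace.toUniformSpace X m.toPseudoMetricSpace) = t ∧
  @CompleteSpace X (@PseudoMetricSpace.toUniformSpace X m.toPseudoMetricSpace) ∧
  @IsLocallyHyperbolic X m ∧
  @hypVolume X m < ⊤

/-- The topological space `X` admits a complete hyperbolic metric of finite volume. -/
def CompleteHyperbolicFiniteVolume (X : Type*) [TopologicalSpace X] : Prop :=
  ∃ m : MetricSpace X, IsCompleteHyperbolicMetricOfFiniteVolume X m

/-- The complement of `L` in `M` admits a complete hyperbolic metric of finite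
volume (`M ∖ L` is hyperbolic). -/
def HyperbolicComplement (M : Type*) [TopologicalSpace M] (L : Set M) : Prop :=
  CompleteHyperbolicFiniteVolume (↥(Lᶜ))

/-- `L` is a (tame) link in `M`: a finite disjoint union of embedded circles,
closedly embedded in `M`. -/
def IsLink (M : Type*) [TopologicalSpace M] (L : Set M) : Prop :=
  ∃ n : ℕ, ∃ f : Fin n × ↥ModelCircle → M, Topology.IsClosedEmbedding f ∧ range f = L

/-- `a` is an embedded arc in `M`. -/
def IsArc (M : Type*) [TopologicalSpace M] (a : Set M) : Prop :=
  ∃ f : ↥(Icc (0:ℝ) 1) → M, Topology.IsEmbedding f ∧ range f = a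

/-- `c` is an embedded circle in `M`. -/
def IsCircleSet (M : Type*) [TopologicalSpace M] (c : Set M) : Prop :=
  ∃ f : ↥ModelCircle → M, Topology.IsEmbedding f ∧ range f = c

/-- `D` is an embedded disk in `M`. -/
def IsDiskSet (M : Type*) [TopologicalSpace M] (D : Set M) : Prop :=
  ∃ f : ↥(closedBall (0:E2) 1) → M, Topology.IsEmbedding f ∧ range f = D

/-- `B` is a tame closed ball in `M`, with boundary sphere `S`. -/
def IsTameBallWithSphere (M : Type*) [TopologicalSpace M] (B S : Set M) : Prop :=
  ∃ f : E3 → M, Topology.IsEmbedding f ∧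
    f '' closedBall (0:E3) 1 = B ∧ f '' sphere (0:E3) 1 = S

/-- `S` is an embedded 2-sphere in `M`. -/
def IsEmbeddedSphere (M : Type*) [TopologicalSpace M] (S : Set M) : Prop :=
  ∃ f : ↥(sphere (0:E3) 1) → M, Topology.IsEmbedding f ∧ range f = S

/-- The sphere `S` bounds an embedded closed 3-ball contained in `W`. -/
def BoundsABallIn (M : Type*) [TopologicalSpace M] (W S : Set M) : Prop :=
  ∃ f : ↥(closedBall (0:E3) 1) → M, Topology.IsEmbedding f ∧ range f ⊆ W ∧
    f '' {x : ↥(closedBall (0:E3) 1) | ‖(x : E3)‖ = 1} = S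

/-- `D` is an embedded disk in `M` with boundary circle `C`, meeting each of `P₁`
and `P₂` exactly once, in interior points of the disk: a disk bounded by `C` and
punctured once by each of `P₁` and `P₂`. -/
def BoundsTwicePuncturedDisk (M : Type*) [TopologicalSpace M] (C D P₁ P₂ : Set M) : Prop :=
  ∃ f : E2 → M, Topology.IsEmbedding f ∧
    f '' closedBall (0:E2) 1 = D ∧ f '' sphere (0:E2) 1 = C ∧
    (∃! p, p ∈ D ∩ P₁) ∧ (∃! p, p ∈ D ∩ P₂) ∧
    D ∩ P₁ ⊆ f '' ball (0:E2) 1 ∧ D ∩ P₂ ⊆ f '' ball (0:E2) 1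

/-- `N` is a (closed) tubular neighborhood of the link `L`: a finite disjoint union
of solid tori with core `L`. -/
def IsTubularNeighborhood (M : Type*) [TopologicalSpace M] (L N : Set M) : Prop :=
  ∃ n : ℕ, ∃ f : Fin n × ↥ModelCircle × ↥(closedBall (0:E2) 1) → M,
    Topology.IsClosedEmbedding f ∧ range f = N ∧
    f '' {p | (p.2.2 : E2) = 0} = L

/-- `E` is a compression disk for the surface `S`, contained in the region `W`:
an embedded disk meeting `S` exactly in its boundary circle, whose boundary is
homotopically nontrivial in `S`. -/
def IsCompressionDiskIn (M : Type*) [TopologicalSpace M] (W S E : Set M) : Prop :=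
  E ⊆ W ∧ ∃ f : E2 → M, Topology.IsEmbedding f ∧
    f '' closedBall (0:E2) 1 = E ∧ E ∩ S = f '' sphere (0:E2) 1 ∧
    ∀ c : C(↥ModelCircle, ↥S), (∀ x : ↥ModelCircle, (c x : M) = f ↑x) →
      ¬ ∃ y : ↥S, c.Homotopic (ContinuousMap.const _ y)

/-- The surface `S` is incompressible in the region `W`. -/
def IncompressibleIn (M : Type*) [TopologicalSpace M] (W S : Set M) : Prop :=
  ∀ E : Set M, ¬ IsCompressionDiskIn M W S E

/-- `E` is a boundary-compression disk for the surface `S` in the region `W` with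
boundary `Bd`: `∂E = a ∪ b` with `a = E ∩ S`, `b = E ∩ Bd` arcs meeting only at
their endpoints, such that `a` does not cut a disk from `S`. -/
def IsBoundaryCompressionDiskIn (M : Type*) [TopologicalSpace M] (W S Bd E : Set M) : Prop :=
  E ⊆ W ∧ ∃ f : E2 → M, Topology.IsEmbedding f ∧ f '' closedBall (0:E2) 1 = E ∧
    ∃ a b : Set M, IsArc M a ∧ IsArc M b ∧
      f '' sphere (0:E2) 1 = a ∪ b ∧ E ∩ S = a ∧ E ∩ Bd = b ∧
      (a ∩ b).ncard = 2 ∧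
      ¬ ∃ g : E2 → M, Topology.IsEmbedding g ∧ g '' closedBall (0:E2) 1 ⊆ S ∧
          a ⊆ g '' sphere (0:E2) 1

/-- The surface `S` is boundary-incompressible in the region `W` with boundary `Bd`. -/
def BoundaryIncompressibleIn (M : Type*) [TopologicalSpace M] (W S Bd : Set M) : Prop :=
  ∀ E : Set M, ¬ IsBoundaryCompressionDiskIn M W S Bd E

/-- `A` is a properly embedded annulus in the region `W` whose boundary circles lie
on `Bd`. -/
def IsProperAnnulusIn (M : Type*) [TopologicalSpace M] (W Bd A : Set M) : Prop :=
  A ⊆ W ∧ ∃ f : ↥ModelCircle × ↥(Icc (0:ℝ) 1) → M, Topology.IsEmbedding f ∧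
    range f = A ∧ A ∩ Bd = f '' {q | (q.2 : ℝ) = 0 ∨ (q.2 : ℝ) = 1}

/-- `T` is an embedded torus contained in the region `W`. -/
def IsEmbeddedTorusIn (M : Type*) [TopologicalSpace M] (W T : Set M) : Prop :=
  T ⊆ W ∧ ∃ f : ↥ModelCircle × ↥ModelCircle → M, Topology.IsEmbedding f ∧ range f = T

/-- The annulus `A` is boundary-parallel in the region `W`: it can be isotoped,
relative to its boundary `A ∩ Bd` and staying inside `W`, into `Bd`. -/
def AnnulusBoundaryParallelIn (M : Type*) [TopologicalSpace M] (W Bd A : Set M) : Prop :=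
  ∃ F : ℝ → ↥A → M,
    Continuous (fun q : ℝ × ↥A => F q.1 q.2) ∧
    (∀ a, F 0 a = ↑a) ∧
    (∀ t, Function.Injective (F t)) ∧
    (∀ t a, F t a ∈ W) ∧
    (∀ t, ∀ a : ↥A, (↑a : M) ∈ Bd → F t a = ↑a) ∧
    (∀ a, F 1 a ∈ Bd)

/-- The torus `T` is boundary-parallel in the region `W`: it can be isotoped,
staying inside `W`, into the boundary `Bd`. -/
def TorusBoundaryParallelIn (M : Type*) [TopologicalSpace M] (W Bd T : Set M) : Prop :=
  ∃ F : ℝ → ↥T → M,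
    Continuous (fun q : ℝ × ↥T => F q.1 q.2) ∧
    (∀ a, F 0 a = ↑a) ∧
    (∀ t, Function.Injective (F t)) ∧
    (∀ t a, F t a ∈ W) ∧
    (∀ a, F 1 a ∈ Bd)

/-- The surface `T'` is isotopic, inside the region `W`, to the surface `T`. -/
def IsotopicToSurfaceIn (M : Type*) [TopologicalSpace M] (W T' T : Set M) : Prop :=
  ∃ F : ℝ → ↥T' → M,
    Continuous (fun q : ℝ × ↥T' => F q.1 q.2) ∧
    (∀ a, F 0 a = ↑a) ∧
    (∀ t, Function.Injective (F t)) ∧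
    (∀ t a, F t a ∈ W) ∧
    range (F 1) = T

/-- `E` is an essential disk in the exterior region `W` of the link neighborhood `N`:
a properly embedded disk whose boundary lies on `frontier N` and is homotopically
nontrivial there. -/
def IsEssentialDiskIn (M : Type*) [TopologicalSpace M] (W N E : Set M) : Prop :=
  E ⊆ W ∧ ∃ f : E2 → M, Topology.IsEmbedding f ∧ f '' closedBall (0:E2) 1 = E ∧
    E ∩ N = f '' sphere (0:E2) 1 ∧ f '' sphere (0:E2) 1 ⊆ frontier N ∧
    ∀ c : C(↥ModelCircle, ↥(frontier N)), (∀ x : ↥ModelCircle, (c x : M) = f ↑x) →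
      ¬ ∃ y, c.Homotopic (ContinuousMap.const _ y)

/-- `V` is an embedded solid torus contained in `W`, with boundary torus `T`. -/
def IsSolidTorusWithBoundaryIn (M : Type*) [TopologicalSpace M] (W V T : Set M) : Prop :=
  V ⊆ W ∧ ∃ f : ↥ModelCircle × ↥(closedBall (0:E2) 1) → M, Topology.IsEmbedding f ∧
    range f = V ∧ f '' {q | ‖(q.2 : E2)‖ = 1} = T

/-- The two straight strands of the trivial tangle in the unit ball of `E3`. -/
def TrivialTangleStrands : Set E3 :=
  {p : E3 | p 1 = 0 ∧ (p 0 = 1/2 ∨ p 0 = -(1/2))}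

/-- The pair `(Bc, t)` is a rational tangle in a 3-ball: it is homeomorphic, as a
pair, to the trivial tangle of two parallel unknotted arcs in the unit 3-ball
(rational tangles are exactly the tangles obtained from the trivial tangle by
finitely many horizontal and vertical twists, and are characterized by this
property). -/
def IsRationalTanglePair (M : Type*) [TopologicalSpace M] (Bc t : Set M) : Prop :=
  t ⊆ Bc ∧ ∃ e : ↥Bc ≃ₜ ↥(closedBall (0:E3) 1),
    ∀ x : ↥Bc, (x : M) ∈ t ↔ (↑(e x) : E3) ∈ TrivialTangleStrands

/-- `a` is an embedded arc in `M` meeting `L` exactly in its two (distinct)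
endpoints. -/
def IsArcWithEndpointsOn (M : Type*) [TopologicalSpace M] (L a : Set M) : Prop :=
  ∃ f : ↥(Icc (0:ℝ) 1) → M, Topology.IsEmbedding f ∧ range f = a ∧
    ∀ x : ↥(Icc (0:ℝ) 1), f x ∈ L ↔ ((x : ℝ) = 0 ∨ (x : ℝ) = 1)

/-- `s` is the image of a complete, properly embedded geodesic of the metric
space `X`. -/
def IsCompleteEmbeddedGeodesic (X : Type*) [MetricSpace X] (s : Set X) : Prop :=
  ∃ γ : ℝ → X, Continuous γ ∧ Function.Injective γ ∧ range γ = s ∧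
    (∀ K : Set X, IsCompact K → IsCompact (γ ⁻¹' K)) ∧
    ∀ t : ℝ, ∃ ε > 0, ∀ s₁ ∈ Icc (t - ε) (t + ε), ∀ s₂ ∈ Icc (t - ε) (t + ε),
      dist (γ s₁) (γ s₂) = |s₁ - s₂|

/-- `K` is an embedded Klein bottle in `M`, presented as a quotient of the plane by
the usual Klein bottle identifications `(x, y) ∼ (x + 1, -y) ∼ (x, y + 1)`. -/
def IsKleinBottleSet (M : Type*) [TopologicalSpace M] (K : Set M) : Prop :=
  ∃ f : ℝ × ℝ → M, Continuous f ∧ range f = K ∧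
    ∀ x y : ℝ × ℝ, f x = f y ↔
      ∃ a b : ℤ, y.1 = x.1 + a ∧ y.2 = (-1 : ℝ) ^ a * x.2 + b

/-- `T` is an embedded torus in `M`. -/
def IsTorusSet (M : Type*) [TopologicalSpace M] (T : Set M) : Prop :=
  ∃ f : ↥ModelCircle × ↥ModelCircle → M, Topology.IsEmbedding f ∧ range f = T

/-- The ball `B` (with boundary sphere `S`) meets the link `L` in the chain-move
position: two disjoint properly embedded arcs `γ₁, γ₂`, together with a trivial
circle `C` in the interior of `B` bounding a disk punctured once by each of
`γ₁` and `γ₂`. -/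
structure ChainMovePosition (M : Type*) [TopologicalSpace M]
    (L B S γ₁ γ₂ C : Set M) : Prop where
  ball : IsTameBallWithSphere M B S
  inter : L ∩ B = γ₁ ∪ γ₂ ∪ C
  arc₁ : IsArc M γ₁
  arc₂ : IsArc M γ₂
  disj : Disjoint γ₁ γ₂
  circ : IsCircleSet M C
  strandsProper : (γ₁ ∩ S).ncard = 2 ∧ (γ₂ ∩ S).ncard = 2
  circleInterior : C ⊆ B \ S
  disk : ∃ D, BoundsTwicePuncturedDisk M C D γ₁ γ₂ ∧ D ⊆ B \ S

/-- `L'` is obtained from `L` by the chain move with parameter `k` inside the ball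
`B` (with boundary sphere `S`): the tangle `L ∩ B` is replaced by the tangle `T k`,
consisting of the two strands `γ₁, γ₂` together with two circles `C₁, C₂` forming a
Hopf link, with `C₁` encircling `γ₁`, `C₂` encircling `γ₂` (each `Cᵢ` bounds a disk
in the interior of `B` punctured once by `γᵢ` and once by the other circle), and `k`
half-twists inserted; the integer parameter `k` records the number of inserted
half-twists. -/
structure ChainMoveResult (M : Type*) [TopologicalSpace M] (k : ℤ)
    (L L' B S γ₁ γ₂ C₁ C₂ : Set M) : Prop where
  outside : L' \ B = L \ B
  inter : L' ∩ B = γ₁ ∪ γ₂ ∪ C₁ ∪ C₂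
  strandsOld : γ₁ ⊆ L ∧ γ₂ ⊆ L
  arc₁ : IsArc M γ₁
  arc₂ : IsArc M γ₂
  circ₁ : IsCircleSet M C₁
  circ₂ : IsCircleSet M C₂
  circlesInterior : C₁ ∪ C₂ ⊆ B \ S
  hopf₁ : ∃ D₁, BoundsTwicePuncturedDisk M C₁ D₁ γ₁ C₂ ∧ D₁ ⊆ B \ S
  hopf₂ : ∃ D₂, BoundsTwicePuncturedDisk M C₂ D₂ γ₂ C₁ ∧ D₂ ⊆ B \ S

/-- The intersection of the link `L` with the ball `B` (with boundary sphere `S`)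
is the tangle `T k`: two disjoint arcs `γ₁, γ₂` together with two circles `C₁, C₂`
forming a Hopf link, `C₁` encircling `γ₁` and `C₂` encircling `γ₂` (each `Cᵢ`
bounds a disk in the interior of `B` punctured once by `γᵢ` and once by the other
circle), with `k` half-twists inserted; the integer parameter `k` records the
number of inserted half-twists. -/
structure IsTangleTk (M : Type*) [TopologicalSpace M] (k : ℤ)
    (L B S γ₁ γ₂ C₁ C₂ : Set M) : Prop where
  inter : L ∩ B = γ₁ ∪ γ₂ ∪ C₁ ∪ C₂
  arc₁ : IsArc M γ₁
  arc₂ : IsArc M γ₂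
  disj : Disjoint γ₁ γ₂
  circ₁ : IsCircleSet M C₁
  circ₂ : IsCircleSet M C₂
  circlesInterior : C₁ ∪ C₂ ⊆ B \ S
  hopf₁ : ∃ D₁, BoundsTwicePuncturedDisk M C₁ D₁ γ₁ C₂ ∧ D₁ ⊆ B \ S
  hopf₂ : ∃ D₂, BoundsTwicePuncturedDisk M C₂ D₂ γ₂ C₁ ∧ D₂ ⊆ B \ S

/-- `L'` is obtained from `L` by the switch move inside the ball `B` (with boundary
sphere `S`): the two strands of `L ∩ B` are surgered into the two arcs `γ₁, γ₂`
(with the same endpoints on `S`), and a trivial circle `C` is added in the interior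
of `B`, bounding a disk punctured once by each of `γ₁` and `γ₂`. -/
structure SwitchMoveResult (M : Type*) [TopologicalSpace M]
    (L L' B S γ₁ γ₂ C : Set M) : Prop where
  ball : IsTameBallWithSphere M B S
  outside : L' \ B = L \ B
  boundaryAgree : L' ∩ S = L ∩ S
  inter : L' ∩ B = γ₁ ∪ γ₂ ∪ C
  arc₁ : IsArc M γ₁
  arc₂ : IsArc M γ₂
  disj : Disjoint γ₁ γ₂
  circ : IsCircleSet M C
  circleInterior : C ⊆ B \ S
  disk : ∃ D, BoundsTwicePuncturedDisk M C D γ₁ γ₂ ∧ D ⊆ B \ S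

/-- `L''` is obtained from `L` by the augmented chain move inside the ball `B`
(with boundary sphere `S`): the trivial circle `C` of the chain-move position is
kept, and the two Hopf-linked circles `C₁, C₂` are additionally inserted, `C₁`
encircling `γ₁` and `C₂` encircling `γ₂`. -/
structure AugmentedChainMoveResult (M : Type*) [TopologicalSpace M]
    (L L'' B S γ₁ γ₂ C C₁ C₂ : Set M) : Prop where
  outside : L'' \ B = L \ B
  inter : L'' ∩ B = γ₁ ∪ γ₂ ∪ C ∪ C₁ ∪ C₂
  circ₁ : IsCircleSet M C₁
  circ₂ : IsCircleSet M C₂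
  circlesInterior : C₁ ∪ C₂ ⊆ B \ S
  hopf₁ : ∃ D₁, BoundsTwicePuncturedDisk M C₁ D₁ γ₁ C₂ ∧ D₁ ⊆ B \ S
  hopf₂ : ∃ D₂, BoundsTwicePuncturedDisk M C₂ D₂ γ₂ C₁ ∧ D₂ ⊆ B \ S

/-- `L` is a chain link with `c` components in the 3-sphere: a cyclic sequence of
disjoint circles, each one linked once with each of its two neighbours (as recorded
by disks bounded by each component and punctured once by each neighbour), possibly
with half-twists inserted between consecutive components; the parameter `twists`
records the numbers of inserted half-twists. -/
structure IsChainLink (c : ℕ) (twists : ZMod c → ℤ) (L : Set S3) : Prop where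
  comps : ∃ J : ZMod c → Set S3,
    (∀ i, IsCircleSet S3 (J i)) ∧
    (∀ i j, i ≠ j → Disjoint (J i) (J j)) ∧
    (L = ⋃ i, J i) ∧
    (∀ i, ∃ D, BoundsTwicePuncturedDisk S3 (J i) D (J (i + 1)) (J (i - 1)) ∧
      ∀ j, j ≠ i + 1 → j ≠ i - 1 → Disjoint D (J j))

/-- The point `(a, b, c)` of Euclidean 3-space. -/
def e3 (a b c : ℝ) : E3 := (WithLp.equiv 2 (Fin 3 → ℝ)).symm ![a, b, c]

/-- The four standard tangle endpoints on the unit sphere. -/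
def ptNE : E3 := e3 (1/2) 0 (Real.sqrt 3 / 2)
def ptSE : E3 := e3 (1/2) 0 (-(Real.sqrt 3 / 2))
def ptNW : E3 := e3 (-(1/2)) 0 (Real.sqrt 3 / 2)
def ptSW : E3 := e3 (-(1/2)) 0 (-(Real.sqrt 3 / 2))

/-- The model strands of the integer rational tangle with `n` half-twists inside the
closed unit ball of `E3`: two strands winding `n` half-times around each other,
running between the four standard endpoints on the unit sphere. -/
def IntegerTangleModel (n : ℤ) : Set E3 :=
  {p | ∃ t ∈ Icc (0:ℝ) 1,
    p = e3 ((1/2) * Real.cos ((n : ℝ) * Real.pi * t))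
          ((1/2) * Real.sin ((n : ℝ) * Real.pi * t))
          (Real.sqrt 3 * (t - 1/2)) ∨
    p = e3 (-((1/2) * Real.cos ((n : ℝ) * Real.pi * t)))
          (-((1/2) * Real.sin ((n : ℝ) * Real.pi * t)))
          (Real.sqrt 3 * (t - 1/2))}

/-- The model strands of the rational tangle `∞` inside the closed unit ball: two
vertical strands, each joining the two standard endpoints on its own side. -/
def InfinityTangleModel : Set E3 :=
  {p | (p 0 = 1/2 ∨ p 0 = -(1/2)) ∧ p 1 = 0 ∧ |p 2| ≤ Real.sqrt 3 / 2}

/-- The self-map of the closed unit ball performing `m` half-twists about the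
`x`-axis on the region `x ≥ 1/2` (interpolating for `0 ≤ x ≤ 1/2`): the twist map
used to insert `m` half-twists of the second (vertical) kind into a tangle. -/
noncomputable def twistMapX (m : ℤ) (p : E3) : E3 :=
  e3 (p 0)
    (Real.cos ((m : ℝ) * Real.pi * max 0 (min 1 (2 * p 0))) * p 1 -
      Real.sin ((m : ℝ) * Real.pi * max 0 (min 1 (2 * p 0))) * p 2)
    (Real.sin ((m : ℝ) * Real.pi * max 0 (min 1 (2 * p 0))) * p 1 +
      Real.cos ((m : ℝ) * Real.pi * max 0 (min 1 (2 * p 0))) * p 2)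

/-- The model strands of the rational tangle with Conway notation `a b` (first `b`
half-twists of the first kind, then `a` half-twists of the second kind). -/
noncomputable def TwoTangleModel (a b : ℤ) : Set E3 :=
  twistMapX a '' IntegerTangleModel b

/-- The pair `(Bc, t)` is the tangle whose model strand set inside the closed unit
ball is `T0`, relative to the boundary-sphere coordinates provided by the chart
`f : E3 → M` (of the complementary ball): there is a homeomorphism of pairs taking
`t` to `T0` and restricting on the boundary sphere to the chart identification.
Requiring the boundary identification distinguishes the different rational tangle
types (e.g. the integer tangles `IntegerTangleModel n`). -/
def IsTangleOfModelRel (M : Type*) [TopologicalSpace M] (f : E3 → M)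
    (Bc t : Set M) (T0 : Set E3) : Prop :=
  t ⊆ Bc ∧ ∃ e : ↥Bc ≃ₜ ↥(closedBall (0:E3) 1),
    (∀ x : ↥Bc, (x : M) ∈ t ↔ (↑(e x) : E3) ∈ T0) ∧
    ∀ x : E3, x ∈ sphere (0:E3) 1 → ∀ hfx : f x ∈ Bc, ((e ⟨f x, hfx⟩ : E3) = x)
namespace HypArc

/-- The part of degree three of `det (1 + t A)`, and the ones of degree one and two. -/
lemma det_one_add_smul (A : E3 →L[ℝ] E3) (t : ℝ) :
    ((1 : E3 →L[ℝ] E3) + t • A).det =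
      1 + t * (((1 + A).det - (1 - A).det) / 2 - A.det) +
        t ^ 2 * (((1 + A).det + (1 - A).det) / 2 - 1) + t ^ 3 * A.det := by
  let b := (EuclideanSpace.basisFun (Fin 3) ℝ).toBasis
  have key : ∀ B : E3 →L[ℝ] E3, B.det = (LinearMap.toMatrix b b (B : E3 →ₗ[ℝ] E3)).det :=
    fun B => (LinearMap.det_toMatrix b _).symm
  have h1 : LinearMap.toMatrix b b ((1 : E3 →L[ℝ] E3) : E3 →ₗ[ℝ] E3) = 1 := by
    exact LinearMap.toMatrix_one b
  simp only [key, ContinuousLinearMap.toLinearMap_add, ContinuousLinearMap.toLinearMap_sub,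
    ContinuousLinearMap.toLinearMap_smul, map_add, map_sub, map_smul, h1]
  generalize LinearMap.toMatrix b b (A : E3 →ₗ[ℝ] E3) = Q
  simp only [Matrix.det_fin_three, Matrix.add_apply, Matrix.sub_apply, Matrix.smul_apply,
    Matrix.one_apply, smul_eq_mul]
  simp
  ring

lemma id_add_bijective {w : E3 → E3} {K : NNReal} (hw : LipschitzWith K w) {t : NNReal}
    (ht : t * K < 1) : Function.Bijective (fun x => x + (t : ℝ) • w x) := by
  have hA : ApproximatesLinearOn (fun x => x + (t : ℝ) • w x)
      ((ContinuousLinearEquiv.refl ℝ E3 : E3 ≃L[ℝ] E3) : E3 →L[ℝ] E3) univ (t * K) := by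
    intro x _ y _
    have : x + (t : ℝ) • w x - (y + (t : ℝ) • w y) -
      ((ContinuousLinearEquiv.refl ℝ E3 : E3 ≃L[ℝ] E3) : E3 →L[ℝ] E3) (x - y)
        = (t : ℝ) • (w x - w y) := by
      simp [smul_sub]; abel
    rw [this, norm_smul, Real.norm_of_nonneg t.coe_nonneg]
    have := hw.dist_le_mul x y
    rw [dist_eq_norm, dist_eq_norm] at this
    push_cast
    nlinarith [t.coe_nonneg]
  have hc : Subsingleton E3 ∨ (t * K : NNReal) <
      ‖((ContinuousLinearEquiv.refl ℝ E3).symm : E3 →L[ℝ] E3)‖₊⁻¹ := by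
    right
    have : ‖((ContinuousLinearEquiv.refl ℝ E3).symm : E3 →L[ℝ] E3)‖₊ = 1 := by
      have : ‖ContinuousLinearMap.id ℝ E3‖₊ = 1 := by
        ext; exact ContinuousLinearMap.norm_id
      exact this
    rw [this, inv_one]
    exact ht
  exact ⟨injOn_univ.1 (hA.injOn hc), hA.surjective hc⟩

/-- The Jacobian determinant of a compactly supported field has integral zero. -/
theorem integral_det_fderiv_eq_zero {w : E3 → E3} (hw : ContDiff ℝ 1 w)
    (hc : HasCompactSupport w) : ∫ x, (fderiv ℝ w x).det = 0 := by
  have hD : Continuous (fderiv ℝ w) := hw.continuous_fderiv one_ne_zero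
  have hcD : HasCompactSupport (fderiv ℝ w) := hc.fderiv ℝ
  obtain ⟨K, hK⟩ := hw.lipschitzWith_of_hasCompactSupport hc one_ne_zero
  obtain ⟨R, hR0, hR⟩ : ∃ R : ℝ, 0 < R ∧ tsupport w ⊆ closedBall 0 R := by
    obtain ⟨R, hR⟩ := hc.isCompact.isBounded.subset_closedBall (0 : E3)
    exact ⟨max R 1, by positivity, hR.trans (closedBall_subset_closedBall (le_max_left _ _))⟩
  have hwz : ∀ x, x ∉ closedBall (0 : E3) R → w x = 0 := fun x hx =>
    image_eq_zero_of_notMem_tsupport fun h => hx (hR h)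
  have hDz : ∀ x, x ∉ closedBall (0 : E3) R → fderiv ℝ w x = 0 := fun x hx => by
    have : x ∉ tsupport w := fun h => hx (hR h)
    exact image_eq_zero_of_notMem_tsupport fun h => this (tsupport_fderiv_subset ℝ h)
  set A := fun x => fderiv ℝ w x with hAdef
  set c3 : E3 → ℝ := fun x => (A x).det with hc3
  set c1 : E3 → ℝ := fun x => ((1 + A x).det - (1 - A x).det) / 2 - (A x).det with hc1
  set c2 : E3 → ℝ := fun x => ((1 + A x).det + (1 - A x).det) / 2 - 1 with hc2
  have hdet : Continuous fun B : E3 →L[ℝ] E3 => B.det := ContinuousLinearMap.continuous_det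
  have hc3c : Continuous c3 := hdet.comp hD
  have hp : Continuous fun x => (1 + A x).det := hdet.comp (continuous_const.add hD)
  have hm : Continuous fun x => (1 - A x).det := hdet.comp (continuous_const.sub hD)
  have hc1c : Continuous c1 := ((hp.sub hm).div_const 2).sub hc3c
  have hc2c : Continuous c2 := ((hp.add hm).div_const 2).sub continuous_const
  have hB : IsCompact (closedBall (0 : E3) R) := isCompact_closedBall 0 R
  obtain ⟨C1, hC1⟩ := hB.exists_bound_of_continuousOn hc1c.continuousOn
  obtain ⟨C2, hC2⟩ := hB.exists_bound_of_continuousOn hc2c.continuousOn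
  obtain ⟨C3, hC3⟩ := hB.exists_bound_of_continuousOn hc3c.continuousOn
  set S := |C1| + |C2| + |C3| + K + 1 with hS
  have hSpos : 1 ≤ S := by rw [hS]; have := K.2; linarith [abs_nonneg C1, abs_nonneg C2, abs_nonneg C3, K.coe_nonneg]
  have main : ∀ t : ℝ, 0 < t → t ≤ 1 / (2 * S) →
      t * ∫ x in closedBall (0 : E3) R, c1 x + t * c2 x + t ^ 2 * c3 x = 0 := by
    intro t ht0 ht
    have hSt : t * S ≤ 1 / 2 := by
      rw [le_div_iff₀ (by positivity)] at ht; linarith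
    have ht1 : t ≤ 1 / 2 := by nlinarith
    lift t to NNReal using ht0.le
    have hbij := id_add_bijective hK (t := t) (by
      rw [← NNReal.coe_lt_coe]; push_cast
      have : (K : ℝ) ≤ S := by
        rw [hS]; linarith [abs_nonneg C1, abs_nonneg C2, abs_nonneg C3]
      nlinarith [t.coe_nonneg])
    have himg : (fun x => x + (t : ℝ) • w x) '' closedBall 0 R = closedBall 0 R := by
      ext y; constructor
      · rintro ⟨x, hx, rfl⟩
        by_contra hy
        have : x + (t : ℝ) • w x = x := by
          apply hbij.1
          have h0 := hwz _ hy
          simp only [h0, smul_zero, add_zero]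
        exact hy (by simpa only [this] using hx)
      · intro hy
        obtain ⟨x, rfl⟩ := hbij.2 y
        refine ⟨x, ?_, rfl⟩
        by_contra hx
        have h0 := hwz _ hx
        simp only [h0, smul_zero, add_zero] at hy
        exact hx hy
    have hder : ∀ x ∈ closedBall (0 : E3) R, HasFDerivWithinAt (fun x => x + (t : ℝ) • w x)
        (1 + (t : ℝ) • A x) (closedBall 0 R) x := by
      intro x _
      have := ((hw.differentiable one_ne_zero) x).hasFDerivAt
      exact ((hasFDerivAt_id x).add (this.const_smul (t : ℝ))).hasFDerivWithinAt
    have hint := MeasureTheory.integral_image_eq_integral_abs_det_fderiv_smul volume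
      (measurableSet_closedBall (x := (0 : E3)) (ε := R)) hder hbij.1.injOn (fun _ => (1 : ℝ))
    rw [himg] at hint
    have hpos : ∀ x ∈ closedBall (0 : E3) R, |(1 + (t : ℝ) • A x).det| • (1 : ℝ) =
        1 + t * (c1 x + t * c2 x + t ^ 2 * c3 x) := by
      intro x hx
      have e : (1 + (t : ℝ) • A x).det = 1 + t * (c1 x + t * c2 x + t ^ 2 * c3 x) := by
        rw [det_one_add_smul]; simp only [hc1, hc2, hc3]; ring
      have h1 := hC1 x hx
      have h2 := hC2 x hx
      have h3 := hC3 x hx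
      rw [Real.norm_eq_abs] at h1 h2 h3
      have hb : |c1 x + t * c2 x + t ^ 2 * c3 x| ≤ S := by
        have i1 : |c1 x + t * c2 x + t ^ 2 * c3 x| ≤
            |c1 x| + t * |c2 x| + t ^ 2 * |c3 x| := by
          refine (abs_add_le _ _).trans (add_le_add ((abs_add_le _ _).trans (add_le_add le_rfl ?_)) ?_)
          · rw [abs_mul, abs_of_pos ht0]
          · rw [abs_mul, abs_of_nonneg (sq_nonneg (t : ℝ))]
        have : t * |c2 x| ≤ |c2 x| := by nlinarith [abs_nonneg (c2 x)]
        have : (t : ℝ) ^ 2 * |c3 x| ≤ |c3 x| := by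
          have : (t : ℝ) ^ 2 ≤ 1 := by nlinarith
          nlinarith [abs_nonneg (c3 x)]
        rw [hS]
        linarith [le_abs_self C1, le_abs_self C2, le_abs_self C3, K.coe_nonneg]
      have : (0 : ℝ) ≤ 1 + t * (c1 x + t * c2 x + t ^ 2 * c3 x) := by
        have := neg_abs_le (c1 x + t * c2 x + t ^ 2 * c3 x)
        nlinarith
      rw [e, abs_of_nonneg this, smul_eq_mul, mul_one]
    rw [setIntegral_congr_fun measurableSet_closedBall hpos] at hint
    have hcont : Continuous fun x => t * (c1 x + t * c2 x + t ^ 2 * c3 x) := by fun_prop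
    have j1 : IntegrableOn (fun _ : E3 => (1 : ℝ)) (closedBall 0 R) volume :=
      continuousOn_const.integrableOn_compact hB
    rw [integral_add j1
      (hcont.continuousOn.integrableOn_compact hB), integral_const_mul] at hint
    linarith
  set I1 := ∫ x in closedBall (0 : E3) R, c1 x
  set I2 := ∫ x in closedBall (0 : E3) R, c2 x
  set I3 := ∫ x in closedBall (0 : E3) R, c3 x with hI3
  have lin : ∀ t : ℝ, 0 < t → t ≤ 1 / (2 * S) → I1 + t * I2 + t ^ 2 * I3 = 0 := by
    intro t ht0 ht
    have h := (mul_eq_zero.1 (main t ht0 ht)).resolve_left ht0.ne'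
    have i1 := hc1c.continuousOn.integrableOn_compact (μ := volume) hB
    have i2 := hc2c.continuousOn.integrableOn_compact (μ := volume) hB
    have i3 := hc3c.continuousOn.integrableOn_compact (μ := volume) hB
    have i2' := i2.const_mul t
    have i3' := i3.const_mul (t ^ 2)
    have e1 : ∫ x in closedBall (0 : E3) R, c1 x + t * c2 x + t ^ 2 * c3 x =
        (∫ x in closedBall (0 : E3) R, c1 x + t * c2 x) +
          ∫ x in closedBall (0 : E3) R, t ^ 2 * c3 x := integral_add (i1.add i2') i3'
    have e2 : ∫ x in closedBall (0 : E3) R, c1 x + t * c2 x =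
        I1 + ∫ x in closedBall (0 : E3) R, t * c2 x := integral_add i1 i2'
    rw [e1, e2, integral_const_mul, integral_const_mul] at h
    exact h
  have hI : I3 = 0 := by
    set s := 1 / (2 * S) with hs
    have hspos : 0 < s := by positivity
    have e1 := lin s hspos le_rfl
    have e2 := lin (s / 2) (by positivity) (by linarith)
    have e3 := lin (s / 4) (by positivity) (by linarith)
    have : s ^ 2 * I3 = 0 := by linarith
    exact (mul_eq_zero.1 this).resolve_left (by positivity)
  refine (setIntegral_eq_integral_of_forall_compl_eq_zero (s := closedBall (0 : E3) R) ?_).symm.trans hI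
  · intro x hx
    change (fderiv ℝ w x).det = 0
    rw [hDz x hx]
    have : LinearMap.det (0 : E3 →ₗ[ℝ] E3) = 0 := by
      rw [LinearMap.det_zero]; simp
    exact this
end HypArc

namespace HypArc

lemma det_smul_one_add_rankOne (a k : ℝ) (x : E3) :
    (a • (1 : E3 →L[ℝ] E3) + k • (innerSL ℝ x).smulRight x).det =
      a ^ 2 * (a + k * ‖x‖ ^ 2) := by
  let b := (EuclideanSpace.basisFun (Fin 3) ℝ).toBasis
  have key : ∀ B : E3 →L[ℝ] E3, B.det = (LinearMap.toMatrix b b (B : E3 →ₗ[ℝ] E3)).det :=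
    fun B => (LinearMap.det_toMatrix b _).symm
  have h1 : ∀ i j, LinearMap.toMatrix b b ((a • (1 : E3 →L[ℝ] E3) +
      k • (innerSL ℝ x).smulRight x : E3 →L[ℝ] E3) : E3 →ₗ[ℝ] E3) i j =
      a * (if i = j then 1 else 0) + k * (x j * x i) := by
    intro i j
    rw [LinearMap.toMatrix_apply]
    simp [b, EuclideanSpace.inner_single_right]
  rw [key, Matrix.det_fin_three]
  simp only [h1, EuclideanSpace.norm_sq_eq, Fin.sum_univ_three, Real.norm_eq_abs, sq_abs]
  simp
  ring

lemma det_eq_zero_of_inner_eq_zero {A : E3 →L[ℝ] E3} {u : E3} (hu : u ≠ 0)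
    (h : ∀ v, inner ℝ u (A v) = 0) : A.det = 0 := by
  by_contra hd
  obtain ⟨v, hv⟩ := (LinearMap.equivOfDetNeZero (A : E3 →ₗ[ℝ] E3) hd).surjective u
  have h2 : A v = u := hv
  have := h v
  rw [h2, inner_self_eq_zero] at this
  exact hu this

/-- A `C¹` self-map of space which is the identity outside of a ball has a zero. -/
theorem exists_eq_zero_of_eq_id_outside {f : E3 → E3} (hf : ContDiff ℝ 1 f) {r : ℝ} (hr : 0 < r)
    (h : ∀ x, r ≤ ‖x‖ → f x = x) : ∃ x, f x = 0 := by
  by_contra! hne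
  set R := 2 * r with hR
  set b : ℝ → ℝ := fun s => Real.smoothTransition ((4 * R ^ 2 - s) / (3 * R ^ 2)) with hb
  have hbs : ContDiff ℝ 1 b := by
    have : ContDiff ℝ 1 Real.smoothTransition := Real.smoothTransition.contDiff (n := 1)
    exact this.comp (by fun_prop)
  have hR0 : 0 < R := by positivity
  have hb1 : ∀ s, s ≤ R ^ 2 → b s = 1 := fun s hs =>
    Real.smoothTransition.one_of_one_le (by rw [le_div_iff₀ (by positivity)]; linarith)
  have hb0 : ∀ s, 4 * R ^ 2 ≤ s → b s = 0 := fun s hs =>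
    Real.smoothTransition.zero_of_nonpos
      (div_nonpos_of_nonpos_of_nonneg (by linarith) (by positivity))
  have hba : Antitone b := fun s t hst => Real.smoothTransition.monotone (by gcongr)
  set w : E3 → E3 := fun x => (b (‖x‖ ^ 2) * ‖f x‖⁻¹) • f x with hw
  have hwC : ContDiff ℝ 1 w := by
    refine ContDiff.smul (ContDiff.mul (hbs.comp (contDiff_norm_sq ℝ)) ?_) hf
    exact (hf.norm ℝ hne).inv fun x => norm_ne_zero_iff.2 (hne x)
  have hwc : HasCompactSupport w := by
    refine HasCompactSupport.intro (isCompact_closedBall (0 : E3) (2 * R)) fun x hx => ?_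
    have : 2 * R < ‖x‖ := by simpa using hx
    simp only [hw]
    rw [hb0 _ (by nlinarith), zero_mul, zero_smul]
  have hin : ∀ x, ‖x‖ < R → (fderiv ℝ w x).det = 0 := by
    intro x hx
    have hn : ∀ y, ‖y‖ < R → ‖w y‖ = 1 := by
      intro y hy
      simp only [hw]
      rw [hb1 _ (by nlinarith [norm_nonneg y]), one_mul, norm_smul, norm_inv, norm_norm,
        inv_mul_cancel₀ (norm_ne_zero_iff.2 (hne y))]
    apply det_eq_zero_of_inner_eq_zero (u := w x) (norm_ne_zero_iff.1 (by rw [hn x hx]; simp))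
    intro v
    have hd := ((hwC.differentiable one_ne_zero) x).hasFDerivAt.norm_sq
    have hev : (fun y => ‖w y‖ ^ 2) =ᶠ[nhds x] fun _ => (1 : ℝ) := by
      filter_upwards [(isOpen_lt continuous_norm continuous_const).mem_nhds hx] with y hy
      rw [hn y hy]; simp
    have := (hd.congr_of_eventuallyEq hev.symm).unique (hasFDerivAt_const (1 : ℝ) x)
    have := DFunLike.congr_fun this v
    simpa using this
  have hout : ∀ x, r < ‖x‖ → (fderiv ℝ w x).det =
      (b (‖x‖ ^ 2) / ‖x‖) ^ 2 * (2 * ‖x‖ * deriv b (‖x‖ ^ 2)) := by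
    intro x hx
    have hx0 : 0 < ‖x‖ := hr.trans hx
    set φ : ℝ → ℝ := fun s => b s / √s with hφ
    set s := ‖x‖ ^ 2 with hs
    have hs0 : 0 < s := by positivity
    have hsq : √s = ‖x‖ := Real.sqrt_sq hx0.le
    have hφd : HasDerivAt φ ((deriv b s * √s - b s * (1 / (2 * √s))) / √s ^ 2) s :=
      ((hbs.differentiable one_ne_zero) s).hasDerivAt.div (Real.hasDerivAt_sqrt hs0.ne')
        (by rw [hsq]; exact hx0.ne')
    set k := (deriv b s * √s - b s * (1 / (2 * √s))) / √s ^ 2 with hk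
    have hev : w =ᶠ[nhds x] fun y => φ (‖y‖ ^ 2) • y := by
      filter_upwards [(isOpen_lt continuous_const continuous_norm).mem_nhds hx] with y hy
      simp only [hw, hφ]
      rw [h y (le_of_lt hy), Real.sqrt_sq (norm_nonneg y), div_eq_mul_inv]
    have hd1 : HasFDerivAt (fun y : E3 => φ (‖y‖ ^ 2)) (k • (2 : ℝ) • innerSL ℝ x) x := by
      have := hφd.comp_hasFDerivAt (f := fun y : E3 => ‖y‖ ^ 2) x (hasStrictFDerivAt_norm_sq x).hasFDerivAt
      have e2 : (2 : ℝ) • innerSL ℝ x = (2 : ℕ) • innerSL ℝ x := ofNat_smul_eq_nsmul ℝ 2 _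
      rw [e2]
      exact this
    have hd : HasFDerivAt (fun y => φ (‖y‖ ^ 2) • y) _ x := hd1.smul (hasFDerivAt_id x)
    rw [hev.fderiv_eq, hd.fderiv]
    have e : φ (‖x‖ ^ 2) • ContinuousLinearMap.id ℝ E3 +
        (k • (2 : ℝ) • innerSL ℝ x).smulRight x =
        φ s • (1 : E3 →L[ℝ] E3) + (2 * k) • (innerSL ℝ x).smulRight x := by
      ext v
      simp [hs]
      ring
    rw [e, det_smul_one_add_rankOne, hφ, hk, ← hs]
    simp only [hsq]
    have : s = ‖x‖ * ‖x‖ := by rw [hs]; ring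
    rw [this]
    field_simp
    ring
  have hcont : Continuous fun x => -(fderiv ℝ w x).det :=
    (ContinuousLinearMap.continuous_det.comp (hwC.continuous_fderiv one_ne_zero)).neg
  have hcs : HasCompactSupport fun x => -(fderiv ℝ w x).det := by
    have := (hwc.fderiv ℝ).comp_left (g := fun A : E3 →L[ℝ] E3 => -A.det) (by
      have : LinearMap.det (0 : E3 →ₗ[ℝ] E3) = 0 := by rw [LinearMap.det_zero]; simp
      rw [neg_eq_zero]; exact this)
    exact this
  have hderiv : ∀ s, deriv b s ≤ 0 := fun s => hba.deriv_nonpos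
  have hnn : 0 ≤ fun x => -(fderiv ℝ w x).det := by
    intro x
    rcases lt_or_ge ‖x‖ R with hx | hx
    · simp [hin x hx]
    · have hx' : r < ‖x‖ := by linarith
      simp only [Pi.zero_apply, hout x hx', neg_nonneg]
      exact mul_nonpos_of_nonneg_of_nonpos (sq_nonneg _)
        (mul_nonpos_of_nonneg_of_nonpos (by positivity) (hderiv _))
  have hzero : ∀ x, (fderiv ℝ w x).det = 0 := by
    by_contra! hx
    obtain ⟨x, hx⟩ := hx
    have := hcont.integral_pos_of_hasCompactSupport_nonneg_nonzero (μ := volume) hcs hnn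
      (x := x) (neg_ne_zero.2 hx)
    rw [integral_neg, integral_det_fderiv_eq_zero hwC hwc] at this
    simp at this
  have hb3 : ∀ s, b s ^ 2 * deriv b s = 0 := by
    intro s
    rcases lt_or_ge s (R ^ 2) with hs | hs
    · have : b =ᶠ[nhds s] fun _ => (1 : ℝ) := by
        filter_upwards [isOpen_Iio.mem_nhds hs] with y hy
        exact hb1 y (le_of_lt hy)
      rw [this.deriv_eq]; simp
    · obtain ⟨x, hx⟩ : ∃ x : E3, ‖x‖ = √s := by
        refine ⟨EuclideanSpace.single 0 (√s), ?_⟩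
        simp [abs_of_nonneg (Real.sqrt_nonneg s)]
      have hs0 : 0 ≤ s := le_trans (by positivity) hs
      have hxr : r < ‖x‖ := by
        rw [hx]; apply Real.lt_sqrt_of_sq_lt; nlinarith
      have hz := hout x hxr
      rw [hzero, hx, Real.sq_sqrt hs0, div_pow] at hz
      have h0 : 0 < √s := by rw [← hx]; linarith
      have h1 : (b s ^ 2 * deriv b s) * (2 * √s / √s ^ 2) = 0 := by rw [hz]; ring
      exact (mul_eq_zero.1 h1).resolve_right (by positivity)
  have hconst := is_const_of_deriv_eq_zero (f := fun s => b s ^ 3)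
    ((hbs.differentiable one_ne_zero).pow 3) (fun s => by
      have := (((hbs.differentiable one_ne_zero) s).hasDerivAt.pow 3).deriv
      have h3 := hb3 s
      change deriv (b ^ 3) s = 0
      rw [this]; push_cast; linear_combination 3 * h3) 0 (4 * R ^ 2)
  simp only [hb1 0 (by positivity), hb0 _ le_rfl] at hconst
  norm_num at hconst
end HypArc

namespace HypArc

/-- Radial retraction onto the closed unit ball. -/
def ballRetract (x : E3) : E3 := (max 1 ‖x‖)⁻¹ • x

lemma continuous_ballRetract : Continuous ballRetract :=
  ((continuous_const.max continuous_norm).inv₀ fun x => by positivity).smul continuous_id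

lemma ballRetract_mem (x : E3) : ballRetract x ∈ closedBall (0 : E3) 1 := by
  have : 0 < max 1 ‖x‖ := by positivity
  rw [mem_closedBall_zero_iff, ballRetract, norm_smul, norm_inv, Real.norm_of_nonneg this.le,
    inv_mul_le_iff₀ this, mul_one]
  exact le_max_right _ _

lemma ballRetract_eq {x : E3} (hx : x ∈ closedBall (0 : E3) 1) : ballRetract x = x := by
  rw [mem_closedBall_zero_iff] at hx
  rw [ballRetract, max_eq_left hx, inv_one, one_smul]

/-- Brouwer's fixed point theorem for the ball in 3-space. -/
theorem brouwer {φ : E3 → E3} (hφ : ContinuousOn φ (closedBall 0 1))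
    (hm : MapsTo φ (closedBall 0 1) (closedBall 0 1)) :
    ∃ x ∈ closedBall (0 : E3) 1, φ x = x := by
  by_contra! hne
  set ψ : E3 → E3 := fun x => φ (ballRetract x) with hψ
  have hψc : Continuous ψ := hφ.comp_continuous continuous_ballRetract ballRetract_mem
  have hψ1 : ∀ x, ‖ψ x‖ ≤ 1 := fun x => by simpa using hm (ballRetract_mem x)
  have hψne : ∀ x, x - ψ x ≠ 0 := by
    intro x hx
    have hx' : ψ x = x := (sub_eq_zero.1 hx).symm
    have hxm : x ∈ closedBall (0 : E3) 1 := by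
      rw [mem_closedBall_zero_iff, ← hx']; exact hψ1 x
    apply hne x hxm
    rw [hψ] at hx'
    simpa only [ballRetract_eq hxm] using hx'
  obtain ⟨x0, -, hx0⟩ := (isCompact_closedBall (0 : E3) 2).exists_isMinOn ⟨0, by simp⟩
    (f := fun x => ‖x - ψ x‖) (by fun_prop)
  set δ := min ‖x0 - ψ x0‖ 1 with hδ
  have hδ0 : 0 < δ := lt_min (norm_pos_iff.2 (hψne x0)) one_pos
  have hδ1 : δ ≤ 1 := min_le_right _ _
  set θ : E3 → ℝ := fun x => max 0 (min 1 (3 - ‖x‖)) with hθ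
  have hθ0 : ∀ x, 0 ≤ θ x := fun x => le_max_left _ _
  have hθ1 : ∀ x, θ x ≤ 1 := fun x => max_le zero_le_one (min_le_left _ _)
  obtain ⟨g, hg, hgd, hgs⟩ := Continuous.exists_contDiff_approx (f := fun x => θ x • ψ x)
    (ε := fun _ => δ / 2) 1 (by fun_prop) continuous_const (fun _ => by positivity)
  obtain ⟨x, hx⟩ := exists_eq_zero_of_eq_id_outside (f := fun x => x - g x) (r := 3)
    (contDiff_id.sub hg) (by norm_num) (by
      intro x hx
      have : g x = 0 := by
        by_contra hgx
        have := hgs (show x ∈ Function.support g from hgx)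
        apply this
        have : θ x = 0 := max_eq_left ((min_le_right _ _).trans (by linarith))
        simp only [this, zero_smul]
      simp [this])
  have hgx : g x = x := (sub_eq_zero.1 hx).symm
  have hd := hgd x
  rw [hgx, dist_eq_norm] at hd
  rcases le_or_gt ‖x‖ 2 with h | h
  · have ht : θ x = 1 := by
      have : min 1 (3 - ‖x‖) = 1 := min_eq_left (by linarith)
      simp only [hθ, this]; norm_num
    rw [ht, one_smul] at hd
    have : ‖x0 - ψ x0‖ ≤ ‖x - ψ x‖ := hx0 (by simpa using h)
    linarith [min_le_left ‖x0 - ψ x0‖ 1]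
  · have h1 : ‖θ x • ψ x‖ ≤ 1 := by
      rw [norm_smul, Real.norm_of_nonneg (hθ0 x)]
      nlinarith [hθ0 x, hθ1 x, hψ1 x, norm_nonneg (ψ x)]
    have := norm_sub_norm_le x (θ x • ψ x)
    linarith

/-- A continuous injection of the closed unit ball of 3-space covers a neighbourhood of the
image of the center. -/
theorem mem_interior_image_closedBall {f : E3 → E3} (hf : ContinuousOn f (closedBall 0 1))
    (hinj : InjOn f (closedBall 0 1)) : f 0 ∈ interior (f '' closedBall 0 1) := by
  by_contra hnot
  set B := closedBall (0 : E3) 1 with hB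
  have hBc : IsCompact B := isCompact_closedBall 0 1
  set K := f '' B with hK
  have hKc : IsCompact K := hBc.image_of_continuousOn hf
  have : CompactSpace B := isCompact_iff_compactSpace.1 hBc
  have hcl : Topology.IsClosedEmbedding (fun x : B => f x) :=
    Continuous.isClosedEmbedding (continuousOn_iff_continuous_domRestrict.1 hf)
      (fun x y h => Subtype.ext (hinj x.2 y.2 h))
  obtain ⟨G, hG⟩ := ContinuousMap.exists_extension hcl
    (⟨fun x : B => (x : E3), continuous_subtype_val⟩ : C(B, E3))
  have hGf : ∀ x ∈ B, G (f x) = x := fun x hx => DFunLike.congr_fun hG ⟨x, hx⟩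
  have h0B : (0 : E3) ∈ B := by simp [hB]
  have hG0 : G (f 0) = 0 := hGf 0 h0B
  have stab : ∀ G' : E3 → E3, ContinuousOn G' K → (∀ y ∈ K, ‖G y - G' y‖ ≤ 1) →
      ∃ y ∈ K, G' y = 0 := by
    intro G' hG' hd
    obtain ⟨x, hx, hfx⟩ := brouwer (φ := fun x => x - G' (f x))
      (continuousOn_id.sub (hG'.comp hf (mapsTo_image f B))) (by
        intro x hx
        have := hd (f x) (mem_image_of_mem f hx)
        rw [hGf x hx] at this
        simpa using this)
    exact ⟨f x, mem_image_of_mem f hx, by simpa using hfx⟩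
  obtain ⟨ε, hε, hGε⟩ : ∃ ε > 0, ∀ y, ‖y - f 0‖ < 2 * ε → ‖G y‖ ≤ 1 / 10 := by
    obtain ⟨η, hη, h⟩ := Metric.continuousAt_iff.1 (G.continuous.continuousAt (x := f 0))
      (1 / 10) (by norm_num)
    refine ⟨η / 2, by positivity, fun y hy => ?_⟩
    have := h (x := y) (by rw [dist_eq_norm]; linarith)
    rw [hG0, dist_zero_right] at this
    exact this.le
  obtain ⟨c, hcK, hc⟩ : ∃ c, c ∉ K ∧ ‖f 0 - c‖ < ε := by
    by_contra! h
    apply hnot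
    rw [mem_interior_iff_mem_nhds, Metric.mem_nhds_iff]
    refine ⟨ε, hε, fun y hy => ?_⟩
    by_contra hyK
    have := h y hyK
    rw [mem_ball', dist_eq_norm] at hy
    linarith
  have hGc : ∀ y, ‖y - c‖ ≤ ε → ‖G y‖ ≤ 1 / 10 := by
    intro y hy
    apply hGε
    have : y - f 0 = (y - c) - (f 0 - c) := by abel
    rw [this]
    have := norm_sub_le (y - c) (f 0 - c)
    linarith
  set S1 := K ∩ {y | ε ≤ ‖y - c‖} with hS1
  have hS1c : IsCompact S1 := hKc.inter_right (isClosed_le continuous_const (by fun_prop))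
  have hGS1 : ∀ y ∈ S1, G y ≠ 0 := by
    rintro _ ⟨⟨x, hx, rfl⟩, hy⟩ h0
    rw [hGf x hx] at h0
    subst h0
    have hy : ε ≤ ‖f 0 - c‖ := hy
    linarith
  obtain ⟨δ, hδ0, hδ1, hδ⟩ : ∃ δ : ℝ, 0 < δ ∧ δ ≤ 1 / 10 ∧ ∀ y ∈ S1, δ ≤ ‖G y‖ := by
    rcases S1.eq_empty_or_nonempty with h | h
    · exact ⟨1 / 10, by norm_num, le_rfl, by simp [h]⟩
    · obtain ⟨y0, hy0, hmin⟩ := hS1c.exists_isMinOn h (f := fun y => ‖G y‖) (by fun_prop)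
      exact ⟨min ‖G y0‖ (1 / 10), lt_min (norm_pos_iff.2 (hGS1 y0 hy0)) (by norm_num),
        min_le_right _ _, fun y hy => (min_le_left _ _).trans (hmin hy)⟩
  obtain ⟨P, hP, hPd, -⟩ := Continuous.exists_contDiff_approx (f := G)
    (ε := fun _ => δ / 2) 1 G.continuous continuous_const (fun _ => by positivity)
  have hnull : volume (P '' sphere c ε) = 0 :=
    MeasureTheory.addHaar_image_eq_zero_of_differentiableOn_of_addHaar_eq_zero volume
      (hP.differentiable one_ne_zero).differentiableOn (MeasureTheory.Measure.addHaar_sphere _ _ _)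
  obtain ⟨v, hvb, hv⟩ : ∃ v ∈ ball (0 : E3) (δ / 4), v ∉ P '' sphere c ε := by
    by_contra! h
    have := measure_mono_null (show ball (0 : E3) (δ / 4) ⊆ P '' sphere c ε from h) hnull
    exact (measure_ball_pos volume (0 : E3) (by positivity : 0 < δ / 4)).ne' this
  rw [mem_ball_zero_iff] at hvb
  have hPG : ∀ y, ‖G y - (P y - v)‖ < δ := by
    intro y
    have h1 := hPd y
    rw [dist_comm, dist_eq_norm] at h1
    have : G y - (P y - v) = (G y - P y) + v := by abel
    rw [this]
    linarith [norm_add_le (G y - P y) v]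
  set Φ : E3 → E3 := fun y => c + (max (ε / ‖y - c‖) 1) • (y - c) with hΦ
  have hne : ∀ y ∈ K, ‖y - c‖ ≠ 0 := fun y hy h => by
    rw [norm_eq_zero, sub_eq_zero] at h
    exact hcK (h ▸ hy)
  have hΦc : ContinuousOn Φ K := by
    have h1 : ContinuousOn (fun y => ε / ‖y - c‖) K :=
      continuousOn_const.div (by fun_prop) hne
    have h2 : ContinuousOn (fun y => max (ε / ‖y - c‖) 1) K := h1.sup continuousOn_const
    exact continuousOn_const.add (h2.smul (by fun_prop))
  have hΦ1 : ∀ y ∈ K, ε ≤ ‖y - c‖ → Φ y = y := by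
    intro y hy h
    have : max (ε / ‖y - c‖) 1 = 1 := max_eq_right (div_le_one_of_le₀ h (norm_nonneg _))
    simp only [hΦ, this, one_smul]; abel
  have hΦ2 : ∀ y ∈ K, ‖y - c‖ < ε → ‖Φ y - c‖ = ε := by
    intro y hy h
    have h0 : 0 < ‖y - c‖ := (norm_nonneg _).lt_of_ne' (hne y hy)
    have : max (ε / ‖y - c‖) 1 = ε / ‖y - c‖ := max_eq_left ((one_le_div h0).2 h.le)
    simp only [hΦ, this, add_sub_cancel_left, norm_smul, norm_div, norm_norm,
      Real.norm_of_nonneg hε.le]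
    field_simp
  obtain ⟨y, hy, hy0⟩ := stab (fun y => P (Φ y) - v)
    ((hP.continuous.comp_continuousOn hΦc).sub continuousOn_const) (by
      intro y hy
      rcases le_or_gt ε ‖y - c‖ with h | h
      · rw [hΦ1 y hy h]; linarith [hPG y]
      · have h1 := hGc y h.le
        have h2 := hGc (Φ y) (hΦ2 y hy h).le
        have h3 := hPG (Φ y)
        have : G y - (P (Φ y) - v) = G y - G (Φ y) + (G (Φ y) - (P (Φ y) - v)) := by abel
        rw [this]
        have h4 := norm_add_le (G y - G (Φ y)) (G (Φ y) - (P (Φ y) - v))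
        have h5 := norm_sub_le (G y) (G (Φ y))
        linarith)
  rcases le_or_gt ε ‖y - c‖ with h | h
  · simp only [hΦ1 y hy h] at hy0
    have h1 := hPG y
    rw [hy0, sub_zero] at h1
    linarith [hδ y ⟨hy, h⟩]
  · apply hv
    refine ⟨Φ y, ?_, sub_eq_zero.1 hy0⟩
    rw [mem_sphere, dist_eq_norm]
    exact hΦ2 y hy h

/-- Invariance of domain in dimension three. -/
theorem isOpen_image_of_injOn {U : Set E3} (hU : IsOpen U) {f : E3 → E3} (hf : ContinuousOn f U)
    (hinj : InjOn f U) : IsOpen (f '' U) := by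
  rw [isOpen_iff_mem_nhds]
  rintro _ ⟨x, hx, rfl⟩
  obtain ⟨r, hr, hrU⟩ := Metric.nhds_basis_closedBall.mem_iff.1 (hU.mem_nhds hx)
  have hm : MapsTo (fun y : E3 => x + r • y) (closedBall 0 1) (closedBall x r) := by
    intro y hy
    rw [mem_closedBall_zero_iff] at hy
    rw [mem_closedBall, dist_eq_norm, add_sub_cancel_left, norm_smul, Real.norm_of_nonneg hr.le]
    nlinarith
  have key := mem_interior_image_closedBall (f := fun y => f (x + r • y))
    (hf.comp (by fun_prop) (hm.mono_right hrU))
    (fun y hy z hz h => by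
      have := hinj (hrU (hm hy)) (hrU (hm hz)) h
      simpa [hr.ne'] using this)
  simp only [smul_zero, add_zero] at key
  rw [mem_interior_iff_mem_nhds] at key
  refine Filter.mem_of_superset key ?_
  rintro _ ⟨y, hy, rfl⟩
  exact ⟨_, hrU (hm hy), rfl⟩
end HypArc

namespace HypArc

/-- Minkowski 4-space. -/
abbrev V : Type := Fin 4 → ℝ

/-- The Lorentz form on `V`, in coordinates adapted to the upper half-space. -/
def bil (v w : V) : ℝ := (v 0 * w 3 + v 3 * w 0) / 2 - v 1 * w 1 - v 2 * w 2

lemma bil_comm (v w : V) : bil v w = bil w v := by simp only [bil]; ring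
lemma bil_add_left (u v w : V) : bil (u + v) w = bil u w + bil v w := by
  simp only [bil, Pi.add_apply]; ring
lemma bil_add_right (u v w : V) : bil w (u + v) = bil w u + bil w v := by
  simp only [bil, Pi.add_apply]; ring
lemma bil_sub_left (u v w : V) : bil (u - v) w = bil u w - bil v w := by
  simp only [bil, Pi.sub_apply]; ring
lemma bil_sub_right (u v w : V) : bil w (u - v) = bil w u - bil w v := by
  simp only [bil, Pi.sub_apply]; ring
lemma bil_smul_left (c : ℝ) (v w : V) : bil (c • v) w = c * bil v w := by
  simp only [bil, Pi.smul_apply, smul_eq_mul]; ring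
lemma bil_smul_right (c : ℝ) (v w : V) : bil w (c • v) = c * bil w v := by
  simp only [bil, Pi.smul_apply, smul_eq_mul]; ring
lemma bil_neg_left (v w : V) : bil (-v) w = -bil v w := by
  simp only [bil, Pi.neg_apply]; ring
lemma bil_neg_right (v w : V) : bil w (-v) = -bil w v := by
  simp only [bil, Pi.neg_apply]; ring
lemma bil_zero_left (w : V) : bil 0 w = 0 := by simp [bil]
lemma bil_zero_right (w : V) : bil w 0 = 0 := by simp [bil]

lemma continuous_bil : Continuous fun p : V × V => bil p.1 p.2 := by
  unfold bil; fun_prop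

lemma Continuous.bil {X : Type*} [TopologicalSpace X] {f g : X → V} (hf : Continuous f)
    (hg : Continuous g) : Continuous fun x => bil (f x) (g x) :=
  continuous_bil.comp (hf.prodMk hg)

lemma bil_nondeg {v : V} (h : ∀ w, bil v w = 0) : v = 0 := by
  have h0 := h (Pi.single 3 1)
  have h1 := h (Pi.single 1 1)
  have h2 := h (Pi.single 2 1)
  have h3 := h (Pi.single 0 1)
  simp [bil] at h0 h1 h2 h3
  ext i; fin_cases i <;> simp [h0, h1, h2, h3]

/-- Hyperbolic 3-space, as the upper sheet of the hyperboloid. -/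
@[ext] structure Hyp where
  val : V
  pos : 0 < val 0
  eq : bil val val = 1

namespace Hyp

instance : Coe Hyp V := ⟨Hyp.val⟩

lemma val_injective : Function.Injective Hyp.val := fun _ _ h => Hyp.ext h

lemma apply_three (p : Hyp) : p.val 3 = (1 + p.val 1 ^ 2 + p.val 2 ^ 2) / p.val 0 := by
  have := p.eq
  have h0 := p.pos
  rw [eq_div_iff h0.ne']
  simp only [bil] at this
  linarith

lemma bil_eq (p q : Hyp) : bil p q = 1 + ((p.val 0 - q.val 0) ^ 2 +
    (p.val 0 * q.val 1 - q.val 0 * p.val 1) ^ 2 + (p.val 0 * q.val 2 - q.val 0 * p.val 2) ^ 2) /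
      (2 * p.val 0 * q.val 0) := by
  have hp := p.pos
  have hq := q.pos
  simp only [bil, apply_three]
  field_simp
  ring

lemma one_le_bil (p q : Hyp) : 1 ≤ bil p q := by
  have hp := p.pos
  have hq := q.pos
  rw [bil_eq]
  have : 0 ≤ ((p.val 0 - q.val 0) ^ 2 +
    (p.val 0 * q.val 1 - q.val 0 * p.val 1) ^ 2 + (p.val 0 * q.val 2 - q.val 0 * p.val 2) ^ 2) /
      (2 * p.val 0 * q.val 0) := by positivity
  linarith

lemma eq_of_bil_eq_one {p q : Hyp} (h : bil p q = 1) : p = q := by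
  have hp := p.pos
  have hq := q.pos
  rw [bil_eq, add_eq_left, _root_.div_eq_zero_iff] at h
  have h := h.resolve_right (by positivity)
  have h0 : p.val 0 = q.val 0 := by
    nlinarith [sq_nonneg (p.val 0 - q.val 0),
      sq_nonneg (p.val 0 * q.val 1 - q.val 0 * p.val 1),
      sq_nonneg (p.val 0 * q.val 2 - q.val 0 * p.val 2)]
  rw [h0] at h
  have h1 : q.val 0 * (q.val 1 - p.val 1) = 0 := by
    nlinarith [sq_nonneg (q.val 0 * q.val 1 - q.val 0 * p.val 1),
      sq_nonneg (q.val 0 * q.val 2 - q.val 0 * p.val 2)]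
  have h2 : q.val 0 * (q.val 2 - p.val 2) = 0 := by
    nlinarith [sq_nonneg (q.val 0 * q.val 1 - q.val 0 * p.val 1),
      sq_nonneg (q.val 0 * q.val 2 - q.val 0 * p.val 2)]
  have h1 := (mul_eq_zero.1 h1).resolve_left hq.ne'
  have h2 := (mul_eq_zero.1 h2).resolve_left hq.ne'
  ext i
  fin_cases i
  · exact h0
  · simp; linarith
  · simp; linarith
  · have e1 : p.val 1 = q.val 1 := by linarith
    have e2 : p.val 2 = q.val 2 := by linarith
    simp [apply_three, h0, e1, e2]

/-- The reversed Cauchy-Schwarz inequality. -/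
lemma bil_self_le_sq (b : Hyp) (v : V) : bil v v ≤ bil v b ^ 2 := by
  set c := v 0 / b.val 0 with hc
  have h0 : v 0 = c * b.val 0 := (div_mul_cancel₀ _ b.pos.ne').symm
  have h : bil (v - c • b.val) (v - c • b.val) ≤ 0 := by
    have : (v - c • b.val) 0 = 0 := by simp [h0]
    simp only [bil, this]
    nlinarith [sq_nonneg ((v - c • b.val) 1), sq_nonneg ((v - c • b.val) 2)]
  simp only [bil_sub_left, bil_sub_right, bil_smul_left, bil_smul_right, b.eq,
    bil_comm b.val v] at h
  nlinarith [sq_nonneg (bil v b - c)]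

lemma bil_cauchy (b : Hyp) (v w : V) :
    (bil v b * bil w b - bil v w) ^ 2 ≤ (bil v b ^ 2 - bil v v) * (bil w b ^ 2 - bil w w) := by
  have key : ∀ s t : ℝ, 0 ≤ s ^ 2 * (bil v b ^ 2 - bil v v) +
      2 * s * t * (bil v b * bil w b - bil v w) + t ^ 2 * (bil w b ^ 2 - bil w w) := by
    intro s t
    have := bil_self_le_sq b (s • v + t • w)
    simp only [bil_add_left, bil_add_right, bil_smul_left, bil_smul_right, bil_comm w v] at this
    linarith
  set x := bil v b ^ 2 - bil v v
  set y := bil v b * bil w b - bil v w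
  set z := bil w b ^ 2 - bil w w
  have hz := key 0 1
  have hx := key 1 0
  rcases eq_or_ne z 0 with h | h
  · rw [h] at key ⊢
    by_contra! hy
    have hy0 : y ≠ 0 := by intro h; rw [h] at hy; simp at hy
    have := key 1 (-(x + 1) / (2 * y))
    have e : 2 * 1 * (-(x + 1) / (2 * y)) * y = -(x + 1) := by field_simp
    rw [e] at this
    linarith
  · have hz : 0 < z := lt_of_le_of_ne (by simpa using hz) h.symm
    have := key z (-y)
    have h3 : 0 ≤ z * (x * z - y ^ 2) := by linarith
    have := (mul_nonneg_iff_of_pos_left hz).1 h3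
    linarith

instance : Dist Hyp := ⟨fun p q => Real.arcosh (bil p q)⟩

lemma dist_def (p q : Hyp) : dist p q = Real.arcosh (bil p q) := rfl

lemma cosh_dist (p q : Hyp) : Real.cosh (dist p q) = bil p q := by
  rw [dist_def, Real.cosh_arcosh (one_le_bil p q)]

lemma dist_nonneg' (p q : Hyp) : 0 ≤ dist p q := Real.arcosh_nonneg (one_le_bil p q)

instance : MetricSpace Hyp where
  dist_self p := by rw [dist_def, p.eq]; simp
  dist_comm p q := by rw [dist_def, dist_def, bil_comm]
  dist_triangle a b c := by
    have h1 := dist_nonneg' a b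
    have h2 := dist_nonneg' b c
    have h3 := dist_nonneg' a c
    rw [← abs_of_nonneg h3, ← abs_of_nonneg (add_nonneg h1 h2), ← Real.cosh_le_cosh,
      Real.cosh_add, cosh_dist, cosh_dist, cosh_dist]
    have s1 : 0 ≤ Real.sinh (dist a b) := Real.sinh_nonneg_iff.2 h1
    have s2 : 0 ≤ Real.sinh (dist b c) := Real.sinh_nonneg_iff.2 h2
    have e1 := Real.sinh_sq (dist a b)
    have e2 := Real.sinh_sq (dist b c)
    rw [cosh_dist] at e1 e2
    have key := bil_cauchy b a c
    rw [a.eq, c.eq, bil_comm c.val b, ← e1, ← e2, ← mul_pow] at key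
    have := abs_le_of_sq_le_sq key (by positivity)
    linarith [neg_abs_le (bil ↑a ↑b * bil ↑b ↑c - bil ↑a ↑c)]
  eq_of_dist_eq_zero {p q} h := by
    apply eq_of_bil_eq_one
    rw [← cosh_dist, h, Real.cosh_zero]

end Hyp
end HypArc

namespace HypArc

/-- Linear endomorphisms of `V` from matrices. -/
def matCLM : Matrix (Fin 4) (Fin 4) ℝ →ₗ[ℝ] (V →L[ℝ] V) :=
  (LinearMap.toContinuousLinearMap : (V →ₗ[ℝ] V) ≃ₗ[ℝ] (V →L[ℝ] V)).toLinearMap ∘ₗ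
    (Matrix.toLin' : Matrix (Fin 4) (Fin 4) ℝ ≃ₗ[ℝ] (V →ₗ[ℝ] V)).toLinearMap

lemma matCLM_apply (M : Matrix (Fin 4) (Fin 4) ℝ) (v : V) : matCLM M v = M.mulVec v := rfl

lemma continuous_matCLM : Continuous matCLM := LinearMap.continuous_of_finiteDimensional _

lemma bil_self_eq_one_pos {v : V} (b : Hyp) (hv : bil v v = 1) (hb : 0 < bil v b) : 0 < v 0 := by
  by_contra! h
  have hv0 : v 0 ≠ 0 := by
    intro h0
    simp only [bil, h0] at hv
    nlinarith [sq_nonneg (v 1), sq_nonneg (v 2)]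
  have : 0 < (-v) 0 := by simp only [Pi.neg_apply]; exact neg_pos.2 (lt_of_le_of_ne h hv0)
  have h1 := Hyp.one_le_bil ⟨-v, this, by rw [bil_neg_left, bil_neg_right, hv]; ring⟩ b
  simp only [bil_neg_left] at h1
  linarith

/-- The group of linear automorphisms of `V` which preserve the form and the upper sheet. -/
def Lor : Subgroup (V →L[ℝ] V)ˣ where
  carrier := {g | (∀ v w, bil (g.1 v) (g.1 w) = bil v w) ∧ ∀ p : Hyp, 0 < g.1 p.val 0}
  one_mem' := ⟨fun _ _ => rfl, fun p => p.pos⟩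
  mul_mem' {g h} hg hh := ⟨fun v w => (hg.1 _ _).trans (hh.1 _ _),
    fun p => hg.2 ⟨h.1 p.val, hh.2 p, by rw [hh.1, p.eq]⟩⟩
  inv_mem' {g} hg := by
    have hc : ∀ v, g.1 (g⁻¹.1 v) = v := fun v => DFunLike.congr_fun g.mul_inv v
    have hb : ∀ v w, bil (g⁻¹.1 v) (g⁻¹.1 w) = bil v w := fun v w => by
      rw [← hg.1, hc, hc]
    refine ⟨hb, fun p => ?_⟩
    have hgp : bil (g⁻¹.1 p.val) p = bil (g.1 p.val) p := by
      rw [← hg.1, hc, bil_comm]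
    refine bil_self_eq_one_pos p (by rw [hb, p.eq]) ?_
    rw [hgp]
    exact one_pos.trans_le
      (Hyp.one_le_bil ⟨g.1 p.val, hg.2 p, by rw [hg.1, p.eq]⟩ p)

namespace Lor

/-- The underlying linear map. -/
def lin (g : Lor) : V →L[ℝ] V := g.1.1

@[simp] lemma lin_one : lin 1 = 1 := rfl
@[simp] lemma lin_mul (g h : Lor) : lin (g * h) = lin g * lin h := rfl
lemma lin_mul_apply (g h : Lor) (v : V) : lin (g * h) v = lin g (lin h v) := rfl
@[simp] lemma lin_inv_lin (g : Lor) (v : V) : lin g⁻¹ (lin g v) = v :=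
  DFunLike.congr_fun g.1.inv_mul v
@[simp] lemma lin_lin_inv (g : Lor) (v : V) : lin g (lin g⁻¹ v) = v :=
  DFunLike.congr_fun g.1.mul_inv v
lemma lin_inv_mul (g : Lor) : lin g⁻¹ * lin g = 1 := g.1.inv_mul
lemma lin_mul_inv (g : Lor) : lin g * lin g⁻¹ = 1 := g.1.mul_inv

lemma lin_injective : Function.Injective lin := fun _ _ h => Subtype.ext (Units.ext h)

lemma bil_lin (g : Lor) (v w : V) : bil (lin g v) (lin g w) = bil v w := g.2.1 v w

lemma bil_lin_left (g : Lor) (v w : V) : bil (lin g v) w = bil v (lin g⁻¹ w) := by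
  rw [← bil_lin g v, lin_lin_inv]

instance : MulAction Lor Hyp where
  smul g p := ⟨lin g p.val, g.2.2 p, by rw [bil_lin, p.eq]⟩
  one_smul p := rfl
  mul_smul g h p := rfl

@[simp] lemma val_smul (g : Lor) (p : Hyp) : (g • p).val = lin g p.val := rfl

lemma dist_smul_smul (g : Lor) (p q : Hyp) : dist (g • p) (g • q) = dist p q := by
  rw [Hyp.dist_def, Hyp.dist_def, val_smul, val_smul, bil_lin]

instance : IsIsometricSMul Lor Hyp := ⟨fun g => Isometry.of_dist_eq (dist_smul_smul g)⟩

end Lor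

namespace Hyp

/-- The base point. -/
def e : Hyp := ⟨![1, 0, 0, 1], by simp, by simp [bil]⟩

@[simp] lemma e_zero : e.val 0 = 1 := rfl
@[simp] lemma e_one : e.val 1 = 0 := rfl
@[simp] lemma e_two : e.val 2 = 0 := rfl
@[simp] lemma e_three : e.val 3 = 1 := rfl

/-- The matrix of the affine map of the half-space taking the base point to `p`. -/
def frameMat (p : V) : Matrix (Fin 4) (Fin 4) ℝ :=
  !![p 0, 0, 0, 0; p 1, 1, 0, 0; p 2, 0, 1, 0;
    (p 1 ^ 2 + p 2 ^ 2) / p 0, 2 * (p 1 / p 0), 2 * (p 2 / p 0), (p 0)⁻¹]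

/-- The inverse of `frameMat`. -/
def frameMatInv (p : V) : Matrix (Fin 4) (Fin 4) ℝ :=
  !![(p 0)⁻¹, 0, 0, 0; -(p 1 / p 0), 1, 0, 0; -(p 2 / p 0), 0, 1, 0;
    (p 1 ^ 2 + p 2 ^ 2) / p 0, -(2 * p 1), -(2 * p 2), p 0]

lemma frameMat_mul_inv {p : V} (h : p 0 ≠ 0) : matCLM (frameMat p) * matCLM (frameMatInv p) = 1 := by
  ext v i
  change (frameMat p).mulVec ((frameMatInv p).mulVec v) i = v i
  fin_cases i <;>
    simp [frameMat, frameMatInv, Matrix.mulVec, dotProduct, Fin.sum_univ_four] <;>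
    field_simp <;> ring

lemma frameMatInv_mul {p : V} (h : p 0 ≠ 0) : matCLM (frameMatInv p) * matCLM (frameMat p) = 1 := by
  ext v i
  change (frameMatInv p).mulVec ((frameMat p).mulVec v) i = v i
  fin_cases i <;>
    simp [frameMat, frameMatInv, Matrix.mulVec, dotProduct, Fin.sum_univ_four] <;>
    field_simp <;> ring

/-- The affine map of the half-space taking the base point to `p`. -/
def frame (p : Hyp) : Lor :=
  ⟨⟨matCLM (frameMat p.val), matCLM (frameMatInv p.val), frameMat_mul_inv p.pos.ne',
    frameMatInv_mul p.pos.ne'⟩, by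
    have hp := p.pos
    refine ⟨fun v w => ?_, fun q => ?_⟩
    · simp [matCLM_apply, bil, frameMat, Matrix.mulVec, dotProduct, Fin.sum_univ_four]
      field_simp
      ring
    · have hq := q.pos
      simp [matCLM_apply, frameMat, Matrix.mulVec, dotProduct, Fin.sum_univ_four]
      positivity⟩

lemma lin_frame (p : Hyp) : Lor.lin (frame p) = matCLM (frameMat p.val) := rfl
lemma lin_frame_inv (p : Hyp) : Lor.lin (frame p)⁻¹ = matCLM (frameMatInv p.val) := rfl

@[simp] lemma frame_smul_e (p : Hyp) : frame p • e = p := by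
  apply val_injective
  rw [Lor.val_smul, lin_frame, matCLM_apply]
  ext i
  have hp := p.pos
  fin_cases i <;> simp [frameMat, Matrix.mulVec, dotProduct, Fin.sum_univ_four, e, apply_three]
  field_simp
  ring

@[simp] lemma frame_inv_smul (p : Hyp) : (frame p)⁻¹ • p = e := by
  rw [inv_smul_eq_iff, frame_smul_e]

lemma dist_eq_frame (p q : Hyp) : dist p q = dist e ((frame p)⁻¹ • q) := by
  rw [← frame_inv_smul p, dist_smul]

lemma bil_e (q : Hyp) : bil q e = (q.val 0 + q.val 3) / 2 := by simp [bil]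

lemma norm_sub_e_le (q : Hyp) : ‖q.val - e.val‖ ≤ Real.exp (dist q e) - 1 := by
  have hc := cosh_dist q e
  rw [bil_e] at hc
  have hs := Real.sinh_sq (dist q e)
  have hs0 : 0 ≤ Real.sinh (dist q e) := Real.sinh_nonneg_iff.2 dist_nonneg
  have hc1 := Real.one_le_cosh (dist q e)
  have he : Real.exp (dist q e) = Real.cosh (dist q e) + Real.sinh (dist q e) :=
    (Real.cosh_add_sinh _).symm
  have hq := q.eq
  simp only [bil] at hq
  set c := Real.cosh (dist q e)
  set s := Real.sinh (dist q e)
  have e3 : q.val 3 = 2 * c - q.val 0 := by linarith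
  rw [e3] at hq
  have hsq : (q.val 0 - c) ^ 2 + q.val 1 ^ 2 + q.val 2 ^ 2 = s ^ 2 := by rw [hs]; linarith
  have b0 : |q.val 0 - c| ≤ s := abs_le_of_sq_le_sq (by nlinarith [sq_nonneg (q.val 1), sq_nonneg (q.val 2)]) hs0
  have b1 : |q.val 1| ≤ s := abs_le_of_sq_le_sq (by nlinarith [sq_nonneg (q.val 0 - c), sq_nonneg (q.val 2)]) hs0
  have b2 : |q.val 2| ≤ s := abs_le_of_sq_le_sq (by nlinarith [sq_nonneg (q.val 0 - c), sq_nonneg (q.val 1)]) hs0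
  rw [abs_le] at b0 b1 b2
  rw [he, pi_norm_le_iff_of_nonneg (by linarith)]
  intro i
  rw [Real.norm_eq_abs, abs_le]
  fin_cases i <;> simp [e3] <;> constructor <;> linarith

lemma norm_sub_le (p q : Hyp) :
    ‖q.val - p.val‖ ≤ ‖Lor.lin (frame p)‖ * (Real.exp (dist q p) - 1) := by
  have h : q.val - p.val = Lor.lin (frame p) (((frame p)⁻¹ • q).val - e.val) := by
    rw [map_sub, ← Lor.val_smul, ← Lor.val_smul, frame_smul_e, smul_inv_smul]
  rw [h]
  refine (ContinuousLinearMap.le_opNorm _ _).trans ?_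
  have := norm_sub_e_le ((frame p)⁻¹ • q)
  rw [dist_comm q p, dist_eq_frame p q, dist_comm]
  gcongr

lemma continuous_val : Continuous Hyp.val := by
  rw [continuous_iff_continuousAt]
  intro p
  rw [ContinuousAt, tendsto_iff_norm_sub_tendsto_zero]
  refine squeeze_zero (fun _ => norm_nonneg _) (fun q => norm_sub_le p q) ?_
  have : Continuous fun q : Hyp => ‖Lor.lin (frame p)‖ * (Real.exp (dist q p) - 1) := by fun_prop
  simpa using this.tendsto p

lemma isInducing_val : Topology.IsInducing Hyp.val := by
  rw [Topology.isInducing_iff_nhds]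
  intro p
  refine le_antisymm (Filter.tendsto_iff_comap.1 continuous_val.continuousAt) ?_
  rw [(Metric.nhds_basis_ball (x := p)).ge_iff]
  intro r hr
  have h1 : Continuous fun v : V => bil v p.val := Continuous.bil continuous_id continuous_const
  have h2 : {v : V | bil v p.val < Real.cosh r} ∈ nhds p.val := by
    apply (isOpen_lt h1 continuous_const).mem_nhds
    change bil p.val p.val < _
    rw [p.eq]; exact Real.one_lt_cosh.2 hr.ne'
  refine ⟨_, h2, fun q hq => ?_⟩
  change bil q.val p.val < Real.cosh r at hq
  rw [← cosh_dist, Real.cosh_lt_cosh, abs_of_nonneg dist_nonneg, abs_of_pos hr] at hq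
  exact hq

lemma isClosedEmbedding_val : Topology.IsClosedEmbedding Hyp.val := by
  refine ⟨⟨isInducing_val, val_injective⟩, ?_⟩
  have : range Hyp.val = {v : V | 0 ≤ v 0} ∩ {v : V | bil v v = 1} := by
    ext v; constructor
    · rintro ⟨p, rfl⟩; exact ⟨p.pos.le, p.eq⟩
    · rintro ⟨h1, h2⟩
      have h2 : bil v v = 1 := h2
      refine ⟨⟨v, lt_of_le_of_ne h1 fun h0 => ?_, h2⟩, rfl⟩
      simp only [bil, ← h0] at h2
      nlinarith [sq_nonneg (v 1), sq_nonneg (v 2)]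
  rw [this]
  exact (isClosed_le continuous_const (continuous_apply 0)).inter
    (isClosed_eq (Continuous.bil continuous_id continuous_id) continuous_const)

instance : ProperSpace Hyp := by
  refine ⟨fun p r => ?_⟩
  have : closedBall p r ⊆ Hyp.val ⁻¹' closedBall p.val (‖Lor.lin (frame p)‖ * (Real.exp r - 1)) := by
    intro q hq
    rw [mem_preimage, mem_closedBall, dist_eq_norm]
    refine (norm_sub_le p q).trans ?_
    rw [mem_closedBall] at hq
    gcongr
  exact (isClosedEmbedding_val.isCompact_preimage (isCompact_closedBall _ _)).of_isClosed_subset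
    isClosed_closedBall this

lemma continuous_lin_frame : Continuous fun p => Lor.lin (frame p) := by
  simp only [lin_frame]
  refine continuous_matCLM.comp (continuous_matrix fun i j => ?_)
  have h : ∀ i, Continuous fun p : Hyp => p.val i := fun i => (continuous_apply i).comp continuous_val
  have h0 : ∀ p : Hyp, p.val 0 ≠ 0 := fun p => p.pos.ne'
  have := h 0; have := h 1; have := h 2
  fin_cases i <;> fin_cases j <;> simp [frameMat] <;> fun_prop (disch := exact h0)

lemma continuous_lin_frame_inv : Continuous fun p => Lor.lin (frame p)⁻¹ := by
  simp only [lin_frame_inv]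
  refine continuous_matCLM.comp (continuous_matrix fun i j => ?_)
  have h : ∀ i, Continuous fun p : Hyp => p.val i := fun i => (continuous_apply i).comp continuous_val
  have h0 : ∀ p : Hyp, p.val 0 ≠ 0 := fun p => p.pos.ne'
  have := h 0; have := h 1; have := h 2
  fin_cases i <;> fin_cases j <;> simp [frameMatInv] <;> fun_prop (disch := exact h0)

end Hyp
end HypArc

namespace HypArc

/-- `f` preserves distances on `U`. -/
def IsoOn {A B : Type*} [MetricSpace A] [MetricSpace B] (f : A → B) (U : Set A) : Prop :=
  ∀ x ∈ U, ∀ y ∈ U, dist (f x) (f y) = dist x y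

lemma IsoOn.mono {A B : Type*} [MetricSpace A] [MetricSpace B] {f : A → B} {U W : Set A}
    (h : IsoOn f W) (hUW : U ⊆ W) : IsoOn f U :=
  fun x hx y hy => h x (hUW hx) y (hUW hy)

lemma IsoOn.congr {A B : Type*} [MetricSpace A] [MetricSpace B] {f g : A → B} {U : Set A}
    (h : IsoOn f U) (hfg : EqOn f g U) : IsoOn g U :=
  fun x hx y hy => by rw [← hfg hx, ← hfg hy, h x hx y hy]

lemma IsoOn.injOn {A B : Type*} [MetricSpace A] [MetricSpace B] {f : A → B} {U : Set A}
    (h : IsoOn f U) : InjOn f U := fun x hx y hy hxy => by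
  rw [← dist_eq_zero, ← h x hx y hy, hxy, dist_self]

lemma IsoOn.continuousOn {A B : Type*} [MetricSpace A] [MetricSpace B] {f : A → B} {U : Set A}
    (h : IsoOn f U) : ContinuousOn f U := by
  rw [continuousOn_iff_continuous_domRestrict]
  exact Isometry.continuous (Isometry.of_dist_eq fun x y => h x x.2 y y.2)

namespace Hyp

/-- The unit-speed geodesic from `a` in the direction `u`. -/
def geo (a : Hyp) (u : V) (h1 : bil u a = 0) (h2 : bil u u = -1) (t : ℝ) : Hyp :=
  have hv : bil (Real.cosh t • a.val + Real.sinh t • u) (Real.cosh t • a.val + Real.sinh t • u) = 1 := by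
    simp only [bil_add_left, bil_add_right, bil_smul_left, bil_smul_right, bil_comm a.val u, h1, h2,
      a.eq]
    nlinarith [Real.cosh_sq t]
  ⟨Real.cosh t • a.val + Real.sinh t • u, bil_self_eq_one_pos a hv (by
    simp only [bil_add_left, bil_smul_left, h1, a.eq]
    nlinarith [Real.cosh_pos t]), hv⟩

lemma isometry_geo (a : Hyp) (u : V) (h1 : bil u a = 0) (h2 : bil u u = -1) :
    Isometry (geo a u h1 h2) := by
  refine Isometry.of_dist_eq fun s t => ?_
  have : bil (geo a u h1 h2 s).val (geo a u h1 h2 t).val = Real.cosh (|s - t|) := by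
    simp only [geo, bil_add_left, bil_add_right, bil_smul_left, bil_smul_right, bil_comm a.val u,
      h1, h2, a.eq, Real.cosh_abs, Real.cosh_sub]
    ring
  rw [dist_def, this, Real.arcosh_cosh (abs_nonneg _), Real.dist_eq]

lemma exists_unit_orthogonal (a : Hyp) : ∃ u : V, bil u a = 0 ∧ bil u u = -1 := by
  refine ⟨Lor.lin (frame a) ![0, 1, 0, 0], ?_, ?_⟩
  · rw [Lor.bil_lin_left, ← Lor.val_smul, frame_inv_smul]; simp [bil]
  · rw [Lor.bil_lin]; simp [bil]

lemma sinh_add_sinh_le {s t : ℝ} (hs : 0 ≤ s) (ht : 0 ≤ t) :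
    Real.sinh s + Real.sinh t ≤ Real.sinh (s + t) := by
  rw [Real.sinh_add]
  nlinarith [Real.one_le_cosh s, Real.one_le_cosh t, Real.sinh_nonneg_iff.2 hs,
    Real.sinh_nonneg_iff.2 ht]

lemma mem_ball_iff {p c : Hyp} {r : ℝ} (hr : 0 < r) : p ∈ ball c r ↔ bil p c < Real.cosh r := by
  rw [mem_ball, ← cosh_dist, Real.cosh_lt_cosh, abs_of_nonneg dist_nonneg, abs_of_pos hr]

lemma exists_geodesic (a b : Hyp) : ∃ σ : ℝ → Hyp, Isometry σ ∧ σ 0 = a ∧ σ (dist a b) = b ∧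
    ∀ c r, a ∈ ball c r → b ∈ ball c r → ∀ t ∈ Icc 0 (dist a b), σ t ∈ ball c r := by
  rcases eq_or_ne a b with rfl | hab
  · obtain ⟨u, h1, h2⟩ := exists_unit_orthogonal a
    have h0 : geo a u h1 h2 0 = a := by apply val_injective; simp [geo]
    refine ⟨geo a u h1 h2, isometry_geo a u h1 h2, h0, by rw [dist_self, h0], fun c r ha _ t ht => ?_⟩
    have : t = 0 := by rw [dist_self] at ht; exact le_antisymm ht.2 ht.1
    rwa [this, h0]
  · set l := dist a b with hl
    have hl0 : 0 < l := dist_pos.2 hab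
    have hs : 0 < Real.sinh l := Real.sinh_pos_iff.2 hl0
    have hc : bil a.val b.val = Real.cosh l := (cosh_dist a b).symm
    have hsq := Real.cosh_sq l
    set u : V := (Real.sinh l)⁻¹ • (b.val - Real.cosh l • a.val) with hu
    have h1 : bil u a = 0 := by
      simp only [hu, bil_smul_left, bil_sub_left, bil_comm b.val a.val, hc, a.eq]; ring
    have h2 : bil u u = -1 := by
      simp only [hu, bil_smul_left, bil_sub_left, bil_smul_right, bil_sub_right,
        bil_comm b.val a.val, hc, a.eq, b.eq]
      field_simp
      linarith
    refine ⟨geo a u h1 h2, isometry_geo a u h1 h2, ?_, ?_, fun c r ha hb t ht => ?_⟩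
    · apply val_injective; simp [geo]
    · apply val_injective
      simp only [geo, hu, smul_smul, mul_inv_cancel₀ hs.ne', one_smul]
      abel
    · have hr : 0 < r := dist_nonneg.trans_lt ha
      rw [mem_ball_iff hr] at ha hb ⊢
      have key : Real.sinh l * bil (geo a u h1 h2 t).val c =
          Real.sinh (l - t) * bil a c + Real.sinh t * bil b c := by
        simp only [geo, hu, bil_smul_left, bil_sub_left, bil_add_left, Real.sinh_sub]
        field_simp
        ring
      have h3 := sinh_add_sinh_le (sub_nonneg.2 ht.2) ht.1
      rw [sub_add_cancel] at h3
      have h4 : 0 ≤ Real.sinh (l - t) := Real.sinh_nonneg_iff.2 (sub_nonneg.2 ht.2)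
      have h5 : 0 ≤ Real.sinh t := Real.sinh_nonneg_iff.2 ht.1
      have hm : max (bil a c) (bil b c) < Real.cosh r := max_lt ha hb
      have hm0 : 0 ≤ max (bil a c) (bil b c) :=
        (zero_le_one.trans (one_le_bil a c)).trans (le_max_left _ _)
      have h6 : Real.sinh l * bil (geo a u h1 h2 t).val c ≤
          Real.sinh l * max (bil a c) (bil b c) := by
        rw [key]
        nlinarith [le_max_left (bil a.val c.val) (bil b.val c.val),
          le_max_right (bil a.val c.val) (bil b.val c.val)]
      exact (le_of_mul_le_mul_left h6 hs).trans_lt hm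

/-- Any two points of `U` are joined by a geodesic segment in `U`. -/
def Convex (U : Set Hyp) : Prop := ∀ a ∈ U, ∀ b ∈ U, ∃ σ : ℝ → Hyp, Isometry σ ∧ σ 0 = a ∧
  σ (dist a b) = b ∧ ∀ t ∈ Icc 0 (dist a b), σ t ∈ U

lemma convex_ball (c : Hyp) (r : ℝ) : Convex (ball c r) := fun a ha b hb => by
  obtain ⟨σ, h1, h2, h3, h4⟩ := exists_geodesic a b
  exact ⟨σ, h1, h2, h3, h4 c r ha hb⟩

lemma convex_ball_inter (c c' : Hyp) (r r' : ℝ) : Convex (ball c r ∩ ball c' r') :=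
  fun a ha b hb => by
    obtain ⟨σ, h1, h2, h3, h4⟩ := exists_geodesic a b
    exact ⟨σ, h1, h2, h3, fun t ht => ⟨h4 c r ha.1 hb.1 t ht, h4 c' r' ha.2 hb.2 t ht⟩⟩

lemma convex_univ : Convex univ := fun a _ b _ => by
  obtain ⟨σ, h1, h2, h3, -⟩ := exists_geodesic a b
  exact ⟨σ, h1, h2, h3, fun _ _ => mem_univ _⟩

lemma Convex.isPreconnected {U : Set Hyp} (hU : Convex U) : IsPreconnected U := by
  refine isPreconnected_of_forall_pair fun a ha b hb => ?_
  obtain ⟨σ, h1, h2, h3, h4⟩ := hU a ha b hb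
  refine ⟨σ '' Icc 0 (dist a b), image_subset_iff.2 h4, ⟨0, ⟨le_rfl, dist_nonneg⟩, h2⟩,
    ⟨dist a b, ⟨dist_nonneg, le_rfl⟩, h3⟩, isPreconnected_Icc.image _ h1.continuous.continuousOn⟩

/-- Upper half-space coordinates on the hyperboloid. -/
def ofHalf (x : E3) : Hyp :=
  if h : 0 < x 2 then ⟨![(x 2)⁻¹, x 0 / x 2, x 1 / x 2, (x 0 ^ 2 + x 1 ^ 2 + x 2 ^ 2) / x 2],
    by simpa using h, by simp [bil]; field_simp; ring⟩ else e

lemma val_ofHalf {x : E3} (h : 0 < x 2) : (ofHalf x).val =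
    ![(x 2)⁻¹, x 0 / x 2, x 1 / x 2, (x 0 ^ 2 + x 1 ^ 2 + x 2 ^ 2) / x 2] := by
  simp [ofHalf, h]

/-- The half-space point of a point of the hyperboloid. -/
def toHalf (p : Hyp) : E3 := !₂[p.val 1 / p.val 0, p.val 2 / p.val 0, (p.val 0)⁻¹]

lemma toHalf_pos (p : Hyp) : 0 < toHalf p 2 := by simpa [toHalf] using p.pos

lemma ofHalf_toHalf (p : Hyp) : ofHalf (toHalf p) = p := by
  apply val_injective
  rw [val_ofHalf (toHalf_pos p)]
  have hp := p.pos
  ext i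
  fin_cases i <;> simp [toHalf, apply_three]
  · field_simp
  · field_simp
  · field_simp
    ring

lemma toHalf_injective : Function.Injective toHalf :=
  Function.LeftInverse.injective ofHalf_toHalf

lemma toHalf_ofHalf {x : E3} (h : 0 < x 2) : toHalf (ofHalf x) = x := by
  ext i
  rw [toHalf, val_ofHalf h]
  fin_cases i <;> simp <;> field_simp

lemma continuous_toHalf : Continuous toHalf := by
  have h : ∀ i, Continuous fun p : Hyp => p.val i := fun i => (continuous_apply i).comp continuous_val
  have h0 : ∀ p : Hyp, p.val 0 ≠ 0 := fun p => p.pos.ne'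
  have := h 0; have := h 1; have := h 2
  refine (PiLp.continuous_toLp 2 _).comp (continuous_pi fun i => ?_)
  fin_cases i <;> simp <;> fun_prop (disch := exact h0)

lemma continuousOn_ofHalf : ContinuousOn ofHalf {x | 0 < x 2} := by
  rw [continuousOn_iff_continuous_domRestrict, isInducing_val.continuous_iff]
  have h : ∀ i, Continuous fun x : {x : E3 | 0 < x 2} => x.1 i := fun i => by fun_prop
  have h0 : ∀ x : {x : E3 | 0 < x 2}, x.1 2 ≠ 0 := fun p => ne_of_gt p.2
  have := h 0; have := h 1; have := h 2
  have : Hyp.val ∘ domRestrict {x : E3 | 0 < x 2} ofHalf = fun x =>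
      ![(x.1 2)⁻¹, x.1 0 / x.1 2, x.1 1 / x.1 2, (x.1 0 ^ 2 + x.1 1 ^ 2 + x.1 2 ^ 2) / x.1 2] :=
    funext fun x => val_ofHalf x.2
  rw [this]
  refine continuous_pi fun i => ?_
  fin_cases i <;> simp <;> fun_prop (disch := exact h0)

lemma dist_ofHalf {x y : E3} (hx : 0 < x 2) (hy : 0 < y 2) :
    dist (ofHalf x) (ofHalf y) = hypDist x y := by
  rw [hypDist, dist_def]
  change Real.arcosh _ = Real.arcosh _
  congr 1
  rw [val_ofHalf hx, val_ofHalf hy, EuclideanSpace.dist_eq, Real.sq_sqrt (by positivity)]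
  simp [bil, Fin.sum_univ_three, Real.dist_eq]
  field_simp
  ring

lemma isOpen_image_ofHalf {U : Set E3} (hU : IsOpen U) (h : U ⊆ {x | 0 < x 2}) :
    IsOpen (ofHalf '' U) := by
  have : ofHalf '' U = toHalf ⁻¹' U := by
    ext p; constructor
    · rintro ⟨x, hx, rfl⟩; rw [mem_preimage, toHalf_ofHalf (h hx)]; exact hx
    · intro hp; exact ⟨_, hp, ofHalf_toHalf p⟩
  rw [this]; exact hU.preimage continuous_toHalf

lemma exists_linearIndependent {U : Set Hyp} {p : Hyp} (hU : U ∈ nhds p) :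
    ∃ b : Fin 4 → Hyp, (∀ i, b i ∈ U) ∧ LinearIndependent ℝ fun i => (b i).val := by
  set c : ℝ → Fin 4 → Hyp := fun t i => frame p • ofHalf (![!₂[0, 0, 1], !₂[t, 0, 1], !₂[0, t, 1],
    !₂[0, 0, Real.exp t]] i) with hc
  have hcont : ∀ i, Continuous fun t => c t i := by
    intro i
    refine (isometry_smul Hyp (frame p)).continuous.comp
      (continuousOn_ofHalf.comp_continuous ?_ ?_)
    · fin_cases i <;> simp <;> refine (PiLp.continuous_toLp 2 _).comp (continuous_pi fun i => ?_) <;>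
        fin_cases i <;> simp <;> fun_prop
    · intro x
      fin_cases i <;> simp [Real.exp_pos]
  have h0 : ∀ i, c 0 i = p := by
    have : ofHalf !₂[0, 0, 1] = e := by
      apply val_injective; rw [val_ofHalf (by simp)]; simp [e]
    intro i
    fin_cases i <;> simp [hc, this]
  have hev : ∀ᶠ t in nhds (0 : ℝ), ∀ i, c t i ∈ U := by
    rw [Filter.eventually_all]
    intro i
    exact (hcont i).continuousAt (by rw [h0 i]; exact hU)
  obtain ⟨t, ht, ht0⟩ := ((hev.filter_mono nhdsWithin_le_nhds).and
    (self_mem_nhdsWithin (s := Ioi (0 : ℝ)) (a := 0))).exists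
  refine ⟨c t, ht, ?_⟩
  have ht0 : 0 < t := ht0
  have hinj : Function.Injective (Lor.lin (frame p)) :=
    Function.LeftInverse.injective (Lor.lin_inv_lin (frame p))
  have hE : 1 < Real.exp t := Real.one_lt_exp_iff.2 ht0
  suffices LinearIndependent ℝ fun i => (ofHalf (![!₂[0, 0, 1], !₂[t, 0, 1], !₂[0, t, 1],
    !₂[0, 0, Real.exp t]] i)).val from
    this.map' (Lor.lin (frame p)).toLinearMap (LinearMap.ker_eq_bot.2 hinj)
  rw [Fintype.linearIndependent_iff]
  intro g hg
  rw [Fin.sum_univ_four] at hg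
  simp only [Matrix.cons_val] at hg
  rw [val_ofHalf (by simp), val_ofHalf (by simp), val_ofHalf (by simp),
    val_ofHalf (by simp [Real.exp_pos])] at hg
  have e0 := congrFun hg 0
  have e1 := congrFun hg 1
  have e2 := congrFun hg 2
  have e3 := congrFun hg 3
  simp at e0 e1 e2 e3
  have g1 : g 1 = 0 := by rcases e1 with h | h; exact h; exact absurd h ht0.ne'
  have g2 : g 2 = 0 := by rcases e2 with h | h; exact h; exact absurd h ht0.ne'
  rw [g1, g2] at e0 e3
  have hEp := Real.exp_pos t
  have e3' : g 0 + g 3 * Real.exp t = 0 := by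
    have : Real.exp t ^ 2 / Real.exp t = Real.exp t := by field_simp
    simpa [this] using e3
  have e0' : g 0 * Real.exp t + g 3 = 0 := by
    have := congrArg (· * Real.exp t) e0
    simp only [zero_mul, add_zero, add_mul] at this
    rwa [mul_assoc, inv_mul_cancel₀ hEp.ne', mul_one] at this
  have g0 : g 0 = 0 := by
    have : g 0 * (Real.exp t ^ 2 - 1) = 0 := by linear_combination Real.exp t * e0' - e3'
    rcases mul_eq_zero.1 this with h | h
    · exact h
    · nlinarith
  have g3 : g 3 = 0 := by rw [g0] at e0'; linarith
  intro i
  fin_cases i <;> assumption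

end Hyp

namespace Lor

/-- A linear map preserving the form and sending some point of the hyperboloid into it. -/
def ofLinear (A : V →ₗ[ℝ] V) (hA : ∀ v w, bil (A v) (A w) = bil v w) (b : Hyp) (b' : Hyp)
    (hb : A b.val = b'.val) : Lor :=
  have hinj : Function.Injective A := by
    rw [← LinearMap.ker_eq_bot, LinearMap.ker_eq_bot']
    intro v hv
    refine bil_nondeg fun w => ?_
    rw [← hA, hv, bil_zero_left]
  ⟨ContinuousLinearEquiv.toUnit (LinearEquiv.ofInjectiveEndo A hinj).toContinuousLinearEquiv, by
    refine ⟨hA, fun p => ?_⟩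
    change 0 < A p.val 0
    refine bil_self_eq_one_pos b' (by rw [hA, p.eq]) ?_
    rw [← hb, hA]
    exact one_pos.trans_le (Hyp.one_le_bil p b)⟩

lemma lin_ofLinear (A : V →ₗ[ℝ] V) (hA b b' hb) (v : V) : lin (ofLinear A hA b b' hb) v = A v := rfl

lemma exists_of_isoOn {θ : Hyp → Hyp} {U : Set Hyp} {p : Hyp} (hU : U ∈ nhds p)
    (h : IsoOn θ U) : ∃ g : Lor, ∀ x ∈ U, θ x = g • x := by
  obtain ⟨b, hbU, hb⟩ := Hyp.exists_linearIndependent hU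
  set B := basisOfLinearIndependentOfCardEqFinrank hb (by simp) with hB
  have hBv : ∀ i, B i = (b i).val := fun i => by simp [hB]
  have hθ : ∀ x ∈ U, ∀ y ∈ U, bil (θ x).val (θ y).val = bil x.val y.val := fun x hx y hy => by
    rw [← Hyp.cosh_dist, ← Hyp.cosh_dist, h x hx y hy]
  set A : V →ₗ[ℝ] V := B.constr ℝ fun i => (θ (b i)).val with hAdef
  have hAb : ∀ i, A (b i).val = (θ (b i)).val := fun i => by
    rw [← hBv, hAdef, Module.Basis.constr_basis]
  have h1 : ∀ x ∈ U, ∀ w, bil (θ x).val (A w) = bil x.val w := by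
    intro x hx w
    have hw : w ∈ Submodule.span ℝ (range B) := by rw [B.span_eq]; trivial
    induction hw using Submodule.span_induction with
    | zero => simp [bil_zero_right]
    | mem w hw => obtain ⟨i, rfl⟩ := hw; rw [hBv, hAb, hθ x hx _ (hbU i)]
    | add v w _ _ hv hw => rw [map_add, bil_add_right, bil_add_right, hv, hw]
    | smul c v _ hv => rw [map_smul, bil_smul_right, bil_smul_right, hv]
  have hA : ∀ v w, bil (A v) (A w) = bil v w := by
    intro v w
    have hv : v ∈ Submodule.span ℝ (range B) := by rw [B.span_eq]; trivial
    induction hv using Submodule.span_induction with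
    | zero => simp [bil_zero_left]
    | mem v hv => obtain ⟨i, rfl⟩ := hv; rw [hBv, hAb, h1 _ (hbU i)]
    | add v w _ _ hv hw => rw [map_add, bil_add_left, bil_add_left, hv, hw]
    | smul c v _ hv => rw [map_smul, bil_smul_left, bil_smul_left, hv]
  refine ⟨ofLinear A hA (b 0) (θ (b 0)) (hAb 0), fun x hx => ?_⟩
  apply Hyp.val_injective
  rw [val_smul, lin_ofLinear, ← sub_eq_zero]
  set g := ofLinear A hA (b 0) (θ (b 0)) (hAb 0) with hg
  refine bil_nondeg fun w => ?_
  have : w = A (lin g⁻¹ w) := (lin_lin_inv g w).symm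
  rw [this, bil_sub_left, h1 x hx, hA, sub_self]

lemma eq_one_of_fix {g : Lor} {U : Set Hyp} {p : Hyp} (hU : U ∈ nhds p)
    (h : ∀ x ∈ U, g • x = x) : g = 1 := by
  obtain ⟨b, hbU, hb⟩ := Hyp.exists_linearIndependent hU
  set B := basisOfLinearIndependentOfCardEqFinrank hb (by simp) with hB
  have hBv : ∀ i, B i = (b i).val := fun i => by simp [hB]
  apply lin_injective
  apply ContinuousLinearMap.coe_injective
  refine B.ext fun i => ?_
  rw [hBv]
  change lin g (b i).val = (b i).val
  rw [← val_smul, h _ (hbU i)]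

lemma exists_smul_eq (a b : Hyp) : ∃ g : Lor, g • a = b :=
  ⟨Hyp.frame b * (Hyp.frame a)⁻¹, by rw [mul_smul, Hyp.frame_inv_smul, Hyp.frame_smul_e]⟩

end Lor
end HypArc

namespace HypArc

variable {X : Type*} [MetricSpace X]

/-- Around each point, balls of some radius are isometric to balls of hyperbolic space. -/
def HypLike (X : Type*) [MetricSpace X] : Prop :=
  ∀ x : X, ∃ r > 0, ∀ y : Hyp, ∃ χ : Hyp → X,
    χ y = x ∧ IsoOn χ (ball y r) ∧ χ '' ball y r = ball x r

/-- `ψ` is isometric near each point of `U`. -/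
def LocIso (ψ : Hyp → X) (U : Set Hyp) : Prop := ∀ a ∈ U, ∃ ε > 0, IsoOn ψ (ball a ε)

lemma LocIso.mono {ψ : Hyp → X} {U W : Set Hyp} (h : LocIso ψ W) (hUW : U ⊆ W) : LocIso ψ U :=
  fun a ha => h a (hUW ha)

lemma IsoOn.locIso {ψ : Hyp → X} {U : Set Hyp} (hU : IsOpen U) (h : IsoOn ψ U) : LocIso ψ U :=
  fun a ha => by
    obtain ⟨ε, hε, hs⟩ := Metric.isOpen_iff.1 hU a ha
    exact ⟨ε, hε, h.mono hs⟩

lemma LocIso.continuousOn {ψ : Hyp → X} {U : Set Hyp} (h : LocIso ψ U) : ContinuousOn ψ U := by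
  intro a ha
  obtain ⟨ε, hε, hi⟩ := h a ha
  exact (hi.continuousOn.continuousAt (ball_mem_nhds a hε)).continuousWithinAt

lemma locIso_of_eventuallyEq {ψ ψ' : Hyp → X} {a : Hyp} {ε : ℝ} (hε : 0 < ε)
    (h : IsoOn ψ (ball a ε)) (hψ : ψ =ᶠ[nhds a] ψ') : ∃ ε > 0, IsoOn ψ' (ball a ε) := by
  obtain ⟨δ, hδ, hs⟩ := Metric.eventually_nhds_iff_ball.1 hψ
  refine ⟨min ε δ, lt_min hε hδ, (h.mono (ball_subset_ball (min_le_left _ _))).congr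
    fun z hz => hs z (ball_subset_ball (min_le_right _ _) hz)⟩

lemma transition_of_subset {ψ ψ' : Hyp → X} {a a' : Hyp} {ε ε' : ℝ} (hε : 0 < ε) (hε' : 0 < ε')
    (h : IsoOn ψ (ball a ε)) (h' : IsoOn ψ' (ball a' ε'))
    (hs : ball (ψ' a') ε' ⊆ ψ' '' ball a' ε') (haa : ψ a = ψ' a') :
    ∃ g : Lor, g • a = a' ∧ ∀ z ∈ ball a (min ε ε'), ψ z = ψ' (g • z) := by
  have ha : a ∈ ball a (min ε ε') := mem_ball_self (lt_min hε hε')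
  have : ∀ z ∈ ball a (min ε ε'), ∃ w ∈ ball a' ε', ψ' w = ψ z := by
    intro z hz
    apply hs
    rw [← haa, mem_ball, h z (ball_subset_ball (min_le_left _ _) hz) a (mem_ball_self hε)]
    exact ball_subset_ball (min_le_right _ _) hz
  choose! θ hθ hθψ using this
  have hi : IsoOn θ (ball a (min ε ε')) := by
    intro x hx y hy
    rw [← h' _ (hθ x hx) _ (hθ y hy), hθψ x hx, hθψ y hy]
    exact h x (ball_subset_ball (min_le_left _ _) hx) y (ball_subset_ball (min_le_left _ _) hy)
  obtain ⟨g, hg⟩ := Lor.exists_of_isoOn (ball_mem_nhds a (lt_min hε hε')) hi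
  refine ⟨g, ?_, fun z hz => by rw [← hg z hz, hθψ z hz]⟩
  rw [← hg a ha]
  exact h'.injOn (hθ a ha) (mem_ball_self hε') (by rw [hθψ a ha, haa])

/-- A local isometry maps small balls onto balls. -/
lemma HypLike.ball_subset_image (hX : HypLike X) {ψ : Hyp → X} {a : Hyp} {ε : ℝ} (hε : 0 < ε)
    (h : IsoOn ψ (ball a ε)) : ∃ δ > 0, δ ≤ ε ∧ ball (ψ a) δ ⊆ ψ '' ball a δ := by
  obtain ⟨r, hr, hχ⟩ := hX (ψ a)
  obtain ⟨χ, hχa, hχi, hχs⟩ := hχ a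
  obtain ⟨g, hga, hg⟩ := transition_of_subset hε hr h hχi (by rw [hχs, hχa]) hχa.symm
  refine ⟨min ε r, lt_min hε hr, min_le_left _ _, fun x hx => ?_⟩
  obtain ⟨w, hw, rfl⟩ := hχs.ge (ball_subset_ball (min_le_right _ _) hx)
  have hwd : w ∈ ball a (min ε r) := by
    rw [mem_ball, ← hχi w hw a (mem_ball_self hr), hχa]; exact hx
  have : g⁻¹ • w ∈ ball a (min ε r) := by
    rw [mem_ball, ← dist_smul g, smul_inv_smul, hga]; exact hwd
  exact ⟨g⁻¹ • w, this, by rw [hg _ this, smul_inv_smul]⟩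

lemma HypLike.transition (hX : HypLike X) {ψ ψ' : Hyp → X} {a a' : Hyp} {ε ε' : ℝ} (hε : 0 < ε)
    (hε' : 0 < ε') (h : IsoOn ψ (ball a ε)) (h' : IsoOn ψ' (ball a' ε')) (haa : ψ a = ψ' a') :
    ∃ g : Lor, g • a = a' ∧ ψ =ᶠ[nhds a] fun z => ψ' (g • z) := by
  obtain ⟨δ, hδ, hδε, hs⟩ := hX.ball_subset_image hε' h'
  obtain ⟨g, hga, hg⟩ := transition_of_subset hε hδ h (h'.mono (ball_subset_ball hδε)) hs haa
  exact ⟨g, hga, Filter.eventually_of_mem (ball_mem_nhds a (lt_min hε hδ)) hg⟩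

/-- Local isometries on a connected open set are determined by their germ at a point. -/
lemma HypLike.eqOn (hX : HypLike X) {ψ ψ' : Hyp → X} {U : Set Hyp} (hUo : IsOpen U)
    (hU : IsPreconnected U) (h : LocIso ψ U) (h' : LocIso ψ' U) {a : Hyp} (ha : a ∈ U)
    (haa : ψ =ᶠ[nhds a] ψ') : EqOn ψ ψ' U := by
  have hW : IsOpen {z | ψ =ᶠ[nhds z] ψ'} := isOpen_setOfPred_eventually_nhds
  suffices U ⊆ {z | ψ =ᶠ[nhds z] ψ'} from fun z hz => (this hz).eq_of_nhds
  refine hU.subset_of_closure_inter_subset hW ⟨a, ha, haa⟩ ?_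
  rintro z ⟨hzc, hzU⟩
  obtain ⟨ε, hε, hi⟩ := h z hzU
  obtain ⟨ε', hε', hi'⟩ := h' z hzU
  have hz : ψ z = ψ' z := by
    have h1 : ContinuousAt ψ z := h.continuousOn.continuousAt (hUo.mem_nhds hzU)
    have h2 : ContinuousAt ψ' z := h'.continuousOn.continuousAt (hUo.mem_nhds hzU)
    have : (nhdsWithin z {z : Hyp | ψ =ᶠ[nhds z] ψ'}).NeBot :=
      mem_closure_iff_nhdsWithin_neBot.1 hzc
    refine tendsto_nhds_unique (l := nhdsWithin z {z : Hyp | ψ =ᶠ[nhds z] ψ'})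
      (h1.tendsto.mono_left nhdsWithin_le_nhds) ?_
    refine (h2.tendsto.mono_left nhdsWithin_le_nhds).congr' ?_
    filter_upwards [self_mem_nhdsWithin] with w hw
    exact (Filter.EventuallyEq.eq_of_nhds hw).symm
  obtain ⟨g, hgz, hg⟩ := hX.transition hε hε' hi hi' hz
  have hgc : Continuous fun w : Hyp => g • w := (isometry_smul Hyp g).continuous
  have hev : ∀ᶠ w in nhds z, ψ w = ψ' (g • w) ∧ w ∈ ball z ε' ∧ g • w ∈ ball z ε' := by
    have hb : ∀ᶠ w in nhds z, w ∈ ball z ε' := ball_mem_nhds z hε'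
    refine hg.and (hb.and ?_)
    exact hgc.continuousAt.eventually_mem (by rw [hgz]; exact ball_mem_nhds z hε')
  obtain ⟨w, hw, hwW⟩ := (mem_closure_iff_frequently.1 hzc).and_eventually
    (eventually_eventually_nhds.2 hev) |>.exists
  have hw : ψ =ᶠ[nhds w] ψ' := hw
  have h1 : g = 1 := by
    refine Lor.eq_one_of_fix (hw.and hwW) ?_
    rintro v ⟨hv1, hv2, hv3, hv4⟩
    exact hi'.injOn hv4 hv3 (by rw [← hv2, hv1])
  simpa [h1] using hg

/-- Local isometries are distance nonincreasing on convex sets. -/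
lemma LocIso.dist_le {ψ : Hyp → X} {U : Set Hyp} (hU : Hyp.Convex U)
    (h : LocIso ψ U) {a b : Hyp} (ha : a ∈ U) (hb : b ∈ U) : dist (ψ a) (ψ b) ≤ dist a b := by
  obtain ⟨σ, hσ, h0, h1, hσU⟩ := hU a ha b hb
  have hc : ContinuousOn (fun t => ψ (σ t)) (Icc 0 (dist a b)) :=
    h.continuousOn.comp hσ.continuous.continuousOn hσU
  have key : Icc 0 (dist a b) ⊆ {t | dist (ψ a) (ψ (σ t)) ≤ t} := by
    refine IsClosed.Icc_subset_of_forall_exists_gt ?_ (by simp [h0]) ?_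
    · have h2 := ((continuous_dist.comp_continuousOn (continuousOn_const.prodMk hc)).sub continuousOn_id).preimage_isClosed_of_isClosed
        isClosed_Icc (isClosed_Iic (a := (0 : ℝ))) (f := fun t => dist (ψ a) (ψ (σ t)) - t)
      convert h2 using 1
      ext t; simp [and_comm]
    · rintro t ⟨ht, htI⟩ s hs
      obtain ⟨ε, hε, hi⟩ := h (σ t) (hσU t ⟨htI.1, htI.2.le⟩)
      have ht : dist (ψ a) (ψ (σ t)) ≤ t := ht
      set u := min s (t + ε / 2) with hu
      have hut : t < u := lt_min hs (by linarith)
      have hd : dist (σ t) (σ u) = u - t := by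
        rw [hσ.dist_eq, dist_comm, Real.dist_eq, abs_of_pos (by linarith)]
      refine ⟨u, ?_, hut, min_le_left _ _⟩
      have hue : u ≤ t + ε / 2 := min_le_right _ _
      have := hi (σ t) (mem_ball_self hε) (σ u) (by rw [mem_ball, dist_comm, hd]; linarith)
      calc dist (ψ a) (ψ (σ u)) ≤ _ := dist_triangle _ (ψ (σ t)) _
        _ ≤ u := by rw [this, hd]; linarith
  have := key (right_mem_Icc.2 dist_nonneg)
  rwa [mem_ofPred_eq, h1] at this

lemma exists_near {o w : Hyp} {R ρ : ℝ} (hR : 0 < R) (hρ : 0 < ρ) (hw : dist w o < R + ρ) :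
    ∃ z ∈ ball o R, dist w z < ρ := by
  by_cases hwR : dist w o < R
  · exact ⟨w, hwR, by simpa⟩
  push Not at hwR
  obtain ⟨σ, hσ, h0, h1, -⟩ := Hyp.exists_geodesic o w
  rw [dist_comm] at hw hwR
  set d := dist o w
  set t := max 0 ((d - ρ + R) / 2) with ht
  have ht0 : 0 ≤ t := le_max_left _ _
  have htd : t ≤ d := max_le (by linarith) (by linarith)
  have ht1 : (d - ρ + R) / 2 ≤ t := le_max_right _ _
  refine ⟨σ t, ?_, ?_⟩
  · rw [mem_ball]
    nth_rw 1 [← h0]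
    rw [hσ.dist_eq, Real.dist_eq, sub_zero, abs_of_nonneg ht0]
    exact max_lt hR (by linarith)
  · nth_rw 1 [← h1]
    rw [hσ.dist_eq, Real.dist_eq, abs_of_nonneg (by linarith)]
    linarith

lemma HypLike.extend_at [CompleteSpace X] (hX : HypLike X) {ψ : Hyp → X} {o : Hyp} {R : ℝ}
    (hR : 0 < R) (h : LocIso ψ (ball o R)) {y : Hyp} (hy : y ∈ closedBall o R) :
    ∃ r > 0, ∃ χ : Hyp → X, IsoOn χ (ball y r) ∧ EqOn χ ψ (ball o R ∩ ball y r) := by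
  have hnear : ∀ n : ℕ, ∃ z ∈ ball o R, dist y z < 1 / ((n : ℝ) + 1) := fun n =>
    exists_near hR Nat.one_div_pos_of_nat (lt_of_le_of_lt hy (by
      have : 0 < 1 / ((n : ℝ) + 1) := Nat.one_div_pos_of_nat
      linarith))
  choose z hz hzy using hnear
  have hlip : ∀ a ∈ ball o R, ∀ b ∈ ball o R, dist (ψ a) (ψ b) ≤ dist a b := fun a ha b hb =>
    h.dist_le (Hyp.convex_ball o R) ha hb
  have hzlim : Filter.Tendsto z Filter.atTop (nhds y) := by
    rw [tendsto_iff_dist_tendsto_zero]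
    exact squeeze_zero (fun _ => dist_nonneg) (fun n => (dist_comm _ _).trans_le (hzy n).le)
      tendsto_one_div_add_atTop_nhds_zero_nat
  have hcau : CauchySeq fun n => ψ (z n) := by
    rw [Metric.cauchySeq_iff]
    intro ε hε
    obtain ⟨N, hN⟩ := Metric.cauchySeq_iff.1 hzlim.cauchySeq ε hε
    exact ⟨N, fun m hm n hn => (hlip _ (hz m) _ (hz n)).trans_lt (hN m hm n hn)⟩
  obtain ⟨x, hx⟩ := cauchySeq_tendsto_of_complete hcau
  have hxd : ∀ a ∈ ball o R, dist (ψ a) x ≤ dist a y := fun a ha =>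
    le_of_tendsto_of_tendsto' (tendsto_const_nhds.dist hx) (tendsto_const_nhds.dist hzlim)
      fun n => hlip a ha _ (hz n)
  obtain ⟨r, hr, hχ⟩ := hX x
  obtain ⟨χ, hχy, hχi, hχs⟩ := hχ y
  obtain ⟨z0, hz0, hzy0⟩ := exists_near (w := y) (ρ := r / 4) hR (by linarith)
    (lt_of_le_of_lt hy (by linarith))
  have hz0x : dist (ψ z0) x < r / 4 := (hxd z0 hz0).trans_lt (by rwa [dist_comm])
  obtain ⟨w0, hw0, hw0x⟩ := hχs.ge (show ψ z0 ∈ ball x r by rw [mem_ball]; linarith)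
  have hw0y : dist w0 y < r / 4 := by
    rw [← hχi w0 hw0 y (mem_ball_self hr), hχy, hw0x]; exact hz0x
  obtain ⟨ε, hε, hi⟩ := h z0 hz0
  obtain ⟨ε', hε', hi'⟩ := hχi.locIso isOpen_ball w0 hw0
  obtain ⟨g, hg0, hg⟩ := hX.transition hε hε' hi hi' hw0x.symm
  have hgy : dist (g • y) y < r / 2 := by
    calc dist (g • y) y ≤ dist (g • y) (g • z0) + dist (g • z0) y := dist_triangle _ _ _
      _ < r / 2 := by rw [dist_smul, hg0]; linarith
  have hsub : ∀ v ∈ ball y (r / 2), g • v ∈ ball y r := by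
    intro v hv
    rw [mem_ball] at hv ⊢
    calc dist (g • v) y ≤ dist (g • v) (g • y) + dist (g • y) y := dist_triangle _ _ _
      _ < r := by rw [dist_smul]; linarith
  have hχ' : IsoOn (fun v => χ (g • v)) (ball y (r / 2)) := fun a ha b hb => by
    rw [hχi _ (hsub a ha) _ (hsub b hb), dist_smul]
  refine ⟨r / 2, by linarith, fun v => χ (g • v), hχ', ?_⟩
  refine hX.eqOn (isOpen_ball.inter isOpen_ball)
    (Hyp.convex_ball_inter _ _ _ _).isPreconnected
    ((hχ'.locIso isOpen_ball).mono inter_subset_right) (h.mono inter_subset_left)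
    (a := z0) ⟨hz0, by rw [mem_ball, dist_comm]; linarith⟩ hg.symm

lemma HypLike.extend [CompleteSpace X] (hX : HypLike X) {ψ : Hyp → X} {o : Hyp} {R : ℝ}
    (hR : 0 < R) (h : LocIso ψ (ball o R)) :
    ∃ δ > 0, ∃ ψ' : Hyp → X, LocIso ψ' (ball o (R + δ)) ∧ EqOn ψ' ψ (ball o R) := by
  have hex : ∀ y : closedBall o R, ∃ r > 0, ∃ χ : Hyp → X,
    IsoOn χ (ball y.1 r) ∧ EqOn χ ψ (ball o R ∩ ball y.1 r) := fun y => hX.extend_at hR h y.2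
  choose r hr χ hχi hχe using hex
  obtain ⟨ρ, hρ, hL⟩ := lebesgue_number_lemma_of_metric (isCompact_closedBall o R)
    (c := fun y : closedBall o R => ball y.1 (r y)) (fun _ => isOpen_ball)
    fun y hy => mem_iUnion.2 ⟨⟨y, hy⟩, mem_ball_self (hr _)⟩
  have hL' : ∀ z ∈ ball o R, ∃ χ : Hyp → X, IsoOn χ (ball z ρ) ∧
      EqOn χ ψ (ball o R ∩ ball z ρ) := fun z hz => by
    obtain ⟨y, hy⟩ := hL z (ball_subset_closedBall hz)
    exact ⟨χ y, (hχi y).mono hy, (hχe y).mono (inter_subset_inter_right _ hy)⟩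
  have : Nonempty (Hyp → X) := ⟨ψ⟩
  choose! χ hχi hχe using hL'
  have hπ : ∀ w ∈ ball o (R + ρ / 4), ∃ z ∈ ball o R, dist w z < ρ / 4 := fun w hw =>
    exists_near hR (by linarith) hw
  choose! π hπR hπd using hπ
  refine ⟨ρ / 4, by linarith, fun w => χ (π w) w, ?_, ?_⟩
  · intro w hw
    have hwρ : w ∈ ball (π w) ρ := by rw [mem_ball]; linarith [hπd w hw]
    obtain ⟨ε, hε, hi⟩ := (hχi _ (hπR w hw)).locIso isOpen_ball w hwρ
    refine locIso_of_eventuallyEq hε hi ?_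
    filter_upwards [isOpen_ball.mem_nhds hw, ball_mem_nhds w (show 0 < ρ / 4 by linarith)]
      with v hv hvw
    have h1 := hπd w hw
    have h2 := hπd v hv
    have h3 : dist v w < ρ / 4 := hvw
    have hpv : π v ∈ ball (π w) ρ := by
      rw [mem_ball]
      calc dist (π v) (π w) ≤ dist (π v) v + dist v w + dist w (π w) := dist_triangle4 _ _ _ _
        _ < ρ := by rw [dist_comm (π v)]; linarith
    refine hX.eqOn (U := ball (π w) ρ ∩ ball (π v) ρ) (isOpen_ball.inter isOpen_ball)
      (Hyp.convex_ball_inter _ _ _ _).isPreconnected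
      (((hχi _ (hπR w hw)).locIso isOpen_ball).mono inter_subset_left)
      (((hχi _ (hπR v hv)).locIso isOpen_ball).mono inter_subset_right)
      (a := π v) ⟨hpv, mem_ball_self hρ⟩ ?_ ⟨?_, ?_⟩
    · filter_upwards [isOpen_ball.mem_nhds (hπR v hv), isOpen_ball.mem_nhds hpv,
        ball_mem_nhds (π v) hρ] with u hu1 hu2 hu3
      rw [hχe _ (hπR w hw) ⟨hu1, hu2⟩, hχe _ (hπR v hv) ⟨hu1, hu3⟩]
    · rw [mem_ball]
      linarith [dist_triangle v w (π w)]
    · rw [mem_ball]; linarith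
  · intro w hw
    have hw' : w ∈ ball o (R + ρ / 4) := ball_subset_ball (by linarith) hw
    exact hχe _ (hπR w hw') ⟨hw, by rw [mem_ball]; linarith [hπd w hw']⟩

/-- Developing map: a local isometry from hyperbolic space with prescribed value. -/
lemma HypLike.exists_develop [CompleteSpace X] (hX : HypLike X) (o : Hyp) (x : X) :
    ∃ ψ : Hyp → X, LocIso ψ univ ∧ ψ o = x := by
  obtain ⟨r, hr, hχ⟩ := hX x
  obtain ⟨χ, hχo, hχi, -⟩ := hχ o
  let P : ℝ → (Hyp → X) → Prop := fun R ψ => LocIso ψ (ball o R) ∧ ψ =ᶠ[nhds o] χ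
  have huniq : ∀ R R' ψ ψ' w, P R ψ → P R' ψ' → dist w o < R → dist w o < R' → ψ w = ψ' w := by
    intro R R' ψ ψ' w h h' hw hw'
    have hpos : 0 < min R R' := dist_nonneg.trans_lt (lt_min hw hw')
    refine hX.eqOn isOpen_ball (Hyp.convex_ball o (min R R')).isPreconnected
      (h.1.mono (ball_subset_ball (min_le_left _ _)))
      (h'.1.mono (ball_subset_ball (min_le_right _ _))) (mem_ball_self hpos)
      (h.2.trans h'.2.symm) (lt_min hw hw')
  set A : Set Hyp := {z | ∃ R ψ, dist z o < R ∧ P R ψ} with hA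
  have hex : ∀ z ∈ A, ∃ R ψ, dist z o < R ∧ P R ψ := fun z hz => hz
  have : Nonempty (Hyp → X) := ⟨χ⟩
  choose! R ψ hzR hP using hex
  have hnear : ∀ z ∈ A, ∀ᶠ w in nhds z, ψ z w = ψ w w := by
    intro z hz
    filter_upwards [(isOpen_ball (x := o) (ε := R z)).mem_nhds (hzR z hz)] with w hw
    have hwA : w ∈ A := ⟨R z, ψ z, hw, hP z hz⟩
    exact huniq _ _ _ _ w (hP z hz) (hP w hwA) hw (hzR w hwA)
  have hloc : LocIso (fun w => ψ w w) A := by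
    intro z hz
    obtain ⟨ε, hε, hi⟩ := (hP z hz).1 z (hzR z hz)
    exact locIso_of_eventuallyEq hε hi (hnear z hz)
  have hPr : P r χ := ⟨hχi.locIso isOpen_ball, Filter.EventuallyEq.rfl⟩
  have hoA : o ∈ A := ⟨r, χ, by simpa, hPr⟩
  have hgerm : (fun w => ψ w w) =ᶠ[nhds o] χ := by
    filter_upwards [hnear o hoA, (hP o hoA).2] with w h1 h2
    rw [← h1, h2]
  suffices A = univ from ⟨_, this ▸ hloc, by rw [hgerm.eq_of_nhds, hχo]⟩
  by_contra hne
  obtain ⟨z1, hz1⟩ := (ne_univ_iff_exists_notMem _).1 hne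
  set S : Set ℝ := {R | ∃ ψ, P R ψ} with hS
  have hbdd : BddAbove S := ⟨dist z1 o, fun R ⟨ψ, h⟩ => by
    by_contra! hlt; exact hz1 ⟨R, ψ, hlt, h⟩⟩
  have hrS : r ∈ S := ⟨χ, hPr⟩
  have hT : 0 < sSup S := hr.trans_le (le_csSup hbdd hrS)
  have hTA : ball o (sSup S) ⊆ A := fun z hz => by
    obtain ⟨R, ⟨ψ, h⟩, hlt⟩ := exists_lt_of_lt_csSup ⟨r, hrS⟩ hz
    exact ⟨R, ψ, hlt, h⟩
  obtain ⟨δ, hδ, ψ', h1, h2⟩ := hX.extend hT (hloc.mono hTA)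
  have : sSup S + δ ∈ S := ⟨ψ', h1, (h2.eventuallyEq_of_mem (ball_mem_nhds o hT)).trans hgerm⟩
  linarith [le_csSup hbdd this]

end HypArc

namespace HypArc

variable {X : Type*} [MetricSpace X]

lemma LocIso.comp_smul {ψ : Hyp → X} {U W : Set Hyp} (h : LocIso ψ U) (g : Lor)
    (hg : ∀ z ∈ W, g • z ∈ U) : LocIso (fun z => ψ (g • z)) W := by
  intro a ha
  obtain ⟨ε, hε, hi⟩ := h _ (hg a ha)
  refine ⟨ε, hε, fun x hx y hy => ?_⟩
  rw [hi _ (by rwa [mem_ball, dist_smul]) _ (by rwa [mem_ball, dist_smul]), dist_smul]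

lemma LocIso.exists_isoOn {ψ : Hyp → X} (h : LocIso ψ univ) (a : Hyp) :
    ∃ ε > 0, IsoOn ψ (ball a ε) := h a (mem_univ a)

lemma LocIso.continuous {ψ : Hyp → X} (h : LocIso ψ univ) : Continuous ψ :=
  continuousOn_univ.1 h.continuousOn

lemma HypLike.isOpenMap (hX : HypLike X) {ψ : Hyp → X} (h : LocIso ψ univ) : IsOpenMap ψ := by
  intro U hU
  rw [Metric.isOpen_iff]
  rintro _ ⟨a, ha, rfl⟩
  obtain ⟨ε, hε, hi⟩ := h.exists_isoOn a
  obtain ⟨δ, hδ, hs⟩ := Metric.isOpen_iff.1 hU a ha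
  obtain ⟨ρ, hρ, hle, hb⟩ := hX.ball_subset_image (lt_min hε hδ)
    (hi.mono (ball_subset_ball (min_le_left _ _)))
  exact ⟨ρ, hρ, hb.trans (image_mono ((ball_subset_ball (hle.trans (min_le_right _ _))).trans hs))⟩

/-- The ball of radius `r` around `x` is isometric to a hyperbolic ball. -/
def GoodRadius (x : X) (r : ℝ) : Prop := 0 < r ∧ ∀ y : Hyp, ∃ χ : Hyp → X,
    χ y = x ∧ IsoOn χ (ball y r) ∧ χ '' ball y r = ball x r

lemma HypLike.isoOn_of_goodRadius (hX : HypLike X) {ψ : Hyp → X} (h : LocIso ψ univ) {y : Hyp}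
    {r : ℝ} (hr : GoodRadius (ψ y) r) : IsoOn ψ (ball y r) ∧ ball (ψ y) r ⊆ ψ '' ball y r := by
  obtain ⟨χ, hχ, hi, hs⟩ := hr.2 y
  obtain ⟨ε, hε, hiψ⟩ := h.exists_isoOn y
  obtain ⟨g, hgy, hg⟩ := hX.transition hε hr.1 hiψ hi hχ.symm
  have hgb : ∀ z ∈ ball y r, g • z ∈ ball y r := fun z hz => by
    rw [mem_ball, show dist (g • z) y = dist (g • z) (g • y) by rw [hgy], dist_smul]; exact hz
  have heq := hX.eqOn isOpen_ball (Hyp.convex_ball y r).isPreconnected (h.mono (subset_univ _))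
    ((hi.locIso isOpen_ball).comp_smul g hgb) (mem_ball_self hr.1) hg
  refine ⟨fun a ha b hb => ?_, fun w hw => ?_⟩
  · rw [heq ha, heq hb, hi _ (hgb a ha) _ (hgb b hb), dist_smul]
  · obtain ⟨v, hv, rfl⟩ := hs.ge hw
    have : g⁻¹ • v ∈ ball y r := by
      rw [mem_ball, ← dist_smul g, smul_inv_smul, hgy]; exact hv
    exact ⟨g⁻¹ • v, this, (heq this).trans (by simp only [smul_inv_smul])⟩

lemma HypLike.exists_fiber_near (hX : HypLike X) {ψ : Hyp → X} (h : LocIso ψ univ) {x : X}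
    {r : ℝ} (hr : GoodRadius x r) {z : Hyp} (hz : dist (ψ z) x < r) :
    ∃ y, ψ y = x ∧ dist z y = dist (ψ z) x := by
  obtain ⟨χ, hχ, hi, hs⟩ := hr.2 Hyp.e
  obtain ⟨w, hw, hwz⟩ := hs.ge hz
  obtain ⟨ε, hε, hiψ⟩ := h.exists_isoOn z
  obtain ⟨ε', hε', hi'⟩ := hi.locIso isOpen_ball w hw
  obtain ⟨g, hgw, hg⟩ := hX.transition hε' hε hi' hiψ hwz
  have heq := hX.eqOn isOpen_ball (Hyp.convex_ball Hyp.e r).isPreconnected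
    (hi.locIso isOpen_ball) (h.comp_smul g fun _ _ => mem_univ _) hw hg
  have he := mem_ball_self (x := Hyp.e) hr.1
  refine ⟨g • Hyp.e, by rw [← hχ, heq he], ?_⟩
  rw [← hgw, dist_smul, ← hi w hw _ he, hχ, hgw, hwz]

lemma HypLike.isCoveringMap (hX : HypLike X) {ψ : Hyp → X} (h : LocIso ψ univ) :
    IsCoveringMap ψ := by
  intro x
  obtain ⟨r, hr⟩ : ∃ r, GoodRadius x r := hX x
  have hr0 := hr.1
  have hiso : ∀ y, ψ y = x → IsoOn ψ (ball y r) := by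
    rintro y rfl; exact (hX.isoOn_of_goodRadius h hr).1
  rcases isEmpty_or_nonempty (ψ ⁻¹' {x}) with hemp | hne
  · refine IsEvenlyCovered.of_preimage_eq_empty _ (ball_mem_nhds x hr.1) ?_
    rw [eq_empty_iff_forall_notMem]
    intro z hz
    obtain ⟨y, hy, -⟩ := hX.exists_fiber_near h hr hz
    exact hemp.false ⟨y, hy⟩
  · have hdisc : DiscreteTopology (ψ ⁻¹' {x}) := by
      rw [discreteTopology_subtype_iff']
      refine fun y hy => ⟨ball y r, isOpen_ball, ?_⟩
      ext z; constructor
      · rintro ⟨h1, h2⟩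
        exact hiso y hy |>.injOn h1 (mem_ball_self hr0) (Eq.trans h2 (Eq.symm hy))
      · rintro rfl; exact ⟨mem_ball_self hr0, hy⟩
    have : Nonempty (X → Hyp) := ⟨fun _ => Hyp.e⟩
    have hsub : ∀ y : Hyp, ball y (r / 2) ⊆ ball y r := fun y => ball_subset_ball (by linarith)
    refine IsEvenlyCovered.of_trivialization (t := IsOpen.trivializationDiscrete
      (fun y : ψ ⁻¹' {x} => ball y.1 (r / 2)) (ball x (r / 2)) isOpen_ball ?_ ?_ ?_ ?_ ?_)
      (mem_ball_self (by linarith))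
    · intro y W hW
      refine ⟨fun hWo => (hWo.preimage h.continuous).inter isOpen_ball, fun hWo => ?_⟩
      convert hX.isOpenMap h _ hWo
      ext w; constructor
      · intro hw
        have hwb : dist w x < r / 2 := hW hw
        obtain ⟨y, rfl⟩ := y
        obtain ⟨v, hv, rfl⟩ := (hX.isoOn_of_goodRadius h hr).2 (show w ∈ ball (ψ y) r by
          rw [mem_ball]; linarith)
        refine ⟨v, ⟨hw, ?_⟩, rfl⟩
        rw [mem_ball, ← hiso y rfl v hv y (mem_ball_self hr0)]; exact hwb
      · rintro ⟨v, hv, rfl⟩; exact hv.1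
    · exact fun y => (hiso y.1 y.2).injOn.mono (hsub _)
    · rintro ⟨y, rfl⟩ w hw
      obtain ⟨v, hv, rfl⟩ := (hX.isoOn_of_goodRadius h hr).2 (ball_subset_ball (by linarith) hw)
      refine ⟨v, ?_, rfl⟩
      rw [mem_ball, ← hiso y rfl v hv y (mem_ball_self hr0)]; exact hw
    · intro y y' hyy
      rw [Function.onFun, Set.disjoint_left]
      intro z hz hz'
      refine hyy (Subtype.ext ?_)
      rw [mem_ball] at hz hz'
      refine (hiso y.1 y.2).injOn (mem_ball_self hr0) ?_ (Eq.trans y.2 (Eq.symm y'.2))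
      rw [mem_ball, dist_comm]
      linarith [dist_triangle_left y.1 y'.1 z]
    · intro z hz
      have hz : dist (ψ z) x < r / 2 := hz
      obtain ⟨y, hy, hd⟩ := hX.exists_fiber_near h hr (show dist (ψ z) x < r by linarith)
      exact mem_iUnion.2 ⟨⟨y, hy⟩, by rw [mem_ball, hd]; exact hz⟩

/-- The group of deck transformations of `ψ`. -/
def deck (ψ : Hyp → X) : Subgroup Lor where
  carrier := {g | ∀ z, ψ (g • z) = ψ z}
  one_mem' z := by rw [one_smul]
  mul_mem' {g h} hg hh z := by rw [mul_smul, hg, hh]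
  inv_mem' {g} hg z := by rw [← hg, smul_inv_smul]

lemma HypLike.exists_deck (hX : HypLike X) {ψ : Hyp → X} (h : LocIso ψ univ) {a b : Hyp}
    (hab : ψ a = ψ b) : ∃ g ∈ deck ψ, g • a = b := by
  obtain ⟨ε, hε, hi⟩ := h.exists_isoOn a
  obtain ⟨ε', hε', hi'⟩ := h.exists_isoOn b
  obtain ⟨g, hga, hg⟩ := hX.transition hε hε' hi hi' hab
  refine ⟨g, fun z => ?_, hga⟩
  exact (hX.eqOn isOpen_univ Hyp.convex_univ.isPreconnected h
    (h.comp_smul g fun _ _ => mem_univ _) (mem_univ a) hg (mem_univ z)).symm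

lemma LocIso.deck_displacement {ψ : Hyp → X} (h : LocIso ψ univ) (y : Hyp) :
    ∃ ε > 0, ∀ g ∈ deck ψ, g ≠ 1 → ε ≤ dist y (g • y) := by
  obtain ⟨ε, hε, hi⟩ := h.exists_isoOn y
  refine ⟨ε, hε, fun g hg hg1 => ?_⟩
  by_contra! hlt
  have h1 : g • y = y := hi.injOn (by rwa [mem_ball, dist_comm]) (mem_ball_self hε) (hg y)
  refine hg1 (Lor.eq_one_of_fix (ball_mem_nhds y hε) fun z hz => ?_)
  refine hi.injOn ?_ hz (hg z)
  rw [mem_ball, show dist (g • z) y = dist (g • z) (g • y) by rw [h1], dist_smul]; exact hz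

/-- A locally hyperbolic open subset of a 3-manifold is modelled on hyperbolic balls. -/
lemma hypLike_of_chart (hloc : IsLocallyHyperbolic X)
    (hman : ∀ x : X, ∃ φ : OpenPartialHomeomorph X E3, x ∈ φ.source) : HypLike X := by
  intro x
  obtain ⟨ε, hε, f, hf0, hf⟩ := hloc x
  set F : X → Hyp := fun z => Hyp.ofHalf (f z) with hF
  have hFi : IsoOn F (ball x ε) := fun a ha b hb => by
    rw [hF, Hyp.dist_ofHalf (hf0 a ha) (hf0 b hb), hf a ha b hb]
  obtain ⟨φ, hφ⟩ := hman x
  set U : Set E3 := φ.target ∩ φ.symm ⁻¹' ball x ε with hU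
  have hUo : IsOpen U := φ.isOpen_inter_preimage_symm isOpen_ball
  have hUF : ContinuousOn (fun u => Hyp.toHalf (F (φ.symm u))) U := by
    refine Hyp.continuous_toHalf.comp_continuousOn (hFi.continuousOn.comp
      (φ.continuousOn_symm.mono inter_subset_left) fun u hu => hu.2)
  have hUi : InjOn (fun u => Hyp.toHalf (F (φ.symm u))) U := fun u hu v hv huv =>
    φ.symm.injOn hu.1 hv.1 (hFi.injOn hu.2 hv.2 (Hyp.toHalf_injective huv))
  have hopen : IsOpen (F '' (φ.source ∩ ball x ε)) := by
    have h1 := isOpen_image_of_injOn hUo hUF hUi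
    have h2 := Hyp.isOpen_image_ofHalf h1 (by rintro _ ⟨u, hu, rfl⟩; exact Hyp.toHalf_pos _)
    convert h2 using 1
    ext p; constructor
    · rintro ⟨z, hz, rfl⟩
      refine ⟨Hyp.toHalf (F z), ⟨φ z, ⟨φ.map_source hz.1, ?_⟩, ?_⟩, Hyp.ofHalf_toHalf _⟩
      · rw [mem_preimage, φ.left_inv hz.1]; exact hz.2
      · simp only [φ.left_inv hz.1]
    · rintro ⟨_, ⟨u, hu, rfl⟩, rfl⟩
      exact ⟨φ.symm u, ⟨φ.map_target hu.1, hu.2⟩, (Hyp.ofHalf_toHalf _).symm⟩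
  obtain ⟨r, hr, hrs⟩ := Metric.isOpen_iff.1 hopen (F x) ⟨x, ⟨hφ, mem_ball_self hε⟩, rfl⟩
  have hinv : ∀ p ∈ ball (F x) r, ∃ z ∈ ball x ε, F z = p := fun p hp => by
    obtain ⟨z, hz, rfl⟩ := hrs hp
    exact ⟨z, hz.2, rfl⟩
  have : Nonempty X := ⟨x⟩
  choose! χ hχb hχ using hinv
  have hχi : IsoOn χ (ball (F x) r) := fun a ha b hb => by
    rw [← hFi _ (hχb a ha) _ (hχb b hb), hχ a ha, hχ b hb]
  have hx := mem_ball_self (x := F x) hr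
  have hχx : χ (F x) = x := hFi.injOn (hχb _ hx) (mem_ball_self hε) (hχ _ hx)
  refine ⟨min r ε, lt_min hr hε, fun y => ?_⟩
  obtain ⟨g, hg⟩ := Lor.exists_smul_eq y (F x)
  have hgb : ∀ z ∈ ball y (min r ε), g • z ∈ ball (F x) r := fun z hz => by
    rw [← hg, mem_ball, dist_smul]; exact ball_subset_ball (min_le_left _ _) hz
  refine ⟨fun z => χ (g • z), by simp only [hg, hχx], fun a ha b hb => ?_, ?_⟩
  · rw [hχi _ (hgb a ha) _ (hgb b hb), dist_smul]
  · ext w; constructor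
    · rintro ⟨z, hz, rfl⟩
      change dist (χ (g • z)) x < _
      rw [show dist (χ (g • z)) x = dist (χ (g • z)) (χ (F x)) by rw [hχx], hχi _ (hgb z hz) _ hx, ← hg, dist_smul]
      exact hz
    · intro hw
      have hwε : w ∈ ball x ε := ball_subset_ball (min_le_right _ _) hw
      have hwd : dist (F w) (F x) < min r ε := by
        rw [hFi w hwε x (mem_ball_self hε)]; exact hw
      have hwr : F w ∈ ball (F x) r := hwd.trans_le (min_le_left _ _)
      refine ⟨g⁻¹ • F w, ?_, ?_⟩
      · rw [mem_ball, ← dist_smul g, smul_inv_smul, hg]; exact hwd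
      · simp only [smul_inv_smul]
        exact hFi.injOn (hχb _ hwr) hwε (hχ _ hwr)

end HypArc

namespace HypArc

variable {X : Type*} [MetricSpace X]

lemma IsoOn.hausdorffMeasure_le {A B : Type*} [MetricSpace A] [MetricSpace B] [MeasurableSpace A]
    [BorelSpace A] [MeasurableSpace B] [BorelSpace B] {f : A → B} {U : Set A} (h : IsoOn f U)
    {d : ℝ} (hd : 0 ≤ d) : μH[d] U ≤ μH[d] (f '' U) := by
  rcases U.eq_empty_or_nonempty with rfl | ⟨a, -⟩
  · simp
  have : Nonempty A := ⟨a⟩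
  have hl : LipschitzOnWith 1 (Function.invFunOn f U) (f '' U) := by
    refine LipschitzOnWith.of_dist_le_mul ?_
    rintro _ ⟨x, hx, rfl⟩ _ ⟨y, hy, rfl⟩
    rw [h.injOn.leftInvOn_invFunOn hx, h.injOn.leftInvOn_invFunOn hy, h x hx y hy]
    simp
  have := hl.hausdorffMeasure_image_le hd
  rwa [h.injOn.leftInvOn_invFunOn.image_image, ENNReal.coe_one, ENNReal.one_rpow, one_mul] at this

namespace Hyp

instance : MeasurableSpace Hyp := borel Hyp
instance : BorelSpace Hyp := ⟨rfl⟩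

instance : SecondCountableTopology Hyp := inferInstance

lemma exists_lipschitzOn_val : ∃ C : NNReal, LipschitzOnWith C Hyp.val (ball e 1) := by
  obtain ⟨C, hC⟩ := (isCompact_closedBall e 1).exists_bound_of_continuousOn
    continuous_lin_frame.continuousOn
  have hC0 : 0 ≤ C := (norm_nonneg _).trans (hC e (mem_closedBall_self zero_le_one))
  refine ⟨Real.toNNReal (C * Real.exp 2), LipschitzOnWith.of_dist_le_mul fun q hq p hp => ?_⟩
  rw [dist_eq_norm, Real.coe_toNNReal _ (by positivity)]
  refine (norm_sub_le p q).trans ?_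
  have hd : dist q p ≤ 2 := by
    have := dist_triangle_right q p e
    rw [mem_ball] at hq hp; linarith
  have h1 : Real.exp (dist q p) - 1 ≤ dist q p * Real.exp 2 := by
    have h2 := Real.add_one_le_exp (-dist q p)
    have h3 : Real.exp (dist q p) ≤ Real.exp 2 := Real.exp_le_exp.2 hd
    have h4 : Real.exp (dist q p) * Real.exp (-dist q p) = 1 := by
      rw [← Real.exp_add]; simp
    nlinarith [Real.exp_pos (dist q p), dist_nonneg (x := q) (y := p)]
  have h5 : 0 ≤ Real.exp (dist q p) - 1 := by
    linarith [Real.one_le_exp (dist_nonneg (x := q) (y := p))]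
  calc _ ≤ C * (dist q p * Real.exp 2) :=
        mul_le_mul (hC p (ball_subset_closedBall hp)) h1 h5 hC0
    _ = _ := by ring

/-- The point with given first three coordinates. -/
def ofCoord (u : Fin 3 → ℝ) : Hyp := ofHalf !₂[u 1 / u 0, u 2 / u 0, (u 0)⁻¹]

lemma coord_ofCoord {u : Fin 3 → ℝ} (hu : 0 < u 0) (i : Fin 3) :
    (ofCoord u).val i.castSucc = u i := by
  have h : 0 < (!₂[u 1 / u 0, u 2 / u 0, (u 0)⁻¹] : E3) 2 := by simpa using hu
  rw [ofCoord, val_ofHalf h]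
  fin_cases i <;> simp <;> field_simp

lemma continuousOn_ofCoord : ContinuousOn ofCoord {u | 0 < u 0} := by
  refine continuousOn_ofHalf.comp ?_ fun u hu => by simpa using hu
  refine (PiLp.continuous_toLp 2 _).comp_continuousOn ?_
  rw [continuousOn_pi]
  have h0 : ContinuousOn (fun u : Fin 3 → ℝ => u 0) {u | 0 < u 0} :=
    (continuous_apply 0).continuousOn
  have hne : ∀ u ∈ {u : Fin 3 → ℝ | 0 < u 0}, u 0 ≠ 0 := fun u hu => ne_of_gt hu
  intro i
  fin_cases i
  · exact (continuous_apply 1).continuousOn.div h0 hne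
  · exact (continuous_apply 2).continuousOn.div h0 hne
  · exact h0.inv₀ hne

lemma hausdorffMeasure_ball_pos {ε : ℝ} (hε : 0 < ε) :
    ∃ c > 0, ∀ y : Hyp, c ≤ μH[3] (ball y ε) := by
  refine ⟨μH[3] (ball e ε), ?_, fun y => ?_⟩
  · obtain ⟨C, hC⟩ := exists_lipschitzOn_val
    set r := min ε 1
    have hr : 0 < r := lt_min hε one_pos
    have hC' := hC.mono (ball_subset_ball (min_le_right ε 1))
    set π : V → (Fin 3 → ℝ) := fun v i => v i.castSucc
    have hπ : LipschitzWith 1 π := LipschitzWith.of_dist_le_mul fun v w => by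
      rw [NNReal.coe_one, one_mul, dist_pi_le_iff dist_nonneg]
      exact fun i => dist_le_pi_dist v w _
    have hl := (hπ.comp_lipschitzOnWith hC').hausdorffMeasure_image_le (d := 3) (by norm_num)
    set W : Set (Fin 3 → ℝ) := {u | 0 < u 0} ∩ ofCoord ⁻¹' ball e r
    have hW : IsOpen W := continuousOn_ofCoord.isOpen_inter_preimage
      (isOpen_lt continuous_const (continuous_apply 0)) isOpen_ball
    have hWs : W ⊆ (π ∘ Hyp.val) '' ball e r := fun u hu =>
      ⟨ofCoord u, hu.2, funext fun i => coord_ofCoord hu.1 i⟩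
    have hWne : W.Nonempty := by
      refine ⟨![1, 0, 0], by simp, ?_⟩
      have : ofCoord ![1, 0, 0] = e := by
        refine val_injective ?_
        rw [ofCoord, val_ofHalf (by simp)]
        ext i; fin_cases i <;> simp [e]
      rw [mem_preimage, this]
      exact mem_ball_self hr
    have hpos : 0 < μH[3] W := by
      have := hausdorffMeasure_pi_real (ι := Fin 3)
      rw [Fintype.card_fin] at this
      norm_num at this
      rw [this]
      exact hW.measure_pos _ hWne
    have h3 := hpos.trans_le ((measure_mono hWs).trans hl)
    refine lt_of_lt_of_le ?_ (measure_mono (ball_subset_ball (min_le_left ε 1)))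
    rw [pos_iff_ne_zero]
    intro h0
    rw [h0, mul_zero] at h3
    exact lt_irrefl _ h3
  · obtain ⟨g, hg⟩ := Lor.exists_smul_eq e y
    rw [← (isometry_smul Hyp g).hausdorffMeasure_image (Or.inl (by norm_num))]
    refine measure_mono ?_
    rintro _ ⟨z, hz, rfl⟩
    change dist (g • z) y < ε
    rw [← hg, dist_smul]
    exact hz

end Hyp

lemma HypLike.hausdorffMeasure_ball_le [MeasurableSpace X] [BorelSpace X] (hX : HypLike X)
    {ψ : Hyp → X} (h : LocIso ψ univ) {U : Set Hyp} (hU : IsOpen U) (hinj : InjOn ψ U) :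
    μH[3] U ≤ μH[3] (ψ '' U) := by
  choose ε hε hi using fun a : Hyp => h.exists_isoOn a
  obtain ⟨T, hT, hcov⟩ := TopologicalSpace.countable_cover_nhds
    (fun a : Hyp => ball_mem_nhds a (hε a))
  have hTne : T.Nonempty := by
    by_contra hne
    rw [not_nonempty_iff_eq_empty] at hne
    simp only [hne, mem_empty_iff_false, iUnion_of_empty, iUnion_empty] at hcov
    exact (hcov ▸ mem_univ Hyp.e : Hyp.e ∈ (∅ : Set Hyp))
  obtain ⟨s, rfl⟩ := hT.exists_eq_range hTne
  set O : ℕ → Set Hyp := fun n => ball (s n) (ε (s n)) ∩ U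
  set P : ℕ → Set X := fun n => ψ '' O n
  have hPm : ∀ n, MeasurableSet (P n) := fun n =>
    (hX.isOpenMap h _ (isOpen_ball.inter hU)).measurableSet
  have hUs : U ⊆ ⋃ n, O n ∩ ψ ⁻¹' disjointed P n := by
    intro a ha
    have h1 : ψ a ∈ ⋃ n, disjointed P n := by
      rw [iUnion_disjointed]
      have : a ∈ ⋃ x ∈ range s, ball x (ε x) := by rw [hcov]; trivial
      simp only [mem_iUnion, mem_range, exists_prop, exists_exists_eq_and] at this
      obtain ⟨n, hn⟩ := this
      exact mem_iUnion.2 ⟨n, a, ⟨hn, ha⟩, rfl⟩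
    obtain ⟨n, hn⟩ := mem_iUnion.1 h1
    obtain ⟨b, hb, hba⟩ := disjointed_subset P n hn
    have : b = a := hinj hb.2 ha hba
    exact mem_iUnion.2 ⟨n, this ▸ hb, hn⟩
  calc μH[3] U ≤ ∑' n, μH[3] (O n ∩ ψ ⁻¹' disjointed P n) :=
        (measure_mono hUs).trans (measure_iUnion_le _)
    _ ≤ ∑' n, μH[3] (disjointed P n) := by
        refine ENNReal.tsum_le_tsum fun n => ?_
        refine (((hi (s n)).mono (inter_subset_left.trans inter_subset_left)).hausdorffMeasure_le
          (by norm_num)).trans (measure_mono ?_)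
        rintro _ ⟨a, ha, rfl⟩
        exact ha.2
    _ = μH[3] (⋃ n, P n) := by
        rw [← iUnion_disjointed, measure_iUnion (disjoint_disjointed P)
          fun n => MeasurableSet.disjointed hPm n]
    _ ≤ μH[3] (ψ '' U) := measure_mono (iUnion_subset fun n => image_mono inter_subset_right)

/-- Outside a compact set, the points of a finite-volume quotient are moved little by some
nontrivial deck transformation. -/
lemma HypLike.exists_compact_thick [MeasurableSpace X] [BorelSpace X] (hX : HypLike X)
    {ψ : Hyp → X} (h : LocIso ψ univ) (hfin : μH[3] (univ : Set X) < ⊤) {ε : ℝ} (hε : 0 < ε) :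
    ∃ K : Set X, IsCompact K ∧ ∀ y, ψ y ∉ K → ∃ g ∈ deck ψ, g ≠ 1 ∧ dist y (g • y) < 2 * ε := by
  obtain ⟨c, hc, hcb⟩ := Hyp.hausdorffMeasure_ball_pos hε
  set Thick : Set Hyp := {y | ∀ g ∈ deck ψ, g ≠ 1 → 2 * ε ≤ dist y (g • y)} with hThick
  set P : Finset Hyp → Prop := fun s => (∀ y ∈ s, y ∈ Thick) ∧
    (s : Set Hyp).PairwiseDisjoint fun y => ψ '' ball y ε with hP
  have hinj : ∀ y ∈ Thick, InjOn ψ (ball y ε) := fun y hy a ha b hb hab => by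
    obtain ⟨g, hg, hgab⟩ := hX.exists_deck h hab
    by_cases hg1 : g = 1
    · rw [← hgab, hg1, one_smul]
    · exfalso
      have h1 := hy g hg hg1
      have h2 := dist_triangle y b (g • y)
      rw [← hgab, dist_smul, hgab] at h2
      rw [mem_ball] at ha hb
      rw [dist_comm y b] at h2
      linarith
  have hbound : ∀ s, P s → s.card * c ≤ μH[3] (univ : Set X) := fun s hs => by
    calc s.card * c = ∑ y ∈ s, c := by simp
      _ ≤ ∑ y ∈ s, μH[3] (ψ '' ball y ε) := Finset.sum_le_sum fun y hy =>
          (hcb y).trans (hX.hausdorffMeasure_ball_le h isOpen_ball (hinj y (hs.1 y hy)))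
      _ = μH[3] (⋃ y ∈ s, ψ '' ball y ε) := (measure_biUnion_finset hs.2 fun y _ =>
          (hX.isOpenMap h _ isOpen_ball).measurableSet).symm
      _ ≤ _ := measure_mono (subset_univ _)
  obtain ⟨s, hs, hmax⟩ : ∃ s, P s ∧ ∀ y ∈ Thick,
      ∃ z ∈ s, ¬ Disjoint (ψ '' ball y ε) (ψ '' ball z ε) := by
    by_contra! hno
    have hall : ∀ n : ℕ, ∃ s, P s ∧ s.card = n := by
      intro n
      induction n with
      | zero => exact ⟨∅, ⟨by simp, by simp⟩, rfl⟩
      | succ n ih =>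
        obtain ⟨s, hs, hsn⟩ := ih
        obtain ⟨y, hy, hyd⟩ := hno s hs
        have hys : y ∉ s := fun hys => by
          have := hyd y hys
          rw [disjoint_self, bot_eq_empty, image_eq_empty] at this
          exact (this ▸ mem_ball_self hε : y ∈ (∅ : Set Hyp))
        classical
        refine ⟨insert y s, ⟨?_, ?_⟩, by rw [Finset.card_insert_of_notMem hys, hsn]⟩
        · intro z hz
          rcases Finset.mem_insert.1 hz with rfl | hz
          exacts [hy, hs.1 z hz]
        · rw [Finset.coe_insert]
          exact hs.2.insert fun z hz _ => hyd z hz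
    obtain ⟨n, hn⟩ := ENNReal.exists_nat_mul_gt hc.ne' hfin.ne
    obtain ⟨s, hs, hsn⟩ := hall n
    exact absurd (hbound s hs) (by rw [hsn]; exact not_le.2 hn)
  refine ⟨⋃ y ∈ s, ψ '' closedBall y (2 * ε), s.isCompact_biUnion fun y _ =>
    (isCompact_closedBall y _).image h.continuous, fun y hy => ?_⟩
  by_contra! hno
  obtain ⟨z, hz, hd⟩ := hmax y hno
  obtain ⟨_, ⟨a, ha, rfl⟩, ⟨b, hb, hba⟩⟩ := not_disjoint_iff.1 hd
  obtain ⟨g, hg, hgab⟩ := hX.exists_deck h hba.symm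
  refine hy (mem_iUnion₂.2 ⟨z, hz, g • y, ?_, hg y⟩)
  rw [mem_closedBall]
  have h2 := dist_triangle (g • y) (g • a) z
  rw [dist_smul, hgab] at h2
  rw [mem_ball] at ha hb
  rw [dist_comm y a] at h2
  linarith

end HypArc

namespace HypArc

/-- The nonzero part of the closed future cone. -/
def Cone (v : V) : Prop := 0 ≤ bil v v ∧ 0 < v 0 + v 3

/-- The future light cone. -/
def Null (v : V) : Prop := bil v v = 0 ∧ 0 < v 0 + v 3

lemma Null.cone {v : V} (h : Null v) : Cone v := ⟨h.1.ge, h.2⟩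

lemma Hyp.cone (p : Hyp) : Cone p.val := by
  refine ⟨by rw [p.eq]; exact zero_le_one, ?_⟩
  have := p.pos
  have h : 0 < p.val 3 := by rw [Hyp.apply_three]; positivity
  linarith

lemma Cone.mul_ge {v : V} (h : Cone v) : v 1 ^ 2 + v 2 ^ 2 ≤ v 0 * v 3 := by
  have := h.1; simp only [bil] at this; linarith

lemma Cone.nonneg {v : V} (h : Cone v) : 0 ≤ v 0 ∧ 0 ≤ v 3 := by
  have h1 := h.mul_ge
  have h2 := h.2
  have h3 : 0 ≤ v 0 * v 3 := by nlinarith [sq_nonneg (v 1), sq_nonneg (v 2)]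
  constructor
  · by_contra! h0
    nlinarith
  · by_contra! h0
    nlinarith

lemma Cone.of_zero {v : V} (h : Cone v) (h0 : v 0 = 0) : v 1 = 0 ∧ v 2 = 0 ∧ 0 < v 3 := by
  have h1 := h.mul_ge
  have h2 := h.2
  rw [h0, zero_mul] at h1
  rw [h0, zero_add] at h2
  exact ⟨by nlinarith [sq_nonneg (v 1), sq_nonneg (v 2)],
    by nlinarith [sq_nonneg (v 1), sq_nonneg (v 2)], h2⟩

lemma Cone.bil_hyp_pos {v : V} (h : Cone v) (q : Hyp) : 0 < bil v q := by
  have hq := q.pos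
  have hq3 : q.val 3 * q.val 0 = 1 + q.val 1 ^ 2 + q.val 2 ^ 2 := by
    rw [q.apply_three]; field_simp
  have hm := h.mul_ge
  rcases h.nonneg.1.eq_or_lt with h0 | h0
  · obtain ⟨h1, h2, h3⟩ := h.of_zero h0.symm
    simp only [bil, ← h0, h1, h2]
    have := mul_pos h3 hq
    linarith
  · have key : 0 < 2 * (v 0 * q.val 0) * bil v q := by
      have e1 : 2 * (v 0 * q.val 0) * bil v q = v 0 ^ 2 * (q.val 3 * q.val 0) +
          q.val 0 ^ 2 * (v 0 * v 3) - 2 * (v 0 * q.val 0) * (v 1 * q.val 1 + v 2 * q.val 2) := by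
        simp only [bil]; ring
      have e2 := mul_le_mul_of_nonneg_left hm (sq_nonneg (q.val 0))
      rw [e1, hq3]
      nlinarith [sq_nonneg (v 0 * q.val 1 - q.val 0 * v 1),
        sq_nonneg (v 0 * q.val 2 - q.val 0 * v 2), pow_pos h0 2]
    exact pos_of_mul_pos_right key (by positivity)

lemma bil_comb (v w : V) : 2 * (v 0 * w 0) * bil v w =
    w 0 ^ 2 * bil v v + v 0 ^ 2 * bil w w + (v 0 * w 1 - w 0 * v 1) ^ 2 +
      (v 0 * w 2 - w 0 * v 2) ^ 2 := by
  simp only [bil]; ring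

lemma Cone.bil_nonneg {v w : V} (hv : Cone v) (hw : Cone w) : 0 ≤ bil v w := by
  rcases hv.nonneg.1.eq_or_lt with h0 | h0
  · obtain ⟨h1, h2, h3⟩ := hv.of_zero h0.symm
    simp only [bil, ← h0, h1, h2]
    have := mul_nonneg h3.le hw.nonneg.1
    linarith
  rcases hw.nonneg.1.eq_or_lt with h0' | h0'
  · obtain ⟨h1, h2, h3⟩ := hw.of_zero h0'.symm
    simp only [bil, ← h0', h1, h2]
    have := mul_nonneg h0.le h3.le
    linarith
  have h2 := hv.1
  have h3 := hw.1
  have : 0 ≤ 2 * (v 0 * w 0) * bil v w := by rw [bil_comb]; positivity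
  exact nonneg_of_mul_nonneg_right this (by positivity)

lemma Null.eq_smul {v w : V} (hv : Null v) (hw : Null w) (h : bil v w = 0) :
    ∃ c > (0 : ℝ), w = c • v := by
  rcases hv.cone.nonneg.1.eq_or_lt with h0 | h0
  · obtain ⟨h1, h2, h3⟩ := hv.cone.of_zero h0.symm
    have hw0 : w 0 = 0 := by
      simp only [bil, ← h0, h1, h2] at h
      have : v 3 * w 0 = 0 := by linarith
      exact (mul_eq_zero.1 this).resolve_left h3.ne'
    obtain ⟨k1, k2, k3⟩ := hw.cone.of_zero hw0
    refine ⟨w 3 / v 3, div_pos k3 h3, ?_⟩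
    ext i; fin_cases i <;> simp [hw0, ← h0, h1, h2, k1, k2]
    field_simp
  rcases hw.cone.nonneg.1.eq_or_lt with h0' | h0'
  · obtain ⟨k1, k2, k3⟩ := hw.cone.of_zero h0'.symm
    simp only [bil, ← h0', k1, k2] at h
    have := mul_pos h0 k3
    linarith
  have hb := bil_comb v w
  rw [h, hv.1, hw.1] at hb
  have e1 : v 0 * w 1 = w 0 * v 1 := by
    nlinarith [sq_nonneg (v 0 * w 1 - w 0 * v 1), sq_nonneg (v 0 * w 2 - w 0 * v 2)]
  have e2 : v 0 * w 2 = w 0 * v 2 := by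
    nlinarith [sq_nonneg (v 0 * w 1 - w 0 * v 1), sq_nonneg (v 0 * w 2 - w 0 * v 2)]
  have e3 : v 0 * w 3 = w 0 * v 3 := by
    have a1 := hv.1
    have a2 := hw.1
    simp only [bil] at a1 a2
    have : w 0 * v 0 * (v 0 * w 3 - w 0 * v 3) = 0 := by
      have : w 0 * v 0 * (v 0 * w 3 - w 0 * v 3) = v 0 ^ 2 * (w 1 ^ 2 + w 2 ^ 2) -
          w 0 ^ 2 * (v 1 ^ 2 + v 2 ^ 2) := by linear_combination v 0 ^ 2 * a2 - w 0 ^ 2 * a1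
      rw [this]
      linear_combination (v 0 * w 1 + w 0 * v 1) * e1 + (v 0 * w 2 + w 0 * v 2) * e2
    have := (mul_eq_zero.1 this).resolve_left (by positivity)
    linarith
  refine ⟨w 0 / v 0, div_pos h0' h0, ?_⟩
  ext i; fin_cases i <;> simp <;> field_simp <;> linarith

lemma Null.bil_pos_of {v w : V} (hv : Null v) (hw : Null w) (h : ¬ ∃ c > (0 : ℝ), w = c • v) :
    0 < bil v w :=
  (hv.cone.bil_nonneg hw.cone).lt_of_ne fun h0 => h (hv.eq_smul hw h0.symm)

lemma Cone.lin {v : V} (h : Cone v) (g : Lor) : Cone (Lor.lin g v) := by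
  refine ⟨by rw [Lor.bil_lin]; exact h.1, ?_⟩
  have h1 := h.bil_hyp_pos (g⁻¹ • Hyp.e)
  rw [Lor.val_smul, ← Lor.bil_lin_left] at h1
  simp [bil, Hyp.e] at h1
  linarith

lemma Null.lin {v : V} (h : Null v) (g : Lor) : Null (Lor.lin g v) :=
  ⟨by rw [Lor.bil_lin, h.1], (h.cone.lin g).2⟩

lemma Null.smul {v : V} (h : Null v) {c : ℝ} (hc : 0 < c) : Null (c • v) := by
  refine ⟨by rw [bil_smul_left, bil_smul_right, h.1]; simp, ?_⟩
  have := mul_pos hc h.2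
  simp only [Pi.smul_apply, smul_eq_mul]
  linarith

/-- The positive multiple of a timelike vector on the hyperboloid. -/
def Hyp.proj (v : V) (h : 0 < bil v v) (h' : 0 < v 0 + v 3) : Hyp where
  val := (√(bil v v))⁻¹ • v
  pos := by
    have hc : Cone v := ⟨h.le, h'⟩
    have h0 : 0 < v 0 := hc.nonneg.1.lt_of_ne fun h0 => by
      obtain ⟨h1, h2, -⟩ := hc.of_zero h0.symm
      simp [bil, ← h0, h1, h2] at h
    have := Real.sqrt_pos.2 h
    simp only [Pi.smul_apply, smul_eq_mul]
    positivity
  eq := by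
    have h1 := Real.sqrt_pos.2 h
    have h2 := Real.sq_sqrt h.le
    rw [bil_smul_left, bil_smul_right]
    field_simp
    exact h2.symm

lemma Hyp.exists_fixed {g : Lor} {v : V} (h : 0 < bil v v) (h' : 0 < v 0 + v 3)
    (hg : Lor.lin g v = v) : ∃ y : Hyp, g • y = y :=
  ⟨Hyp.proj v h h', Hyp.val_injective (by
    rw [Lor.val_smul]; simp only [Hyp.proj]; rw [map_smul, hg])⟩

/-- A group acting freely and with orbits whose points are uniformly separated. -/
def Disc (Γ : Subgroup Lor) : Prop :=
  ∀ y : Hyp, ∃ ε > 0, ∀ g ∈ Γ, g ≠ 1 → ε ≤ dist y (g • y)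

lemma Disc.eq_one {Γ : Subgroup Lor} (hΓ : Disc Γ) {g : Lor} (hg : g ∈ Γ) {y : Hyp}
    (hy : g • y = y) : g = 1 := by
  obtain ⟨ε, hε, h⟩ := hΓ y
  by_contra hne
  have := h g hg hne
  rw [hy, dist_self] at this
  linarith

lemma Disc.eq_one_of_time {Γ : Subgroup Lor} (hΓ : Disc Γ) {g : Lor} (hg : g ∈ Γ) {v : V}
    (h : 0 < bil v v) (h' : 0 < v 0 + v 3) (hv : Lor.lin g v = v) : g = 1 := by
  obtain ⟨y, hy⟩ := Hyp.exists_fixed h h' hv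
  exact hΓ.eq_one hg hy

/-- Two elements of a sequence with bounded displacement coincide. -/
lemma Disc.exists_eq {Γ : Subgroup Lor} (hΓ : Disc Γ) (s : ℕ → Lor) (hs : ∀ k, s k ∈ Γ) (y : Hyp)
    (R : ℝ) (hR : ∀ k, dist y (s k • y) ≤ R) : ∃ i j, i < j ∧ s i = s j := by
  obtain ⟨ε, hε, h⟩ := hΓ y
  obtain ⟨a, -, φ, hφ, hlim⟩ := (isCompact_closedBall y R).tendsto_subseq
    (x := fun k => s k • y) fun k => by rw [mem_closedBall, dist_comm]; exact hR k
  obtain ⟨N, hN⟩ := Metric.cauchySeq_iff'.1 hlim.cauchySeq ε hε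
  refine ⟨φ N, φ (N + 1), hφ (Nat.lt_succ_self N), ?_⟩
  have h1 := hN (N + 1) (Nat.le_succ N)
  simp only [Function.comp] at h1
  by_contra hne
  have h2 := h ((s (φ N))⁻¹ * s (φ (N + 1))) (Γ.mul_mem (Γ.inv_mem (hs _)) (hs _)) (by
    rw [Ne, inv_mul_eq_one]; exact hne)
  rw [mul_smul, ← dist_smul (s (φ N)), smul_inv_smul, dist_comm] at h2
  linarith

lemma Disc.pow_ne_one {Γ : Subgroup Lor} (hΓ : Disc Γ) {g : Lor} (hg : g ∈ Γ) (hg1 : g ≠ 1) {k : ℕ}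
    (hk : k ≠ 0) : g ^ k ≠ 1 := by
  intro hgk
  have hT : ∀ n : ℕ, 0 < bil (∑ i ∈ Finset.range (n + 1), Lor.lin (g ^ i) Hyp.e.val)
      (∑ i ∈ Finset.range (n + 1), Lor.lin (g ^ i) Hyp.e.val) ∧
      0 < (∑ i ∈ Finset.range (n + 1), Lor.lin (g ^ i) Hyp.e.val) 0 +
        (∑ i ∈ Finset.range (n + 1), Lor.lin (g ^ i) Hyp.e.val) 3 := by
    intro n
    induction n with
    | zero =>
      simp only [zero_add, Finset.sum_range_one, pow_zero, Lor.lin_one,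
        one_apply_eq_self]
      exact ⟨by rw [Hyp.e.eq]; exact one_pos, Hyp.e.cone.2⟩
    | succ n ih =>
      rw [Finset.sum_range_succ]
      set v := ∑ i ∈ Finset.range (n + 1), Lor.lin (g ^ i) Hyp.e.val
      have hw := Hyp.e.cone.lin (g ^ (n + 1))
      have hv : Cone v := ⟨ih.1.le, ih.2⟩
      have h1 := hv.bil_nonneg hw
      have h2 := bil_comm v (Lor.lin (g ^ (n + 1)) Hyp.e.val)
      rw [bil_add_left, bil_add_right, bil_add_right]
      refine ⟨by linarith [ih.1, hw.1], ?_⟩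
      simp only [Pi.add_apply]
      linarith [ih.2, hw.2]
  obtain ⟨n, rfl⟩ := Nat.exists_eq_succ_of_ne_zero hk
  refine hg1 (hΓ.eq_one_of_time hg (hT n).1 (hT n).2 ?_)
  have h2 : ∀ i, Lor.lin g (Lor.lin (g ^ i) Hyp.e.val) = Lor.lin (g ^ (i + 1)) Hyp.e.val := fun i => by
    rw [pow_succ', Lor.lin_mul_apply]
  rw [map_sum]
  simp only [h2]
  rw [Finset.sum_range_succ, Finset.sum_range_succ', ← Nat.succ_eq_add_one, hgk, pow_zero]

/-- The fixed points at infinity of an isometry, as future null vectors. -/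
def Fix (g : Lor) : Set V := {v | Null v ∧ ∃ l : ℝ, Lor.lin g v = l • v}

lemma eigen_pos {g : Lor} {v : V} (hv : Null v) {l : ℝ} (h : Lor.lin g v = l • v) : 0 < l := by
  have h1 := (hv.lin g).2
  rw [h] at h1
  simp only [Pi.smul_apply, smul_eq_mul, ← mul_add] at h1
  exact pos_of_mul_pos_left h1 hv.2.le

/-- The point of the light-cone slice corresponding to a point of the unit ball. -/
def ballVec (x : E3) : V := ![1 + x 2, x 0, x 1, 1 - x 2]

lemma bil_ballVec (x : E3) : bil (ballVec x) (ballVec x) = 1 - ‖x‖ ^ 2 := by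
  rw [EuclideanSpace.norm_sq_eq, Fin.sum_univ_three]
  simp [bil, ballVec]
  ring

lemma Fix.nonempty {Γ : Subgroup Lor} (hΓ : Disc Γ) {g : Lor} (hg : g ∈ Γ) (hg1 : g ≠ 1) :
    (Fix g).Nonempty := by
  have hcone : ∀ x ∈ closedBall (0 : E3) 1, Cone (ballVec x) := fun x hx => by
    rw [mem_closedBall_zero_iff] at hx
    refine ⟨?_, by simp [ballVec]⟩
    rw [bil_ballVec]
    nlinarith [norm_nonneg x]
  set w : E3 → V := fun x => Lor.lin g (ballVec x) with hw
  have hwc : Continuous w := (Lor.lin g).continuous.comp (by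
    unfold ballVec
    fun_prop)
  have hwi : ∀ i, Continuous fun x => w x i := fun i => (continuous_apply i).comp hwc
  set c : E3 → ℝ := fun x => (w x 0 + w x 3) / 2 with hc
  have hcc : Continuous c := ((hwi 0).add (hwi 3)).div_const 2
  have hcpos : ∀ x ∈ closedBall (0 : E3) 1, 0 < c x := fun x hx => by
    have := ((hcone x hx).lin g).2
    simp only [hc, hw]; linarith
  have hne : ∀ x ∈ closedBall (0 : E3) 1, c x ≠ 0 := fun x hx => (hcpos x hx).ne'
  set φ : E3 → E3 := fun x => !₂[w x 1 / c x, w x 2 / c x, (w x 0 - w x 3) / (2 * c x)] with hφ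
  have hφc : ContinuousOn φ (closedBall 0 1) := by
    refine (PiLp.continuous_toLp 2 _).comp_continuousOn ?_
    rw [continuousOn_pi]
    intro i
    fin_cases i
    · exact (hwi 1).continuousOn.div hcc.continuousOn hne
    · exact (hwi 2).continuousOn.div hcc.continuousOn hne
    · exact ((hwi 0).sub (hwi 3)).continuousOn.div (hcc.const_smul (2 : ℝ)).continuousOn
        fun x hx => mul_ne_zero two_ne_zero (hne x hx)
  have hφm : MapsTo φ (closedBall 0 1) (closedBall 0 1) := fun x hx => by
    have h1 := ((hcone x hx).lin g).mul_ge
    have h2 := hcpos x hx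
    rw [mem_closedBall_zero_iff, ← sq_le_one_iff₀ (norm_nonneg _), EuclideanSpace.norm_sq_eq,
      Fin.sum_univ_three]
    simp only [hφ, Real.norm_eq_abs, sq_abs, PiLp.toLp_apply, Matrix.cons_val_zero,
      Matrix.cons_val_one, Matrix.cons_val, div_pow]
    have h3 : w x 1 ^ 2 / c x ^ 2 + w x 2 ^ 2 / c x ^ 2 + (w x 0 - w x 3) ^ 2 / (2 * c x) ^ 2 =
        (4 * (w x 1 ^ 2 + w x 2 ^ 2) + (w x 0 - w x 3) ^ 2) / (4 * c x ^ 2) := by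
      field_simp
      ring
    rw [h3, div_le_one (by positivity)]
    simp only [hc] at h1 ⊢
    nlinarith
  obtain ⟨x, hx, hfix⟩ := brouwer hφc hφm
  have h0 := hne x hx
  have e0 : w x 1 / c x = x 0 := congrArg (fun y : E3 => y 0) hfix
  have e1 : w x 2 / c x = x 1 := congrArg (fun y : E3 => y 1) hfix
  have e2 : (w x 0 - w x 3) / (2 * c x) = x 2 := congrArg (fun y : E3 => y 2) hfix
  rw [div_eq_iff h0] at e0 e1
  rw [div_eq_iff (mul_ne_zero two_ne_zero h0)] at e2
  have e3 : w x 0 + w x 3 = 2 * c x := by simp only [hc]; ring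
  have hvw : Lor.lin g (ballVec x) = c x • ballVec x := by
    change w x = _
    ext i
    fin_cases i <;> simp [ballVec] <;> linarith
  rcases (hcone x hx).1.eq_or_lt with h | h
  · exact ⟨ballVec x, ⟨h.symm, (hcone x hx).2⟩, c x, hvw⟩
  · exfalso
    have h1 := Lor.bil_lin g (ballVec x) (ballVec x)
    rw [hvw, bil_smul_left, bil_smul_right] at h1
    have h2 : c x * c x = 1 := by
      have : (c x * c x - 1) * bil (ballVec x) (ballVec x) = 0 := by linarith
      have := (mul_eq_zero.1 this).resolve_right h.ne'
      linarith
    have h3 : c x = 1 := by nlinarith [hcpos x hx]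
    rw [h3, one_smul] at hvw
    exact hg1 (hΓ.eq_one_of_time hg h (hcone x hx).2 hvw)

end HypArc

namespace HypArc

lemma Null.time_add {v w : V} (hv : Null v) (hw : Null w) (h : 0 < bil v w) :
    0 < bil (v + w) (v + w) ∧ 0 < (v + w) 0 + (v + w) 3 := by
  have h1 := bil_comm v w
  rw [bil_add_left, bil_add_right, bil_add_right, hv.1, hw.1]
  simp only [Pi.add_apply]
  exact ⟨by linarith, by linarith [hv.2, hw.2]⟩

lemma eigen_inv {g : Lor} {v : V} {l : ℝ} (hl : l ≠ 0) (h : Lor.lin g v = l • v) :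
    Lor.lin g⁻¹ v = l⁻¹ • v := by
  have h1 := congrArg (Lor.lin g⁻¹) h
  rw [Lor.lin_inv_lin, map_smul] at h1
  rw [h1, smul_smul, inv_mul_cancel₀ hl, one_smul, ← h1]

lemma eigen_pow {g : Lor} {v : V} {l : ℝ} (h : Lor.lin g v = l • v) (k : ℕ) :
    Lor.lin (g ^ k) v = l ^ k • v := by
  induction k with
  | zero => simp
  | succ k ih => rw [pow_succ', Lor.lin_mul_apply, ih, map_smul, h, smul_smul, pow_succ]

lemma eigen_mul {g : Lor} {v w : V} {l m : ℝ} (hv : Lor.lin g v = l • v)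
    (hw : Lor.lin g w = m • w) (h : bil v w ≠ 0) : l * m = 1 := by
  have h1 := Lor.bil_lin g v w
  rw [hv, hw, bil_smul_left, bil_smul_right, ← mul_assoc] at h1
  exact mul_right_cancel₀ h (h1.trans (one_mul _).symm)

lemma mem_fix_smul {g : Lor} {v : V} (h : v ∈ Fix g) {c : ℝ} (hc : 0 < c) : c • v ∈ Fix g := by
  obtain ⟨hn, l, hl⟩ := h
  exact ⟨hn.smul hc, l, by rw [map_smul, hl, smul_comm]⟩

lemma mem_fix_inv {g : Lor} {v : V} (h : v ∈ Fix g) : v ∈ Fix g⁻¹ := by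
  obtain ⟨hn, l, hl⟩ := h
  exact ⟨hn, l⁻¹, eigen_inv (eigen_pos hn hl).ne' hl⟩

lemma mem_fix_mul {g h : Lor} {v : V} (hg : v ∈ Fix g) (hh : v ∈ Fix h) : v ∈ Fix (g * h) := by
  obtain ⟨hn, l, hl⟩ := hg
  obtain ⟨-, m, hm⟩ := hh
  exact ⟨hn, m * l, by rw [Lor.lin_mul_apply, hm, map_smul, hl, smul_smul]⟩

lemma mem_fix_conj {g : Lor} {v : V} (h : v ∈ Fix g) (k : Lor) :
    Lor.lin k v ∈ Fix (k * g * k⁻¹) := by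
  obtain ⟨hn, l, hl⟩ := h
  exact ⟨hn.lin k, l, by
    rw [Lor.lin_mul_apply, Lor.lin_mul_apply, Lor.lin_inv_lin, hl, map_smul]⟩

lemma exists_smul_of_commute {g h : Lor} {w : V} (hw : Null w) {l : ℝ} (hl : 1 < l)
    (hg : Lor.lin g w = l • w) (hgh : g * h = h * g) : ∃ t > (0 : ℝ), Lor.lin h w = t • w := by
  refine hw.eq_smul (hw.lin h) ?_
  by_contra hne
  have h1 : Lor.lin g (Lor.lin h w) = l • Lor.lin h w := by
    rw [← Lor.lin_mul_apply, hgh, Lor.lin_mul_apply, hg, map_smul]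
  nlinarith [eigen_mul hg h1 hne]

lemma le_cosh (x : ℝ) (hx : 0 ≤ x) : x ≤ Real.cosh x :=
  (Real.self_le_sinh_iff.2 hx).trans (Real.sinh_lt_cosh x).le

namespace Disc

lemma exists_smul_of_lt_one {Γ : Subgroup Lor} (hΓ : Disc Γ)
    {g h : Lor} (hg : g ∈ Γ) (hh : h ∈ Γ) {v w : V}
    (hv : Null v) (hw : Null w) (hvw : 0 < bil v w) {l m : ℝ} (hl1 : l < 1)
    (hgv : Lor.lin g v = l • v) (hgw : Lor.lin g w = l⁻¹ • w) (hhv : Lor.lin h v = m • v) :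
    ∃ t > (0 : ℝ), Lor.lin h w = t • w := by
  have hl := eigen_pos hv hgv
  have hm := eigen_pos hv hhv
  have hl' : 1 < l⁻¹ := (one_lt_inv₀ hl).2 hl1
  set c := g * h * g⁻¹ * h⁻¹ with hc
  have hcΓ : c ∈ Γ := Γ.mul_mem (Γ.mul_mem (Γ.mul_mem hg hh) (Γ.inv_mem hg)) (Γ.inv_mem hh)
  have hcv : Lor.lin c v = v := by
    rw [hc, Lor.lin_mul_apply, Lor.lin_mul_apply, Lor.lin_mul_apply, eigen_inv hm.ne' hhv,
      map_smul, eigen_inv hl.ne' hgv]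
    simp only [map_smul, hhv, hgv, smul_smul]
    convert one_smul ℝ v using 2
    field_simp
  have htime := hv.time_add hw hvw
  set x := Hyp.proj (v + w) htime.1 htime.2 with hx
  have hb : bil (v + w) (v + w) = 2 * bil v w := by
    rw [bil_add_left, bil_add_right, bil_add_right, hv.1, hw.1, bil_comm w v]; ring
  obtain ⟨i, j, hij, hsij⟩ := hΓ.exists_eq (fun k => g ^ k * c * (g ^ k)⁻¹)
    (fun k => Γ.mul_mem (Γ.mul_mem (Γ.pow_mem hg k) hcΓ) (Γ.inv_mem (Γ.pow_mem hg k))) x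
    ((2 * bil v w + bil (Lor.lin c w) w) / (2 * bil v w)) fun k => by
      refine (le_cosh _ dist_nonneg).trans ?_
      have hk := pow_pos hl k
      have hk1 : l ^ k ≤ 1 := pow_le_one₀ hl.le hl1.le
      have hsq := Real.sq_sqrt htime.1.le
      have hs := Real.sqrt_pos.2 htime.1
      have e1 : Lor.lin (g ^ k)⁻¹ (v + w) = (l ^ k)⁻¹ • v + l ^ k • w := by
        rw [map_add, eigen_inv hk.ne' (eigen_pow hgv k),
          eigen_inv (pow_pos (inv_pos.2 hl) k).ne' (eigen_pow hgw k), inv_pow, inv_inv]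
      have e2 : bil (Lor.lin c w) v = bil v w := by
        conv_lhs => rw [← hcv]
        rw [Lor.bil_lin, bil_comm]
      have e3 : bil (v + w) (Lor.lin (g ^ k * c * (g ^ k)⁻¹) (v + w)) =
          2 * bil v w + (l ^ k) ^ 2 * bil (Lor.lin c w) w := by
        rw [bil_comm, Lor.lin_mul_apply, Lor.lin_mul_apply, Lor.bil_lin_left, e1, map_add,
          map_smul, map_smul, hcv]
        simp only [bil_add_left, bil_add_right, bil_smul_left, bil_smul_right, hv.1, e2]
        field_simp
        ring
      rw [Hyp.cosh_dist, Lor.val_smul, hx]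
      simp only [Hyp.proj]
      rw [map_smul, bil_smul_left, bil_smul_right, e3, ← mul_assoc, ← mul_inv, ← sq, hsq, hb,
        inv_mul_eq_div]
      have h0 := (hw.lin c).cone.bil_nonneg hw.cone
      gcongr
      have : (l ^ k) ^ 2 ≤ 1 := pow_le_one₀ hk.le hk1
      nlinarith
  obtain ⟨n, rfl⟩ := Nat.exists_eq_add_of_lt hij
  have hcomm : g ^ (n + 1) * c = c * g ^ (n + 1) := by
    simp only [add_assoc, pow_add g i, mul_inv_rev] at hsij
    have h1 : c = g ^ (n + 1) * c * (g ^ (n + 1))⁻¹ := by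
      have := congrArg (fun a => (g ^ i)⁻¹ * a * g ^ i) hsij
      simpa only [mul_assoc, inv_mul_cancel_left, inv_mul_cancel, mul_one] using this
    rw [eq_mul_inv_iff_mul_eq] at h1
    exact h1.symm
  obtain ⟨t, ht, hct⟩ := exists_smul_of_commute hw (one_lt_pow₀ hl' (Nat.succ_ne_zero n))
    (eigen_pow hgw (n + 1)) hcomm
  have ht1 : 1 * t = 1 := eigen_mul (hcv.trans (one_smul ℝ v).symm) hct hvw.ne'
  rw [one_mul] at ht1
  rw [ht1, one_smul] at hct
  have hc1 : c = 1 := hΓ.eq_one_of_time hcΓ htime.1 htime.2 (by rw [map_add, hcv, hct])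
  refine exists_smul_of_commute hw hl' hgw ?_
  rwa [hc, mul_inv_eq_one, mul_inv_eq_iff_eq_mul] at hc1

lemma fix_subset {Γ : Subgroup Lor} (hΓ : Disc Γ)
    {g h : Lor} (hg : g ∈ Γ) (hg1 : g ≠ 1) (hh : h ∈ Γ) {v : V} (hvg : v ∈ Fix g)
    (hvh : v ∈ Fix h) : Fix g ⊆ Fix h := by
  intro w hw
  by_cases hp : ∃ c > (0 : ℝ), w = c • v
  · obtain ⟨c, hc, rfl⟩ := hp
    exact mem_fix_smul hvh hc
  have hvw := hvg.1.bil_pos_of hw.1 hp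
  obtain ⟨hv, l, hl⟩ := hvg
  obtain ⟨hw, l', hl'⟩ := hw
  obtain ⟨-, m, hm⟩ := hvh
  have hll := eigen_mul hl hl' hvw.ne'
  have hlp := eigen_pos hv hl
  obtain rfl : l' = l⁻¹ := eq_inv_of_mul_eq_one_right hll
  have hmain : ∃ t > (0 : ℝ), Lor.lin h w = t • w := by
    rcases lt_trichotomy l 1 with h1 | h1 | h1
    · exact hΓ.exists_smul_of_lt_one hg hh hv hw hvw h1 hl hl' hm
    · exfalso
      have ht := hv.time_add hw hvw
      rw [h1, one_smul] at hl
      rw [h1, inv_one, one_smul] at hl'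
      exact hg1 (hΓ.eq_one_of_time hg ht.1 ht.2 (by rw [map_add, hl, hl']))
    · exact hΓ.exists_smul_of_lt_one (Γ.inv_mem hg) hh hv hw hvw (inv_lt_one_of_one_lt₀ h1)
        (eigen_inv hlp.ne' hl) (eigen_inv (inv_pos.2 hlp).ne' hl') hm
  obtain ⟨t, -, ht⟩ := hmain
  exact ⟨hw, t, ht⟩

lemma fix_eq {Γ : Subgroup Lor} (hΓ : Disc Γ)
    {g h : Lor} (hg : g ∈ Γ) (hg1 : g ≠ 1) (hh : h ∈ Γ) (hh1 : h ≠ 1) {v : V}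
    (hvg : v ∈ Fix g) (hvh : v ∈ Fix h) : Fix g = Fix h :=
  (hΓ.fix_subset hg hg1 hh hvg hvh).antisymm (hΓ.fix_subset hh hh1 hg hvh hvg)

lemma fix_three {Γ : Subgroup Lor} (hΓ : Disc Γ)
    {g : Lor} (hg : g ∈ Γ) (hg1 : g ≠ 1) {u v w : V} (hu : u ∈ Fix g) (hv : v ∈ Fix g)
    (hw : w ∈ Fix g) (huv : 0 < bil u v) (huw : 0 < bil u w) (hvw : 0 < bil v w) : False := by
  obtain ⟨hu, a, ha⟩ := hu
  obtain ⟨hv, b, hb⟩ := hv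
  obtain ⟨hw, c, hc⟩ := hw
  have h1 := eigen_mul ha hb huv.ne'
  have h2 := eigen_mul ha hc huw.ne'
  have h3 := eigen_mul hb hc hvw.ne'
  have ha0 := eigen_pos hu ha
  have hbc : b = c := mul_left_cancel₀ ha0.ne' (h1.trans h2.symm)
  have hb0 := eigen_pos hv hb
  have hb1 : b = 1 := by rw [← hbc] at h3; nlinarith
  have ha1 : a = 1 := by rwa [hb1, mul_one] at h1
  have ht := hu.time_add hv huv
  exact hg1 (hΓ.eq_one_of_time hg ht.1 ht.2 (by rw [map_add, ha, hb, ha1, hb1, one_smul, one_smul]))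

lemma fix_eq_of_preserve {Γ : Subgroup Lor} (hΓ : Disc Γ)
    {g k : Lor} (hg : g ∈ Γ) (hg1 : g ≠ 1) (hk : k ∈ Γ) (hk1 : k ≠ 1)
    (h : ∀ v ∈ Fix g, Lor.lin k v ∈ Fix g) : Fix k = Fix g := by
  obtain ⟨v, hv⟩ := Fix.nonempty hΓ hg hg1
  have hw := h v hv
  have hu := h _ hw
  by_cases hp : ∃ c > (0 : ℝ), Lor.lin k v = c • v
  · obtain ⟨c, -, hc⟩ := hp
    exact hΓ.fix_eq hk hk1 hg hg1 ⟨hv.1, c, hc⟩ hv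
  exfalso
  have hvw := hv.1.bil_pos_of hw.1 hp
  have hwu : 0 < bil (Lor.lin k v) (Lor.lin k (Lor.lin k v)) := by rwa [Lor.bil_lin]
  by_cases hq : ∃ c > (0 : ℝ), Lor.lin k (Lor.lin k v) = c • v
  · obtain ⟨c, -, hc⟩ := hq
    have h1 := Lor.bil_lin k v (Lor.lin k v)
    rw [hc, bil_smul_right, bil_comm] at h1
    have hc1 : c = 1 := mul_right_cancel₀ hvw.ne' (h1.trans (one_mul _).symm)
    rw [hc1, one_smul] at hc
    have ht := hv.1.time_add hw.1 hvw
    exact hk1 (hΓ.eq_one_of_time hk ht.1 ht.2 (by rw [map_add, hc, add_comm]))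
  · exact hΓ.fix_three hg hg1 hv hw hu hvw (hv.1.bil_pos_of hu.1 hq) hwu

/-- Elements related by an iterated commutator which vanishes have the same fixed points. -/
lemma fix_eq_of_commutator {Γ : Subgroup Lor} (hΓ : Disc Γ) {g : Lor} (hg : g ∈ Γ) (hg1 : g ≠ 1) (n : ℕ) :
    ∀ k ∈ Γ, k ≠ 1 → (fun k => g * k * g⁻¹ * k⁻¹)^[n] k = 1 → Fix k = Fix g := by
  induction n with
  | zero => exact fun k _ hk1 h => absurd h hk1
  | succ n ih =>
    intro k hk hk1 h
    rw [Function.iterate_succ_apply] at h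
    set c := g * k * g⁻¹ * k⁻¹ with hc
    have hcΓ : c ∈ Γ := Γ.mul_mem (Γ.mul_mem (Γ.mul_mem hg hk) (Γ.inv_mem hg)) (Γ.inv_mem hk)
    refine hΓ.fix_eq_of_preserve hg hg1 hk hk1 fun v hv => ?_
    by_cases hc1 : c = 1
    · rw [hc, mul_inv_eq_one, mul_inv_eq_iff_eq_mul] at hc1
      have h1 := mem_fix_conj hv k
      rwa [← hc1, mul_inv_cancel_right] at h1
    · have hcg := ih c hcΓ hc1 h
      have e1 : k * g⁻¹ * k⁻¹ = g⁻¹ * c := by rw [hc]; group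
      have h1 := mem_fix_conj (mem_fix_inv hv) k
      rw [e1] at h1
      rwa [hΓ.fix_eq (Γ.mul_mem (Γ.inv_mem hg) hcΓ) ?_ hg hg1
        (mem_fix_mul (mem_fix_inv hv) (hcg ▸ hv)) hv] at h1
      rw [← e1, Ne, mul_inv_eq_one, mul_eq_left, inv_eq_one]
      exact hg1

end Disc

/-- The size of `g` seen from the point `p`. -/
def size (p : Hyp) (g : Lor) : ℝ := ‖Lor.lin ((Hyp.frame p)⁻¹ * g * Hyp.frame p) - 1‖

lemma continuous_size (g : Lor) : Continuous fun p => size p g := by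
  unfold size
  simp only [Lor.lin_mul]
  exact (((Hyp.continuous_lin_frame_inv.mul continuous_const).mul
    Hyp.continuous_lin_frame).sub continuous_const).norm

lemma norm_one_V : ‖(1 : V →L[ℝ] V)‖ ≤ 1 := ContinuousLinearMap.norm_id_le

lemma norm_e : ‖Hyp.e.val‖ ≤ 1 := by
  rw [pi_norm_le_iff_of_nonneg zero_le_one]
  intro i; fin_cases i <;> simp [Hyp.e]

lemma cosh_dist_le_size (p : Hyp) (g : Lor) : Real.cosh (dist p (g • p)) ≤ 1 + size p g := by
  set A := (Hyp.frame p)⁻¹ * g * Hyp.frame p with hA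
  have h1 : dist p (g • p) = dist (A • Hyp.e) Hyp.e := by
    rw [Hyp.dist_eq_frame p (g • p), dist_comm, hA, mul_smul, mul_smul, Hyp.frame_smul_e]
  have h2 : ‖(Lor.lin A - 1) Hyp.e.val‖ ≤ size p g :=
    ((Lor.lin A - 1).le_opNorm _).trans (mul_le_of_le_one_right (norm_nonneg _) norm_e)
  have h3 : (A • Hyp.e).val = Hyp.e.val + (Lor.lin A - 1) Hyp.e.val := by
    rw [Lor.val_smul]; simp
  set v := (Lor.lin A - 1) Hyp.e.val
  have h4 : bil v Hyp.e = (v 0 + v 3) / 2 := by simp [bil, Hyp.e]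
  have h5 := (le_abs_self _).trans ((norm_le_pi_norm v 0).trans h2)
  have h6 := (le_abs_self _).trans ((norm_le_pi_norm v 3).trans h2)
  rw [h1, Hyp.cosh_dist, h3, bil_add_left, Hyp.e.eq, h4]
  linarith

lemma norm_inv_le {A B : V →L[ℝ] V} (h : B * A = 1) (hA : ‖A - 1‖ ≤ 1 / 2) : ‖B‖ ≤ 2 := by
  have h1 : B = 1 - B * (A - 1) := by rw [mul_sub, h, mul_one]; abel
  have h2 : ‖B‖ ≤ 1 + ‖B‖ * (1 / 2) := by
    calc ‖B‖ = ‖1 - B * (A - 1)‖ := by rw [← h1]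
      _ ≤ ‖(1 : V →L[ℝ] V)‖ + ‖B * (A - 1)‖ := norm_sub_le _ _
      _ ≤ 1 + ‖B‖ * (1 / 2) := add_le_add norm_one_V ((norm_mul_le _ _).trans (by gcongr))
  linarith

lemma size_commutator {p : Hyp} {g k : Lor} (hg : size p g ≤ 1 / 16) (hk : size p k ≤ 1 / 16) :
    size p (g * k * g⁻¹ * k⁻¹) ≤ size p k / 2 := by
  set T := Hyp.frame p
  set A := T⁻¹ * g * T with hA
  set B := T⁻¹ * k * T with hB
  have h1 : T⁻¹ * (g * k * g⁻¹ * k⁻¹) * T = A * B * A⁻¹ * B⁻¹ := by rw [hA, hB]; group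
  have hgA : size p g = ‖Lor.lin A - 1‖ := rfl
  have hkB : size p k = ‖Lor.lin B - 1‖ := rfl
  have h2 : Lor.lin (A * B * A⁻¹ * B⁻¹) - 1 =
      ((Lor.lin A - 1) * (Lor.lin B - 1) - (Lor.lin B - 1) * (Lor.lin A - 1)) *
        (Lor.lin A⁻¹ * Lor.lin B⁻¹) := by
    have e1 : (Lor.lin A - 1) * (Lor.lin B - 1) - (Lor.lin B - 1) * (Lor.lin A - 1) =
        Lor.lin A * Lor.lin B - Lor.lin B * Lor.lin A := by
      simp only [sub_mul, mul_sub, one_mul, mul_one]; abel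
    have e2 : Lor.lin B * Lor.lin A * (Lor.lin A⁻¹ * Lor.lin B⁻¹) = 1 := by
      rw [mul_assoc, ← mul_assoc (Lor.lin A), Lor.lin_mul_inv, one_mul, Lor.lin_mul_inv]
    rw [e1, sub_mul, e2]
    simp only [Lor.lin_mul, mul_assoc]
  have hA2 : ‖Lor.lin A⁻¹‖ ≤ 2 := norm_inv_le (Lor.lin_inv_mul A) (by linarith)
  have hB2 : ‖Lor.lin B⁻¹‖ ≤ 2 := norm_inv_le (Lor.lin_inv_mul B) (by linarith)
  change ‖Lor.lin (T⁻¹ * (g * k * g⁻¹ * k⁻¹) * T) - 1‖ ≤ _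
  rw [h1, h2, hkB]
  rw [hgA] at hg
  have h3 : ‖(Lor.lin A - 1) * (Lor.lin B - 1) - (Lor.lin B - 1) * (Lor.lin A - 1)‖ ≤
      1 / 16 * ‖Lor.lin B - 1‖ + ‖Lor.lin B - 1‖ * (1 / 16) :=
    (norm_sub_le _ _).trans (add_le_add ((norm_mul_le _ _).trans (by gcongr))
      ((norm_mul_le _ _).trans (by gcongr)))
  have h4 : ‖Lor.lin A⁻¹ * Lor.lin B⁻¹‖ ≤ 2 * 2 := (norm_mul_le _ _).trans (by gcongr)
  calc _ ≤ _ := norm_mul_le _ _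
    _ ≤ (1 / 16 * ‖Lor.lin B - 1‖ + ‖Lor.lin B - 1‖ * (1 / 16)) * (2 * 2) := by gcongr
    _ = _ := by ring

/-- Small elements at a common point have the same fixed points. -/
lemma Disc.fix_eq_of_size {Γ : Subgroup Lor} (hΓ : Disc Γ) {p : Hyp} {g k : Lor} (hg : g ∈ Γ)
    (hg1 : g ≠ 1) (hk : k ∈ Γ) (hk1 : k ≠ 1) (hgs : size p g ≤ 1 / 16) (hks : size p k ≤ 1 / 16) :
    Fix k = Fix g := by
  obtain ⟨ε, hε, h⟩ := hΓ p
  set F : Lor → Lor := fun k => g * k * g⁻¹ * k⁻¹ with hF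
  have hmem : ∀ n, F^[n] k ∈ Γ ∧ size p (F^[n] k) ≤ 1 / 16 * (1 / 2) ^ n := by
    intro n
    induction n with
    | zero => exact ⟨hk, by simpa using hks⟩
    | succ n ih =>
      rw [Function.iterate_succ_apply']
      refine ⟨Γ.mul_mem (Γ.mul_mem (Γ.mul_mem hg ih.1) (Γ.inv_mem hg)) (Γ.inv_mem ih.1), ?_⟩
      have h1 : ((1 : ℝ) / 2) ^ n ≤ 1 := pow_le_one₀ (by norm_num) (by norm_num)
      have := size_commutator hgs (ih.2.trans (by linarith))
      rw [pow_succ]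
      linarith [ih.2]
  have hc : 0 < Real.cosh ε - 1 := by linarith [Real.one_lt_cosh.2 hε.ne']
  obtain ⟨n, hn⟩ := exists_pow_lt_of_lt_one hc (show (1 / 2 : ℝ) < 1 by norm_num)
  refine hΓ.fix_eq_of_commutator hg hg1 n k hk hk1 ?_
  by_contra hne
  have h1 := h _ (hmem n).1 hne
  have h2 := cosh_dist_le_size p (F^[n] k)
  have h3 : Real.cosh ε ≤ Real.cosh (dist p (F^[n] k • p)) := by
    rw [Real.cosh_le_cosh, abs_of_pos hε, abs_of_nonneg dist_nonneg]; exact h1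
  have h4 : (0 : ℝ) < (1 / 2) ^ n := by positivity
  linarith [(hmem n).2]

end HypArc

namespace HypArc

lemma norm_lin_le {A : Lor} (h : dist (A • Hyp.e) Hyp.e ≤ 1) : ‖Lor.lin A‖ ≤ 200 := by
  have hexp : Real.exp 1 ≤ 3 := by have := Real.exp_one_lt_d9; linarith
  have key : ∀ r : Hyp, ∀ c : ℝ, Real.exp (dist r Hyp.e) ≤ c → ‖r.val‖ ≤ c := by
    intro r c hc
    have h1 := Hyp.norm_sub_e_le r
    have h2 : ‖r.val‖ ≤ ‖r.val - Hyp.e.val‖ + ‖Hyp.e.val‖ := by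
      have := norm_add_le (r.val - Hyp.e.val) Hyp.e.val
      rwa [sub_add_cancel] at this
    linarith [norm_e]
  have hAe : ‖Lor.lin A Hyp.e.val‖ ≤ 3 := by
    rw [← Lor.val_smul]
    exact key _ _ ((Real.exp_le_exp.2 h).trans hexp)
  refine ContinuousLinearMap.opNorm_le_of_unit_norm (by norm_num) fun v hv => ?_
  set w : V := v + (3 : ℝ) • Hyp.e.val with hw
  have hvi : ∀ i, |v i| ≤ 1 := fun i => by
    have := norm_le_pi_norm v i
    rwa [hv] at this
  have h0 := abs_le.1 (hvi 0)
  have h1 := abs_le.1 (hvi 1)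
  have h2 := abs_le.1 (hvi 2)
  have h3 := abs_le.1 (hvi 3)
  have w0 : w 0 = v 0 + 3 := by
    change v 0 + 3 * 1 = _; norm_num
  have w1 : w 1 = v 1 := by
    change v 1 + 3 * 0 = _; norm_num
  have w2 : w 2 = v 2 := by
    change v 2 + 3 * 0 = _; norm_num
  have w3 : w 3 = v 3 + 3 := by
    change v 3 + 3 * 1 = _; norm_num
  have hb : bil w w = (v 0 + 3) * (v 3 + 3) - v 1 ^ 2 - v 2 ^ 2 := by
    unfold bil; rw [w0, w1, w2, w3]; ring
  have hb1 : 1 ≤ bil w w := by rw [hb]; nlinarith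
  have hb2 : bil w w ≤ 16 := by rw [hb]; nlinarith
  have hs := Real.sq_sqrt (zero_le_one.trans hb1)
  have hs1 : 1 ≤ √(bil w w) := Real.one_le_sqrt.2 hb1
  have hs2 : √(bil w w) ≤ 4 := by
    rw [Real.sqrt_le_left (by norm_num)]; linarith
  set q : Hyp := Hyp.proj w (by linarith) (by rw [w0, w3]; linarith) with hq
  have hqv : w = √(bil w w) • q.val := by
    change w = √(bil w w) • ((√(bil w w))⁻¹ • w)
    rw [smul_smul, mul_inv_cancel₀ (by linarith), one_smul]
  have hqe : Real.cosh (dist q Hyp.e) ≤ 4 := by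
    have h4 : √(bil w w) * bil q Hyp.e = (w 0 + w 3) / 2 := by
      rw [← bil_smul_left, ← hqv]; simp [bil, Hyp.e]
    rw [w0, w3] at h4
    rw [Hyp.cosh_dist]
    nlinarith [Hyp.one_le_bil q Hyp.e]
  have hexq : Real.exp (dist q Hyp.e) ≤ 8 := by
    have := Real.exp_pos (-dist q Hyp.e)
    rw [Real.cosh_eq] at hqe
    linarith
  have hr : ‖Lor.lin A q.val‖ ≤ 24 := by
    rw [← Lor.val_smul]
    refine key _ _ ?_
    have : dist (A • q) Hyp.e ≤ dist q Hyp.e + 1 := by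
      have := dist_triangle (A • q) (A • Hyp.e) Hyp.e
      rw [dist_smul] at this
      linarith
    calc Real.exp (dist (A • q) Hyp.e) ≤ Real.exp (dist q Hyp.e + 1) := Real.exp_le_exp.2 this
      _ = Real.exp (dist q Hyp.e) * Real.exp 1 := Real.exp_add _ _
      _ ≤ 8 * 3 := by gcongr
      _ = 24 := by norm_num
  have hv' : v = √(bil w w) • q.val - (3 : ℝ) • Hyp.e.val := by rw [← hqv, hw, add_sub_cancel_right]
  rw [hv', map_sub, map_smul, map_smul]
  refine (norm_sub_le _ _).trans ?_
  rw [norm_smul, norm_smul, Real.norm_of_nonneg (by linarith), Real.norm_of_nonneg (by norm_num)]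
  have := mul_le_mul hs2 hr (norm_nonneg _) (by norm_num)
  linarith

lemma dist_pow_smul_le (g : Lor) (p : Hyp) (k : ℕ) : dist (g ^ k • p) p ≤ k * dist (g • p) p := by
  induction k with
  | zero => simp
  | succ k ih =>
    have h := dist_triangle (g ^ (k + 1) • p) (g ^ k • p) p
    rw [pow_succ, mul_smul, dist_smul] at h
    rw [pow_succ, mul_smul]
    push_cast
    linarith

lemma exists_pow_small {η : ℝ} (hη : 0 < η) : ∃ δ > (0 : ℝ), ∀ A : Lor, dist (A • Hyp.e) Hyp.e < δ →
    ∃ k : ℕ, k ≠ 0 ∧ ‖Lor.lin (A ^ k) - 1‖ < η := by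
  have hfd : ProperSpace (V →L[ℝ] V) := FiniteDimensional.proper ℝ _
  have htb := (isCompact_closedBall (0 : V →L[ℝ] V) 200).totallyBounded
  obtain ⟨t, ht, hcov⟩ := Metric.totallyBounded_iff.1 htb (η / 400) (by positivity)
  refine ⟨1 / (ht.toFinset.card + 1), by positivity, fun A hA => ?_⟩
  set N := ht.toFinset.card with hN
  have hd : ∀ i ∈ Finset.range (N + 1), dist (A ^ i • Hyp.e) Hyp.e ≤ 1 := by
    intro i hi
    have h1 : (i : ℝ) ≤ N + 1 := by exact_mod_cast (Finset.mem_range.1 hi).le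
    rw [lt_div_iff₀ (by positivity)] at hA
    have := mul_le_mul_of_nonneg_right h1 (dist_nonneg (x := A • Hyp.e) (y := Hyp.e))
    linarith [dist_pow_smul_le A Hyp.e i]
  have hc : ∀ i ∈ Finset.range (N + 1), ∃ c ∈ ht.toFinset, Lor.lin (A ^ i) ∈ ball c (η / 400) := by
    intro i hi
    have := hcov (mem_closedBall_zero_iff.2 (norm_lin_le (hd i hi)))
    simpa using this
  choose! c hct hcb using hc
  obtain ⟨i, hi, j, hj, hij, hcc⟩ := Finset.exists_ne_map_eq_of_card_lt_of_maps_to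
    (by rw [Finset.card_range]; exact Nat.lt_succ_self _) (fun i hi => hct i hi)
  wlog hlt : i < j generalizing i j
  · exact this j hj i hi hij.symm hcc.symm (lt_of_le_of_ne (not_lt.1 hlt) hij.symm)
  refine ⟨j - i, by omega, ?_⟩
  have h1 : Lor.lin (A ^ (j - i)) - 1 = Lor.lin (A ^ i)⁻¹ * (Lor.lin (A ^ j) - Lor.lin (A ^ i)) := by
    rw [mul_sub, Lor.lin_inv_mul, ← Lor.lin_mul]
    congr 2
    rw [eq_inv_mul_iff_mul_eq, ← pow_add]
    congr 1; omega
  have h2 : ‖Lor.lin (A ^ i)⁻¹‖ ≤ 200 := by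
    apply norm_lin_le
    have := hd i hi
    rwa [← dist_smul (A ^ i), smul_inv_smul, dist_comm]
  have h3 : ‖Lor.lin (A ^ j) - Lor.lin (A ^ i)‖ < η / 400 + η / 400 := by
    rw [← dist_eq_norm]
    have hbi := mem_ball.1 (hcb i hi)
    rw [hcc, dist_comm] at hbi
    exact (dist_triangle _ _ _).trans_lt (add_lt_add (mem_ball.1 (hcb j hj)) hbi)
  rw [h1]
  calc _ ≤ ‖Lor.lin (A ^ i)⁻¹‖ * ‖Lor.lin (A ^ j) - Lor.lin (A ^ i)‖ := norm_mul_le _ _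
    _ ≤ 200 * ‖Lor.lin (A ^ j) - Lor.lin (A ^ i)‖ := by gcongr
    _ < 200 * (η / 400 + η / 400) := by gcongr
    _ = η := by ring

lemma Disc.exists_size_lt {Γ : Subgroup Lor} (hΓ : Disc Γ) {η : ℝ} (hη : 0 < η) :
    ∃ δ > (0 : ℝ), ∀ p : Hyp, ∀ g ∈ Γ, g ≠ 1 → dist p (g • p) < δ →
      ∃ k ∈ Γ, k ≠ 1 ∧ size p k < η := by
  obtain ⟨δ, hδ, h⟩ := exists_pow_small hη
  refine ⟨δ, hδ, fun p g hg hg1 hd => ?_⟩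
  obtain ⟨k, hk, hs⟩ := h ((Hyp.frame p)⁻¹ * g * Hyp.frame p) (by
    rw [mul_smul, mul_smul, Hyp.frame_smul_e, dist_comm, ← Hyp.dist_eq_frame]; exact hd)
  refine ⟨g ^ k, Γ.pow_mem hg k, hΓ.pow_ne_one hg hg1 hk, ?_⟩
  have := conj_pow (i := k) (a := (Hyp.frame p)⁻¹) (b := g)
  rw [inv_inv] at this
  rwa [this] at hs

lemma HypLike.exists_compact_size {X : Type*} [MetricSpace X] [CompleteSpace X] [MeasurableSpace X]
    [BorelSpace X] (hX : HypLike X) {ψ : Hyp → X} (h : LocIso ψ univ)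
    (hfin : μH[3] (univ : Set X) < ⊤) {η : ℝ} (hη : 0 < η) :
    ∃ K : Set X, IsCompact K ∧ ∀ y, ψ y ∉ K → ∃ g ∈ deck ψ, g ≠ 1 ∧ size y g < η := by
  obtain ⟨δ, hδ, hd⟩ := Disc.exists_size_lt (Γ := deck ψ) (fun y => h.deck_displacement y) hη
  obtain ⟨K, hK, hKy⟩ := hX.exists_compact_thick h hfin (half_pos hδ)
  refine ⟨K, hK, fun y hy => ?_⟩
  obtain ⟨g, hg, hg1, hgd⟩ := hKy y hy
  exact hd y g hg hg1 (by linarith)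

end HypArc

namespace HypArc
open Filter Topology

lemma eq_zero_of_bil {w : V} (b : Hyp) (h1 : bil w b = 0) (h2 : bil w w = 0) : w = 0 := by
  refine bil_nondeg fun v => ?_
  have h := Hyp.bil_cauchy b w v
  rw [h1, h2] at h
  have : (bil w v) ^ 2 ≤ 0 := by linarith
  exact pow_eq_zero_iff two_ne_zero |>.1 (le_antisymm this (sq_nonneg _))

lemma Hyp.sinh_smul_eq {a b c : Hyp} {s t : ℝ} (hst : 0 < s + t)
    (hac : dist a c = s) (hcb : dist c b = t) (hab : dist a b = s + t) :
    c.val = (Real.sinh (s + t))⁻¹ • (Real.sinh t • a.val + Real.sinh s • b.val) := by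
  have hS : 0 < Real.sinh (s + t) := Real.sinh_pos_iff.2 hst
  have e1 : bil a c = Real.cosh s := by rw [← Hyp.cosh_dist, hac]
  have e2 : bil c b = Real.cosh t := by rw [← Hyp.cosh_dist, hcb]
  have e3 : bil a b = Real.cosh (s + t) := by rw [← Hyp.cosh_dist, hab]
  have e4 : bil c a = Real.cosh s := by rw [bil_comm, e1]
  have e5 : bil b c = Real.cosh t := by rw [bil_comm, e2]
  have e6 : bil b a = Real.cosh (s + t) := by rw [bil_comm, e3]
  have h : Real.sinh (s + t) • c.val - (Real.sinh t • a.val + Real.sinh s • b.val) = 0 := by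
    refine eq_zero_of_bil c ?_ ?_
    · simp only [bil_sub_left, bil_add_left, bil_smul_left, e1, e5, c.eq]
      rw [Real.sinh_add]; ring
    · simp only [bil_sub_left, bil_add_left, bil_smul_left, bil_sub_right, bil_add_right,
        bil_smul_right, e1, e2, e3, e4, e5, e6, a.eq, b.eq, c.eq]
      rw [Real.sinh_add, Real.cosh_add]
      have h1 := Real.cosh_sq s
      have h2 := Real.cosh_sq t
      ring_nf
      rw [h1, h2]
      ring
  rw [← sub_eq_zero.1 h, smul_smul, inv_mul_cancel₀ hS.ne', one_smul]

lemma exists_exp_of_local {f : ℝ → V} (h : ∀ t, ∃ P Q : V, ∀ᶠ s in 𝓝 t,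
    f s = Real.exp s • P + Real.exp (-s) • Q) :
    ∃ P Q : V, ∀ s, f s = Real.exp s • P + Real.exp (-s) • Q := by
  have hder : ∀ (P Q : V) (s : ℝ), HasDerivAt (fun s => Real.exp s • P + Real.exp (-s) • Q)
      (Real.exp s • P + (Real.exp (-s) * -1) • Q) s := fun P Q s =>
    ((Real.hasDerivAt_exp s).smul_const P).add ((hasDerivAt_neg s).exp.smul_const Q)
  have hloc : ∀ t, ∃ P Q : V, ∀ᶠ s in 𝓝 t, Real.exp (-s) • ((1 / 2 : ℝ) • (f s + deriv f s)) = P ∧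
      Real.exp s • ((1 / 2 : ℝ) • (f s - deriv f s)) = Q := by
    intro t
    obtain ⟨P, Q, hPQ⟩ := h t
    refine ⟨P, Q, ?_⟩
    filter_upwards [hPQ.eventually_nhds] with s hs
    have hd : deriv f s = Real.exp s • P + (Real.exp (-s) * -1) • Q :=
      ((hder P Q s).congr_of_eventuallyEq hs).deriv
    rw [hd, hs.self_of_nhds]
    have h1 : Real.exp (-s) * Real.exp s = 1 := by rw [← Real.exp_add]; simp
    constructor <;> ext i <;> simp only [Pi.smul_apply, Pi.add_apply, Pi.sub_apply, smul_eq_mul]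
    · linear_combination (P i) * h1
    · linear_combination (Q i) * h1
  set A : ℝ → V := fun s => Real.exp (-s) • ((1 / 2 : ℝ) • (f s + deriv f s)) with hAdef
  set B : ℝ → V := fun s => Real.exp s • ((1 / 2 : ℝ) • (f s - deriv f s)) with hBdef
  have hA : IsLocallyConstant A := by
    rw [IsLocallyConstant.iff_eventually_eq]
    intro t
    obtain ⟨P, Q, hPQ⟩ := hloc t
    filter_upwards [hPQ] with s hs
    exact hs.1.trans hPQ.self_of_nhds.1.symm
  have hB : IsLocallyConstant B := by
    rw [IsLocallyConstant.iff_eventually_eq]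
    intro t
    obtain ⟨P, Q, hPQ⟩ := hloc t
    filter_upwards [hPQ] with s hs
    exact hs.2.trans hPQ.self_of_nhds.2.symm
  refine ⟨A 0, B 0, fun s => ?_⟩
  rw [hA.apply_eq_of_preconnectedSpace 0 s, hB.apply_eq_of_preconnectedSpace 0 s]
  have h1 : Real.exp s * Real.exp (-s) = 1 := by rw [← Real.exp_add]; simp
  ext i
  simp only [hAdef, hBdef, Pi.smul_apply, Pi.add_apply, Pi.sub_apply, smul_eq_mul]
  linear_combination (-(f s i)) * h1

lemma exists_exp_of_geodesic {G : ℝ → Hyp} (h : ∀ t, ∃ ε > (0 : ℝ), ∀ s₁ ∈ Icc (t - ε) (t + ε),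
    ∀ s₂ ∈ Icc (t - ε) (t + ε), dist (G s₁) (G s₂) = |s₁ - s₂|) :
    ∃ P Q : V, ∀ s, (G s).val = Real.exp s • P + Real.exp (-s) • Q := by
  refine exists_exp_of_local fun t => ?_
  obtain ⟨ε, hε, hd⟩ := h t
  set a := G (t - ε)
  set b := G (t + ε)
  set S := (Real.sinh (ε + ε))⁻¹
  refine ⟨(S * 2⁻¹ * -Real.exp (-(t + ε))) • a.val + (S * 2⁻¹ * Real.exp (-(t - ε))) • b.val,
    (S * 2⁻¹ * Real.exp (t + ε)) • a.val + (S * 2⁻¹ * -Real.exp (t - ε)) • b.val, ?_⟩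
  filter_upwards [Icc_mem_nhds (by linarith : t - ε < t) (by linarith : t < t + ε)] with s hs
  have hl : t - ε ∈ Icc (t - ε) (t + ε) := left_mem_Icc.2 (by linarith)
  have hr : t + ε ∈ Icc (t - ε) (t + ε) := right_mem_Icc.2 (by linarith)
  have h1 := Hyp.sinh_smul_eq (a := a) (b := b) (c := G s) (s := s - (t - ε)) (t := t + ε - s)
    (by linarith)
    (by rw [hd _ hl _ hs, abs_sub_comm, abs_of_nonneg (by linarith [hs.1])])
    (by rw [hd _ hs _ hr, abs_sub_comm, abs_of_nonneg (by linarith [hs.2])])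
    (by rw [hd _ hl _ hr, abs_sub_comm, abs_of_nonneg (by linarith)]; ring)
  rw [h1, show s - (t - ε) + (t + ε - s) = ε + ε by ring, Real.sinh_eq (t + ε - s),
    Real.sinh_eq (s - (t - ε))]
  have e1 : Real.exp (t + ε - s) = Real.exp (t + ε) * Real.exp (-s) := by
    rw [← Real.exp_add]; rfl
  have e2 : Real.exp (-(t + ε - s)) = Real.exp (-(t + ε)) * Real.exp s := by
    rw [← Real.exp_add]; ring_nf
  have e3 : Real.exp (s - (t - ε)) = Real.exp (-(t - ε)) * Real.exp s := by
    rw [← Real.exp_add]; ring_nf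
  have e4 : Real.exp (-(s - (t - ε))) = Real.exp (t - ε) * Real.exp (-s) := by
    rw [← Real.exp_add]; ring_nf
  rw [e1, e2, e3, e4]
  ext i
  simp only [Pi.smul_apply, Pi.add_apply, smul_eq_mul]
  ring

/-- The ends of the geodesic `s ↦ exp s • P + exp (-s) • Q`. -/
lemma exp_ends {G : ℝ → Hyp} {P Q : V}
    (h : ∀ s, (G s).val = Real.exp s • P + Real.exp (-s) • Q) :
    Null P ∧ Null Q ∧ bil P Q = 1 / 2 := by
  have hk : ∀ k : ℝ, 0 < k → (G (Real.log k)).val = k • P + k⁻¹ • Q := fun k hk => by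
    rw [h, Real.exp_neg, Real.exp_log hk]
  have key : ∀ k : ℝ, 0 < k → k * (k * bil P P) + 2 * bil P Q + k⁻¹ * (k⁻¹ * bil Q Q) = 1 := by
    intro k hk0
    have h1 := (G (Real.log k)).eq
    rw [hk k hk0] at h1
    simp only [bil_add_left, bil_add_right, bil_smul_left, bil_smul_right, bil_comm Q P] at h1
    have h2 : k * k⁻¹ = 1 := mul_inv_cancel₀ hk0.ne'
    linear_combination h1 - 2 * bil P Q * h2
  have k1 := key 1 one_pos
  have k2 := key 2 two_pos
  have k3 := key 3 three_pos
  norm_num at k1 k2 k3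
  have hPP : bil P P = 0 := by linarith
  have hQQ : bil Q Q = 0 := by linarith
  have hPQ : bil P Q = 1 / 2 := by linarith
  have pos : ∀ P Q : V, bil P P = 0 → bil P Q = 1 / 2 →
      (∀ k : ℝ, 0 < k → 0 < k * bil P Hyp.e + k⁻¹ * bil Q Hyp.e) → Null P := by
    intro P Q hPP hPQ hpos
    have hne : bil P Hyp.e ≠ 0 := fun h0 => by
      rw [eq_zero_of_bil Hyp.e h0 hPP, bil_zero_left] at hPQ
      norm_num at hPQ
    have hge : 0 ≤ bil P Hyp.e := by
      by_contra! hlt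
      set m := -bil P Hyp.e with hm
      have hm0 : 0 < m := by linarith
      have hk0 : 1 ≤ 1 + |bil Q Hyp.e| / m := by
        have : 0 ≤ |bil Q Hyp.e| / m := by positivity
        linarith
      set k := 1 + |bil Q Hyp.e| / m with hkdef
      have h1 := hpos k (by linarith)
      have h2 : k * m = m + |bil Q Hyp.e| := by rw [hkdef]; field_simp
      have h3 : k⁻¹ ≤ 1 := inv_le_one_of_one_le₀ hk0
      have h4 : k⁻¹ * bil Q Hyp.e ≤ |bil Q Hyp.e| := by
        calc k⁻¹ * bil Q Hyp.e ≤ k⁻¹ * |bil Q Hyp.e| := by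
              gcongr; exact le_abs_self _
          _ ≤ 1 * |bil Q Hyp.e| := by gcongr
          _ = _ := one_mul _
      have h5 : k * bil P Hyp.e = -(k * m) := by rw [hm]; ring
      linarith
    refine ⟨hPP, ?_⟩
    have := hge.lt_of_ne hne.symm
    have h2 : bil P Hyp.e = (P 0 + P 3) / 2 := by simp [bil, Hyp.e]
    linarith
  have hb : ∀ k : ℝ, 0 < k → 0 < k * bil P Hyp.e + k⁻¹ * bil Q Hyp.e := by
    intro k hk0
    rw [← bil_smul_left, ← bil_smul_left, ← bil_add_left, ← hk k hk0]
    linarith [Hyp.one_le_bil (G (Real.log k)) Hyp.e]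
  refine ⟨pos P Q hPP hPQ hb, pos Q P hQQ (by rw [bil_comm, hPQ]) fun k hk0 => ?_, hPQ⟩
  have := hb k⁻¹ (inv_pos.2 hk0)
  rw [inv_inv] at this
  linarith

lemma eigen_sub_one_le_size {g : Lor} {n : V} {l : ℝ} (p : Hyp) (hn : Null n)
    (h : Lor.lin g n = l • n) : |l - 1| ≤ size p g := by
  set w := Lor.lin (Hyp.frame p)⁻¹ n with hw
  have hw0 : 0 < ‖w‖ := norm_pos_iff.2 fun h0 => by
    have := (hn.lin (Hyp.frame p)⁻¹).2
    rw [← hw, h0] at this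
    simp at this
  have h1 : (Lor.lin ((Hyp.frame p)⁻¹ * g * Hyp.frame p) - 1) w = (l - 1) • w := by
    change Lor.lin ((Hyp.frame p)⁻¹ * g * Hyp.frame p) w - w = _
    rw [Lor.lin_mul_apply, Lor.lin_mul_apply, hw, Lor.lin_lin_inv, h, map_smul, sub_smul, one_smul]
  have h2 := ContinuousLinearMap.le_opNorm (Lor.lin ((Hyp.frame p)⁻¹ * g * Hyp.frame p) - 1) w
  rw [h1, norm_smul] at h2
  exact le_of_mul_le_mul_right h2 hw0

/-- A nontrivial element of size at most `η` at a point `p` that fixes `n` has small displacement at all points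
of the geodesic ray from `p` to `n`. -/
lemma cosh_dist_proj_le {g : Lor} {n : V} {p : Hyp} {η c : ℝ} (hη : η ≤ 1 / 2) (hn : n ∈ Fix g)
    (hs : size p g ≤ η) (hc : 0 < c) (h : 0 < bil (c • p.val + n) (c • p.val + n))
    (h' : 0 < (c • p.val + n) 0 + (c • p.val + n) 3) :
    Real.cosh (dist (Hyp.proj _ h h') (g • Hyp.proj _ h h')) ≤ 1 + η := by
  obtain ⟨hnn, l, hl⟩ := hn
  have hlp := eigen_pos hnn hl
  have hl1 := abs_le.1 ((eigen_sub_one_le_size p hnn hl).trans hs)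
  have hη0 : 0 ≤ η := (norm_nonneg _).trans hs
  have hC := (cosh_dist_le_size p g).trans (add_le_add_right hs 1)
  rw [Hyp.cosh_dist, Lor.val_smul] at hC ⊢
  simp only [Hyp.proj, map_smul, bil_smul_left, bil_smul_right]
  have hlinv : Lor.lin g⁻¹ n = l⁻¹ • n := eigen_inv hlp.ne' hl
  have hb : 0 < bil p.val n := by rw [bil_comm]; exact hnn.cone.bil_hyp_pos p
  have e1 : bil n (Lor.lin g p.val) = l⁻¹ * bil p.val n := by
    rw [bil_comm, Lor.bil_lin_left, hlinv, bil_smul_right]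
  have hzz : bil (c • p.val + n) (c • p.val + n) = c * c + 2 * (c * bil p.val n) := by
    simp only [bil_add_left, bil_add_right, bil_smul_left, bil_smul_right, p.eq, hnn.1,
      bil_comm n p.val]
    ring
  have hzg : bil (c • p.val + n) (Lor.lin g (c • p.val + n)) =
      c * c * bil p.val (Lor.lin g p.val) + c * bil p.val n * (l + l⁻¹) := by
    simp only [map_add, map_smul, hl, bil_add_left, bil_add_right, bil_smul_left, bil_smul_right,
      hnn.1, e1]
    ring
  have hll : l + l⁻¹ ≤ 2 + 2 * η := by
    have h1 : l * l⁻¹ = 1 := mul_inv_cancel₀ hlp.ne'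
    have h2 : 0 < l⁻¹ := inv_pos.2 hlp
    have h3 : l⁻¹ ≤ 2 := by rw [inv_le_comm₀ hlp two_pos]; linarith
    have h4 : l + l⁻¹ - 2 = (l - 1) ^ 2 * l⁻¹ := by linear_combination (2 - l) * h1
    have h5 : (l - 1) ^ 2 ≤ η := by nlinarith
    nlinarith [mul_le_mul h5 h3 h2.le hη0]
  have hsq := Real.sq_sqrt h.le
  have hsp := Real.sqrt_pos.2 h
  rw [← mul_assoc, ← mul_inv, ← sq, hsq, inv_mul_le_iff₀ h, hzg, hzz]
  have := mul_le_mul_of_nonneg_left hll (mul_pos hc hb).le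
  have := mul_le_mul_of_nonneg_left hC (mul_pos hc hc).le
  linarith

lemma Disc.bil_end_eq_zero {Γ : Subgroup Lor} (hΓ : Disc Γ) {G : ℝ → Hyp} {P Q n : V}
    (hG : ∀ s, (G s).val = Real.exp s • P + Real.exp (-s) • Q) (hn : Null n)
    (h : ∀ η > (0 : ℝ), ∀ᶠ u in atTop, ∃ g ∈ Γ, g ≠ 1 ∧ n ∈ Fix g ∧ size (G u) g < η) :
    bil P n = 0 := by
  obtain ⟨hP, -, -⟩ := exp_ends hG
  by_contra hne
  have hb : 0 < bil P n := (hP.cone.bil_nonneg hn.cone).lt_of_ne' hne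
  have hy : ∀ u, Real.exp (-u) • (G u).val + n = (P + n) + (Real.exp (-u) * Real.exp (-u)) • Q := by
    intro u
    rw [hG, smul_add, smul_smul, smul_smul, ← Real.exp_add, neg_add_cancel, Real.exp_zero, one_smul]
    abel
  have hpos : ∀ u, 0 < bil (Real.exp (-u) • (G u).val + n) (Real.exp (-u) • (G u).val + n) := by
    intro u
    have := mul_pos (Real.exp_pos (-u)) (hn.cone.bil_hyp_pos (G u))
    simp only [bil_add_left, bil_add_right, bil_smul_left, bil_smul_right, (G u).eq, hn.1,
      bil_comm (G u).val n]
    have := mul_pos (Real.exp_pos (-u)) (Real.exp_pos (-u))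
    linarith
  have hpos' : ∀ u, 0 < (Real.exp (-u) • (G u).val + n) 0 + (Real.exp (-u) • (G u).val + n) 3 := by
    intro u
    have := mul_pos (Real.exp_pos (-u)) (G u).cone.2
    have := hn.2
    simp only [Pi.add_apply, Pi.smul_apply, smul_eq_mul]
    linarith
  obtain ⟨h1, h2⟩ := hP.time_add hn hb
  set z : ℝ → Hyp := fun u => Hyp.proj _ (hpos u) (hpos' u) with hz
  set w : Hyp := Hyp.proj _ h1 h2 with hw
  have hv : Tendsto (fun u => Real.exp (-u) • (G u).val + n) atTop (𝓝 (P + n)) := by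
    simp only [hy]
    have := Real.tendsto_exp_neg_atTop_nhds_zero
    have := ((this.mul this).smul_const Q).const_add (P + n)
    simpa using this
  have hzw : Tendsto z atTop (𝓝 w) := by
    rw [Hyp.isInducing_val.tendsto_nhds_iff]
    have hc : Tendsto (fun v : V => (√(bil v v))⁻¹ • v) (𝓝 (P + n))
        (𝓝 ((√(bil (P + n) (P + n)))⁻¹ • (P + n))) := by
      have hsq : ContinuousAt (fun v : V => √(bil v v)) (P + n) :=
        (Real.continuous_sqrt.comp (Continuous.bil continuous_id continuous_id)).continuousAt
      exact (hsq.inv₀ (Real.sqrt_pos.2 h1).ne').smul continuousAt_id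
    exact hc.comp hv
  obtain ⟨ε, hε, hd⟩ := hΓ w
  have hch : 1 < Real.cosh (ε / 2) := Real.one_lt_cosh.2 (half_pos hε).ne'
  set η := min (1 / 2) (Real.cosh (ε / 2) - 1) with hη
  have hη0 : 0 < η := lt_min (by norm_num) (by linarith)
  obtain ⟨u, ⟨g, hg, hg1, hgn, hgs⟩, hu⟩ :=
    ((h η hη0).and (hzw.eventually (ball_mem_nhds w (by linarith : 0 < ε / 4)))).exists
  have h3 := cosh_dist_proj_le (min_le_left _ _) hgn hgs.le (Real.exp_pos (-u)) (hpos u) (hpos' u)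
  have h4 : Real.cosh (dist (z u) (g • z u)) ≤ Real.cosh (ε / 2) :=
    h3.trans (by linarith [min_le_right (1 / 2) (Real.cosh (ε / 2) - 1)])
  rw [Real.cosh_le_cosh, abs_of_nonneg dist_nonneg, abs_of_pos (half_pos hε)] at h4
  have h5 := hd g hg hg1
  have h6 := dist_triangle4 w (z u) (g • z u) (g • w)
  have h7 : dist (z u) w < ε / 4 := hu
  rw [dist_smul, dist_comm w (z u)] at h6
  linarith

lemma Disc.not_cuspidal_geodesic {Γ : Subgroup Lor} (hΓ : Disc Γ) {G : ℝ → Hyp}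
    (hG : ∀ t, ∃ ε > (0 : ℝ), ∀ s₁ ∈ Icc (t - ε) (t + ε), ∀ s₂ ∈ Icc (t - ε) (t + ε),
      dist (G s₁) (G s₂) = |s₁ - s₂|) {n : V} (hn : Null n)
    (h : ∀ η > (0 : ℝ), ∃ R : ℝ, ∀ u, R ≤ |u| → ∃ g ∈ Γ, g ≠ 1 ∧ n ∈ Fix g ∧ size (G u) g < η) :
    False := by
  obtain ⟨P, Q, hPQ⟩ := exists_exp_of_geodesic hG
  obtain ⟨hP, hQ, hb⟩ := exp_ends hPQ
  have h1 : bil P n = 0 := hΓ.bil_end_eq_zero hPQ hn fun η hη => by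
    obtain ⟨R, hR⟩ := h η hη
    filter_upwards [eventually_ge_atTop R] with u hu
    exact hR u (hu.trans (le_abs_self u))
  have h2 : bil Q n = 0 := by
    refine hΓ.bil_end_eq_zero (G := fun u => G (-u)) (P := Q) (Q := P)
      (fun s => by rw [hPQ, neg_neg, add_comm]) hn fun η hη => ?_
    obtain ⟨R, hR⟩ := h η hη
    filter_upwards [eventually_ge_atTop R] with u hu
    exact hR (-u) (by rw [abs_neg]; exact hu.trans (le_abs_self u))
  obtain ⟨c, hc, rfl⟩ := hP.eq_smul hn h1
  rw [bil_smul_right, bil_comm Q P, hb] at h2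
  linarith

end HypArc

namespace HypArc
open Filter Topology

lemma Disc.exists_common_fix {Γ : Subgroup Lor} (hΓ : Disc Γ) {D : Type*} [TopologicalSpace D]
    {S : Set D} (hS : IsPreconnected S) (hne : S.Nonempty) {F : D → Hyp} (hF : Continuous F)
    (h : ∀ d ∈ S, ∃ g ∈ Γ, g ≠ 1 ∧ size (F d) g < 1 / 16) :
    ∃ n, Null n ∧ ∀ d ∈ S, ∀ g ∈ Γ, g ≠ 1 → size (F d) g ≤ 1 / 16 → n ∈ Fix g := by
  obtain ⟨d₀, hd₀⟩ := hne
  obtain ⟨g₀, hg₀, hg₀1, hs₀⟩ := h d₀ hd₀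
  obtain ⟨n, hn⟩ := Fix.nonempty hΓ hg₀ hg₀1
  have hopen : ∀ p : Lor → Prop, IsOpen {d | ∃ g ∈ Γ, g ≠ 1 ∧ size (F d) g < 1 / 16 ∧ p g} := by
    intro p
    have : {d | ∃ g ∈ Γ, g ≠ 1 ∧ size (F d) g < 1 / 16 ∧ p g} =
        ⋃ g ∈ {g : Lor | g ∈ Γ ∧ g ≠ 1 ∧ p g}, {d | size (F d) g < 1 / 16} := by
      ext d
      simp only [mem_ofPred_eq, mem_iUnion, exists_prop]
      constructor
      · rintro ⟨g, h1, h2, h3, h4⟩; exact ⟨g, ⟨h1, h2, h4⟩, h3⟩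
      · rintro ⟨g, ⟨h1, h2, h4⟩, h3⟩; exact ⟨g, h1, h2, h3, h4⟩
    rw [this]
    exact isOpen_biUnion fun g _ =>
      isOpen_lt ((continuous_size g).comp hF) continuous_const
  have hsub : S ⊆ {d | ∃ g ∈ Γ, g ≠ 1 ∧ size (F d) g < 1 / 16 ∧ n ∈ Fix g} := by
    refine hS.subset_left_of_subset_union (hopen fun g => n ∈ Fix g) (hopen fun g => n ∉ Fix g)
      ?_ ?_ ⟨d₀, hd₀, g₀, hg₀, hg₀1, hs₀, hn⟩
    · rw [Set.disjoint_left]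
      rintro d ⟨g, h1, h2, h3, h4⟩ ⟨g', h1', h2', h3', h4'⟩
      rw [hΓ.fix_eq_of_size h1 h2 h1' h2' h3.le h3'.le] at h4'
      exact h4' h4
    · intro d hd
      obtain ⟨g, h1, h2, h3⟩ := h d hd
      by_cases h4 : n ∈ Fix g
      · exact Or.inl ⟨g, h1, h2, h3, h4⟩
      · exact Or.inr ⟨g, h1, h2, h3, h4⟩
  refine ⟨n, hn.1, fun d hd g hg hg1 hs => ?_⟩
  obtain ⟨g', h1, h2, h3, h4⟩ := hsub hd
  rw [hΓ.fix_eq_of_size h1 h2 hg hg1 h3.le hs]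
  exact h4

/-- An open rectangle with a middle part of its lower half removed. -/
def hood (δ : ℝ) : Set (ℝ × ℝ) :=
  Ioo (-1) 1 ×ˢ Ioo 0 δ ∪ Ioo (1 - δ) 1 ×ˢ Ioo 0 1 ∪ Ioo (-1) 1 ×ˢ Ioo (1 - δ) 1

lemma isPreconnected_hood {δ : ℝ} (h0 : 0 < δ) (h1 : δ < 1) : IsPreconnected (hood δ) := by
  have hr : ∀ a b c d : ℝ, IsPreconnected (Ioo a b ×ˢ Ioo c d) := fun a b c d =>
    isPreconnected_Ioo.prod isPreconnected_Ioo
  refine ((hr _ _ _ _).union (1 - δ / 2, δ / 2) ?_ ?_ (hr _ _ _ _)).union (1 - δ / 2, 1 - δ / 2)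
    (Or.inr ?_) ?_ (hr _ _ _ _) <;> constructor <;> constructor <;> dsimp only <;> linarith

lemma hood_subset {δ : ℝ} (h1 : δ < 1) : hood δ ⊆ Ioo (-1) 1 ×ˢ Ioo 0 1 := by
  rintro ⟨t, x⟩ ((⟨⟨a, b⟩, c, d⟩ | ⟨⟨a, b⟩, c, d⟩) | ⟨⟨a, b⟩, c, d⟩) <;> dsimp only at a b c d <;>
    refine ⟨⟨?_, ?_⟩, ?_, ?_⟩ <;> dsimp only <;> linarith

theorem not_homotopic {M X : Type*} [TopologicalSpace M] [ChartedSpace E3 M] [T2Space M]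
    [MetricSpace X] [CompleteSpace X] (hloc : IsLocallyHyperbolic X) (hvol : hypVolume X < ⊤) {L : Set M} {ι : X → M} (hι : IsOpenEmbedding ι)
    (hιr : range ι = Lᶜ) {f : Icc (0 : ℝ) 1 → M} (hf : IsEmbedding f)
    (hfL : ∀ x : Icc (0 : ℝ) 1, f x ∈ L ↔ ((x : ℝ) = 0 ∨ (x : ℝ) = 1))
    (hgeo : IsCompleteEmbeddedGeodesic X (ι ⁻¹' range f)) (H : ℝ → Icc (0 : ℝ) 1 → M)
    (hH : Continuous fun q : ℝ × Icc (0 : ℝ) 1 => H q.1 q.2) (hH0 : ∀ x, H 0 x = f x)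
    (hHend : ∀ t : ℝ, ∀ x : Icc (0 : ℝ) 1, ((x : ℝ) = 0 ∨ (x : ℝ) = 1) → H t x = f x)
    (hHL : ∀ t ∈ Ico (0 : ℝ) 1, ∀ x : Icc (0 : ℝ) 1, (x : ℝ) ≠ 0 → (x : ℝ) ≠ 1 → H t x ∉ L)
    (hH1 : ∀ x, H 1 x ∈ L) : False := by
  let mX : MeasurableSpace X := borel X
  have bX : BorelSpace X := ⟨rfl⟩
  have hfin : μH[3] (univ : Set X) < ⊤ := hvol
  have hX : HypLike X := hypLike_of_chart hloc fun z => by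
    have : Nonempty X := ⟨z⟩
    exact ⟨(hι.toOpenPartialHomeomorph ι).trans (chartAt E3 (ι z)), by simp⟩
  have hιL : ∀ z, ι z ∉ L := fun z => by
    have := mem_range_self (f := ι) z
    rwa [hιr] at this
  obtain ⟨γ, hγ, -, hγr, hγp, hγg⟩ := hgeo
  -- the parameter along the arc
  have hx : ∀ u, ∃ x, f x = ι (γ u) := fun u => by
    have : γ u ∈ ι ⁻¹' range f := hγr ▸ mem_range_self u
    exact this
  choose x hx using hx
  have hxc : Continuous x := hf.isInducing.continuous_iff.2 (by
    have : f ∘ x = ι ∘ γ := funext hx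
    rw [this]; exact hι.continuous.comp hγ)
  have hx01 : ∀ u, (x u : ℝ) ∈ Ioo (0 : ℝ) 1 := by
    intro u
    have h1 : ¬((x u : ℝ) = 0 ∨ (x u : ℝ) = 1) := by
      rw [← hfL, hx]; exact hιL _
    push Not at h1
    exact ⟨(x u).2.1.lt_of_ne' h1.1, (x u).2.2.lt_of_ne h1.2⟩
  -- the homotopy as a map of an open rectangle to the complement
  set A : Set (ℝ × ℝ) := Ioo (-1) 1 ×ˢ Ioo 0 1 with hA
  have hAo : IsOpen A := isOpen_Ioo.prod isOpen_Ioo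
  have hAc : Convex ℝ A := (convex_Ioo _ _).prod (convex_Ioo _ _)
  have hAI : ∀ a : A, a.1.2 ∈ Icc (0 : ℝ) 1 := fun a => Ioo_subset_Icc_self a.2.2
  have hex : ∀ a : A, ∃ z, ι z = H |a.1.1| ⟨a.1.2, hAI a⟩ := fun a => by
    have : H |a.1.1| ⟨a.1.2, hAI a⟩ ∈ range ι := by
      rw [hιr]
      exact hHL _ ⟨abs_nonneg _, abs_lt.2 a.2.1⟩ _ a.2.2.1.ne' a.2.2.2.ne
    exact this
  choose G hG using hex
  have hGc : Continuous G := hι.isInducing.continuous_iff.2 (by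
    have : ι ∘ G = (fun q : ℝ × Icc (0 : ℝ) 1 => H q.1 q.2) ∘
        fun a : A => (|a.1.1|, ⟨a.1.2, hAI a⟩) := funext hG
    rw [this]
    exact hH.comp (by fun_prop))
  -- lifting to the universal cover
  set a : ℝ → A := fun u => ⟨(0, x u), ⟨by norm_num, by norm_num⟩, hx01 u⟩ with ha
  have hac : Continuous a := by
    refine Continuous.subtype_mk ?_ _
    exact continuous_const.prodMk (continuous_subtype_val.comp hxc)
  have hGa : ∀ u, G (a u) = γ u := fun u => hι.injective (by
    rw [hG, ← hx u, ← hH0]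
    simp [ha])
  have : ContractibleSpace A := hAc.contractibleSpace ⟨_, (a 0).2⟩
  have : LocallyPathConnectedSpace A := hAo.locallyPathConnectedSpace
  obtain ⟨ψ, hψ, hψ0⟩ := hX.exists_develop Hyp.e (γ 0)
  have hΓ : Disc (deck ψ) := fun y => hψ.deck_displacement y
  obtain ⟨F, ⟨-, hF⟩, -⟩ := (hX.isCoveringMap hψ).existsUnique_continuousMap_lifts
    ⟨G, hGc⟩ (a 0) Hyp.e (by rw [hψ0]; exact (hGa 0).symm)
  have hFG : ∀ d, ψ (F d) = G d := fun d => congrFun hF d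
  -- the lifted geodesic
  set g : ℝ → Hyp := fun u => F (a u) with hg
  have hgc : Continuous g := F.continuous.comp hac
  have hψg : ∀ u, ψ (g u) = γ u := fun u => (hFG _).trans (hGa u)
  have hgg : ∀ t, ∃ ε > (0 : ℝ), ∀ s₁ ∈ Icc (t - ε) (t + ε), ∀ s₂ ∈ Icc (t - ε) (t + ε),
      dist (g s₁) (g s₂) = |s₁ - s₂| := by
    intro t
    obtain ⟨ε, hε, h1⟩ := hγg t
    obtain ⟨r, hr, h2⟩ := hψ.exists_isoOn (g t)
    obtain ⟨ρ, hρ, h3⟩ := Metric.continuousAt_iff.1 hgc.continuousAt r hr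
    have hm : 0 < min ε (ρ / 2) := lt_min hε (half_pos hρ)
    have hin : ∀ s ∈ Icc (t - min ε (ρ / 2)) (t + min ε (ρ / 2)),
        s ∈ Icc (t - ε) (t + ε) ∧ g s ∈ ball (g t) r := by
      intro s hs
      have e1 := min_le_left ε (ρ / 2)
      have e2 := min_le_right ε (ρ / 2)
      refine ⟨⟨by linarith [hs.1], by linarith [hs.2]⟩, h3 ?_⟩
      rw [Real.dist_eq, abs_lt]
      constructor <;> linarith [hs.1, hs.2]
    refine ⟨_, hm, fun s₁ hs₁ s₂ hs₂ => ?_⟩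
    rw [← h1 s₁ (hin s₁ hs₁).1 s₂ (hin s₂ hs₂).1, ← hψg s₁, ← hψg s₂]
    exact (h2 _ (hin s₁ hs₁).2 _ (hin s₂ hs₂).2).symm
  -- the thin part
  obtain ⟨K, hK, hKs⟩ := hX.exists_compact_size hψ hfin (by norm_num : (0 : ℝ) < 1 / 16)
  obtain ⟨δ, hδ0, hδ1, hδ⟩ : ∃ δ > (0 : ℝ), δ < 1 ∧ ∀ d : A, d.1 ∈ hood δ → G d ∉ K := by
    set S : Set (ℝ × Icc (0 : ℝ) 1) := (Icc (0 : ℝ) 1 ×ˢ univ) ∩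
      (fun q : ℝ × Icc (0 : ℝ) 1 => H q.1 q.2) ⁻¹' (ι '' K) with hSdef
    have hSc : IsCompact S := (isCompact_Icc.prod isCompact_univ).inter_right
      ((hK.image hι.continuous).isClosed.preimage hH)
    have hSL : ∀ q ∈ S, H q.1 q.2 ∉ L := by
      rintro q ⟨-, z, -, hz⟩
      have hz' : ι z = H q.1 q.2 := hz
      rw [← hz']; exact hιL z
    obtain ⟨r, hr, hrS⟩ := hSc.exists_forall_le' (a := (0 : ℝ))
      (f := fun q => min (1 - q.1) (min (q.2 : ℝ) (1 - q.2))) (by fun_prop) (by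
        intro q hq
        have h1 := hSL q hq
        have h2 : q.1 ≠ 1 := fun h => h1 (by rw [h]; exact hH1 _)
        have h3 : ¬((q.2 : ℝ) = 0 ∨ (q.2 : ℝ) = 1) := fun h =>
          h1 (by rw [hHend _ _ h]; exact (hfL _).2 h)
        push Not at h3
        have h4 := hq.1.1.2.lt_of_ne h2
        have h5 := q.2.2.1.lt_of_ne' h3.1
        have h6 := q.2.2.2.lt_of_ne h3.2
        exact lt_min (by linarith) (lt_min h5 (by linarith)))
    refine ⟨min r (1 / 2), lt_min hr (by norm_num), (min_le_right _ _).trans_lt (by norm_num),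
      fun d hd hdK => ?_⟩
    have h1 := hrS (|d.1.1|, ⟨d.1.2, hAI d⟩)
      ⟨⟨⟨abs_nonneg _, (abs_lt.2 d.2.1).le⟩, mem_univ _⟩, G d, hdK, hG d⟩
    simp only [le_min_iff] at h1
    have h2 := min_le_left r (1 / 2)
    have h3 := le_abs_self d.1.1
    rcases hd with (hd | hd) | hd
    · linarith [hd.2.2]
    · linarith [hd.1.1]
    · linarith [hd.2.1]
  set S : Set A := Subtype.val ⁻¹' hood δ with hS
  have hSp : IsPreconnected S := by
    rw [hS, Topology.IsInducing.subtypeVal.isPreconnected_image.symm,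
      Subtype.image_preimage_coe, inter_eq_right.2 (hood_subset hδ1)]
    exact isPreconnected_hood hδ0 hδ1
  have hSne : S.Nonempty := by
    have h : ((0, δ / 2) : ℝ × ℝ) ∈ hood δ :=
      Or.inl (Or.inl ⟨⟨by norm_num, by norm_num⟩, half_pos hδ0, half_lt_self hδ0⟩)
    exact ⟨⟨_, hood_subset hδ1 h⟩, h⟩
  obtain ⟨n, hn, hnS⟩ := hΓ.exists_common_fix hSp hSne F.continuous fun d hd =>
    hKs (F d) (by rw [hFG]; exact hδ d hd)
  have hbdd : ∀ C : Set X, IsCompact C → ∃ R : ℝ, ∀ u, R ≤ |u| → γ u ∉ C := by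
    intro C hC
    obtain ⟨R, hR⟩ := (hγp C hC).isBounded.exists_norm_le
    refine ⟨R + 1, fun u hu huC => ?_⟩
    have := hR u huC
    rw [Real.norm_eq_abs] at this
    linarith
  obtain ⟨R, hR⟩ : ∃ R : ℝ, ∀ u, R ≤ |u| → a u ∈ S := by
    have hcc : IsCompact (ι ⁻¹' (f '' (Subtype.val ⁻¹' Icc δ (1 - δ)))) := by
      refine hι.isInducing.isCompact_preimage_iff ?_ |>.2 ?_
      · rintro _ ⟨y, hy, rfl⟩
        rw [hιr]
        intro h
        rcases (hfL y).1 h with h | h <;> rw [mem_preimage, h] at hy <;> linarith [hy.1, hy.2]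
      · exact ((isClosed_Icc.preimage continuous_subtype_val).isCompact).image hf.continuous
    obtain ⟨R, hR⟩ := hbdd _ hcc
    refine ⟨R, fun u hu => ?_⟩
    have h1 : ¬(δ ≤ (x u : ℝ) ∧ (x u : ℝ) ≤ 1 - δ) := fun h => hR u hu ⟨x u, h, hx u⟩
    have h2 := hx01 u
    rcases lt_or_ge (x u : ℝ) δ with h | h
    · exact Or.inl (Or.inl ⟨⟨by norm_num [ha], by norm_num [ha]⟩, h2.1, h⟩)
    · exact Or.inr ⟨⟨by norm_num [ha], by norm_num [ha]⟩, not_le.1 fun h' => h1 ⟨h, h'⟩, h2.2⟩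
  refine hΓ.not_cuspidal_geodesic hgg hn fun η hη => ?_
  obtain ⟨K', hK', hKs'⟩ := hX.exists_compact_size hψ hfin
    (lt_min hη (by norm_num : (0 : ℝ) < 1 / 16))
  obtain ⟨R', hR'⟩ := hbdd K' hK'
  refine ⟨max R R', fun u hu => ?_⟩
  obtain ⟨k, hk, hk1, hks⟩ := hKs' (g u) (by
    rw [hψg]; exact hR' u ((le_max_right _ _).trans hu))
  exact ⟨k, hk, hk1, hnS (a u) (hR u ((le_max_left _ _).trans hu)) k hk hk1
    (hks.le.trans (min_le_right _ _)), hks.trans_le (min_le_left _ _)⟩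

end HypArc

/-- Let `L` be a link in a 3-manifold `M` whose complement admits a complete
hyperbolic metric `m` of finite volume, and let `α` (parametrized by `f`) be an
arc with endpoints on `L` whose interior is a complete properly embedded geodesic
of `M ∖ L`.  Then `α` cannot be homotoped through `M ∖ L` into `L` while fixing
its endpoints on `L`. -/
theorem geodesic_arc_not_homotopic_into_link
    {M : Type*} [TopologicalSpace M] [ChartedSpace E3 M] [T2Space M]
    (L α : Set M) (hL : IsLink M L)
    (m : MetricSpace ↥(Lᶜ))
    (hm : IsCompleteHyperbolicMetricOfFiniteVolume (↥(Lᶜ)) m)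
    (f : ↥(Icc (0:ℝ) 1) → M) (hf : Topology.IsEmbedding f) (hfr : range f = α)
    (hfL : ∀ x : ↥(Icc (0:ℝ) 1), f x ∈ L ↔ ((x : ℝ) = 0 ∨ (x : ℝ) = 1))
    (hgeo : @IsCompleteEmbeddedGeodesic (↥(Lᶜ)) m (Subtype.val ⁻¹' α)) :
    ¬ ∃ H : ℝ → ↥(Icc (0:ℝ) 1) → M,
        Continuous (fun q : ℝ × ↥(Icc (0:ℝ) 1) => H q.1 q.2) ∧
        (∀ x, H 0 x = f x) ∧
        (∀ t : ℝ, ∀ x : ↥(Icc (0:ℝ) 1), ((x : ℝ) = 0 ∨ (x : ℝ) = 1) → H t x = f x) ∧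
        (∀ t ∈ Ico (0:ℝ) 1, ∀ x : ↥(Icc (0:ℝ) 1),
          (x : ℝ) ≠ 0 → (x : ℝ) ≠ 1 → H t x ∉ L) ∧
        (∀ x, H 1 x ∈ L) := by
  rintro ⟨H, hH, hH0, hHend, hHL, hH1⟩
  obtain ⟨N, c, hc, rfl⟩ := hL
  subst hfr
  obtain ⟨htop, hcomplete, hloc, hvol⟩ := hm
  have hι : @Topology.IsOpenEmbedding _ _ m.toUniformSpace.toTopologicalSpace _
      (Subtype.val : ↥((range c)ᶜ) → M) := by
    rw [htop]
    exact hc.isClosed_range.isOpen_compl.isOpenEmbedding_subtypeVal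
  exact @HypArc.not_homotopic M _ _ _ _ m hcomplete hloc hvol _ _ hι Subtype.range_coe _ hf hfL hgeo H
    hH hH0 hHend hHL hH1
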